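/- arXiv:math/0503443 — 3 statements merged into one kernel-verified Lean document; each statement's English description precedes it below -/
import Mathlib

section
/- For every integer k ≥ 1 there exist constants α > 0 and β > 0 (depending only on k) with the following property: for every integer d ≥ k, every finite set P ⊂ ℝ^d, and every k-flat F, if every (k−1)-flat contains at most α·|P ∩ F| points of P ∩ F, then the number of distinct (k−1)-flats spanned by P ∩ F (i.e., (k−1)-flats that are the affine span of k affinely independent points of P ∩ F) is at least β·|P ∩ F|^k. -/
open scoped Classical

noncomputable section

/-- Points of `d`-dimensional Euclidean space. -/
abbrev Pt (d : ℕ) : Type := EuclideanSpace ℝ (Fin d)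

/-- Closed axis-aligned cube with lower corner `a` and side length `ℓ`. -/
def closedCube {d : ℕ} (a : Fin d → ℝ) (ℓ : ℝ) : Set (Pt d) :=
  {x | ∀ i, a i ≤ x i ∧ x i ≤ a i + ℓ}

/-- Interior of the axis-aligned cube with lower corner `a` and side length `ℓ`. -/
def openCube {d : ℕ} (a : Fin d → ℝ) (ℓ : ℝ) : Set (Pt d) :=
  {x | ∀ i, a i < x i ∧ x i < a i + ℓ}

/-- `P` is `b`-well-separated: every axis-aligned unit cube contains at most `b` points of `P`. -/
def WellSeparated {d : ℕ} (b : ℝ) (P : Finset (Pt d)) : Prop :=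
  ∀ a : Fin d → ℝ, (((↑P : Set (Pt d)) ∩ closedCube a 1).ncard : ℝ) ≤ b

/-- `P` is `b`-homogeneous: it lies in the interior of an axis-aligned cube of volume `|P|`
and every axis-aligned unit cube contains at most `b` of its points. -/
def IsHomogeneous {d : ℕ} (b : ℝ) (P : Finset (Pt d)) : Prop :=
  (∃ a : Fin d → ℝ, (↑P : Set (Pt d)) ⊆ openCube a ((P.card : ℝ) ^ (1 / (d : ℝ)))) ∧
    WellSeparated b P

/-- `F` is a `k`-flat: a `k`-dimensional affine subspace. -/
def IsKFlat {d : ℕ} (k : ℕ) (F : AffineSubspace ℝ (Pt d)) : Prop :=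
  (F : Set (Pt d)).Nonempty ∧ Module.finrank ℝ F.direction = k

/-- `F` is `m`-rich with respect to `P`: it contains at least `m` points of `P`. -/
def IsRich {d : ℕ} (m : ℕ) (P : Finset (Pt d)) (F : AffineSubspace ℝ (Pt d)) : Prop :=
  m ≤ ((↑P : Set (Pt d)) ∩ (F : Set (Pt d))).ncard

/-- The number of distinct distances measured from `p` to the other points of `P`. -/
def distinctDists {d : ℕ} (P : Finset (Pt d)) (p : Pt d) : ℕ :=
  {r : ℝ | ∃ q ∈ P, q ≠ p ∧ dist p q = r}.ncard

/-- The (closed) subcube indexed by `ι` in the subdivision of the cube with corner `a`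
and side `ℓ` into `s^d` congruent subcubes. -/
def subcube {d : ℕ} (a : Fin d → ℝ) (ℓ : ℝ) (s : ℕ) (ι : Fin d → Fin s) : Set (Pt d) :=
  closedCube (fun i => a i + (ι i : ℝ) * (ℓ / s)) (ℓ / s)

/-- The interior of the subcube indexed by `ι`. -/
def openSubcube {d : ℕ} (a : Fin d → ℝ) (ℓ : ℝ) (s : ℕ) (ι : Fin d → Fin s) : Set (Pt d) :=
  openCube (fun i => a i + (ι i : ℝ) * (ℓ / s)) (ℓ / s)

/-! ### Non-crossing straight-line graphs -/

/-- The slope of the chord of the graph of `y` over the interval with endpoints `e`. -/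
def chordSlope (y : ℝ → ℝ) (e : ℝ × ℝ) : ℝ := (y e.2 - y e.1) / (e.2 - e.1)

/-- The affine function whose graph is the chord of the graph of `y` with endpoints `e`. -/
def chord (y : ℝ → ℝ) (e : ℝ × ℝ) (x : ℝ) : ℝ := y e.1 + chordSlope y e * (x - e.1)

/-- The open chords over `e` and `f` have a common point. -/
def Crosses (y : ℝ → ℝ) (e f : ℝ × ℝ) : Prop :=
  ∃ x, e.1 < x ∧ x < e.2 ∧ f.1 < x ∧ x < f.2 ∧ chord y e x = chord y f x

theorem chord_right (y : ℝ → ℝ) {e : ℝ × ℝ} (h : e.1 < e.2) : chord y e e.2 = y e.2 := by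
  have : e.2 - e.1 ≠ 0 := by linarith
  unfold chord chordSlope
  field_simp
  ring

theorem exists_chord_eq (y : ℝ → ℝ) {e f : ℝ × ℝ} {a b : ℝ} (hab : a < b)
    (ha : chord y e a < chord y f a) (hb : chord y f b < chord y e b) :
    ∃ x, a < x ∧ x < b ∧ chord y e x = chord y f x := by
  have hcont : ContinuousOn (fun x => chord y e x - chord y f x) (Set.Icc a b) := by
    unfold chord; fun_prop
  obtain ⟨x, hx, hx0⟩ := intermediate_value_Ioo hab.le hcont
    (show (0 : ℝ) ∈ Set.Ioo _ _ from ⟨by simpa using ha, by simpa using hb⟩)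
  exact ⟨x, hx.1, hx.2, sub_eq_zero.1 hx0⟩

theorem card_le_three_mul_of_not_crosses (y : ℝ → ℝ) (A : Finset ℝ) (E : Finset (ℝ × ℝ))
    (hE : ∀ e ∈ E, e.1 ∈ A ∧ e.2 ∈ A ∧ e.1 < e.2)
    (hv : ∀ e ∈ E, ∀ w ∈ A, e.1 < w → w < e.2 → chord y e w ≠ y w)
    (hc : ∀ e ∈ E, ∀ f ∈ E, e ≠ f → ¬ Crosses y e f) :
    E.card ≤ 3 * A.card := by
  set T := E.filter fun e => ∀ f ∈ E, f.1 = e.1 → chordSlope y f ≤ chordSlope y e with hT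
  have hTcard : T.card ≤ A.card := by
    refine Finset.card_le_card_of_injOn Prod.fst
      (fun e he => (hE e (Finset.mem_filter.1 he).1).1) ?_
    intro e he f hf hef
    obtain ⟨he, he'⟩ := Finset.mem_filter.1 he
    obtain ⟨hf, hf'⟩ := Finset.mem_filter.1 hf
    have hs : chordSlope y e = chordSlope y f := le_antisymm (hf' e he hef) (he' f hf hef.symm)
    have hch : chord y e = chord y f := by
      funext x; unfold chord; rw [hs, hef]
    rcases lt_trichotomy e.2 f.2 with h | h | h
    · exact absurd (by rw [← hch, chord_right y (hE e he).2.2])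
        (hv f hf e.2 (hE e he).2.1 (by rw [← hef]; exact (hE e he).2.2) h)
    · exact Prod.ext hef h
    · exact absurd (by rw [hch, chord_right y (hE f hf).2.2])
        (hv e he f.2 (hE f hf).2.1 (by rw [hef]; exact (hE f hf).2.2) h)
  have key : ∀ e ∈ E \ T, ∃ f ∈ E, ∃ w ∈ A, f.1 = e.1 ∧ chordSlope y e < chordSlope y f ∧
      (∀ g ∈ E, g.1 = e.1 → chordSlope y e < chordSlope y g → chordSlope y f ≤ chordSlope y g) ∧
      e.1 < w ∧ w ≤ e.2 ∧ w ≤ f.2 ∧ chord y e w ≤ y w ∧ y w ≤ chord y f w ∧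
      ∀ z ∈ A, e.1 < z → z < w → y z < chord y e z ∨ chord y f z < y z := by
    intro e he
    obtain ⟨he, heT⟩ := Finset.mem_sdiff.1 he
    have hne : (E.filter fun f => f.1 = e.1 ∧ chordSlope y e < chordSlope y f).Nonempty := by
      by_contra hcon
      refine heT (Finset.mem_filter.2 ⟨he, fun f hf hfe => ?_⟩)
      by_contra hlt
      exact hcon ⟨f, Finset.mem_filter.2 ⟨hf, hfe, not_le.1 hlt⟩⟩
    obtain ⟨f, hf, hmin⟩ := Finset.exists_min_image _ (chordSlope y) hne
    obtain ⟨hf, hfe, hslope⟩ := Finset.mem_filter.1 hf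
    have hle : ∀ x, e.1 < x → chord y e x < chord y f x := by
      intro x hx
      unfold chord
      rw [hfe]
      nlinarith
    have hwne : (A.filter fun w => e.1 < w ∧ w ≤ e.2 ∧ w ≤ f.2 ∧ chord y e w ≤ y w ∧
        y w ≤ chord y f w).Nonempty := by
      rcases le_total e.2 f.2 with h | h
      · refine ⟨e.2, Finset.mem_filter.2 ⟨(hE e he).2.1, (hE e he).2.2, le_rfl, h,
          (chord_right y (hE e he).2.2).le, ?_⟩⟩
        have := hle e.2 (hE e he).2.2
        rw [chord_right y (hE e he).2.2] at this
        exact this.le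
      · have h1 : e.1 < f.2 := by rw [← hfe]; exact (hE f hf).2.2
        refine ⟨f.2, Finset.mem_filter.2 ⟨(hE f hf).2.1, h1, h, le_rfl, ?_,
          (chord_right y (hE f hf).2.2).ge⟩⟩
        have := hle f.2 h1
        rw [chord_right y (hE f hf).2.2] at this
        exact this.le
    obtain ⟨w, hw, hwmin⟩ := Finset.exists_min_image _ id hwne
    obtain ⟨hwA, hw1, hw2, hw3, hw4, hw5⟩ := Finset.mem_filter.1 hw
    refine ⟨f, hf, w, hwA, hfe, hslope, fun g hg hge hs => hmin g (Finset.mem_filter.2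
      ⟨hg, hge, hs⟩), hw1, hw2, hw3, hw4, hw5, fun z hz hz1 hz2 => ?_⟩
    by_contra hcon
    push Not at hcon
    exact absurd (hwmin z (Finset.mem_filter.2 ⟨hz, hz1, by linarith, by linarith, hcon.1,
      hcon.2⟩)) (not_le.2 hz2)
  choose! φ hφE ω hωA hφ1 hslope hmin hω1 hω2 hω3 hω4 hω5 hfirst using key
  have hlt : ∀ e ∈ E \ T, ∀ x, e.1 < x → chord y e x < chord y (φ e) x := by
    intro e he x hx
    unfold chord
    rw [hφ1 e he]
    nlinarith [hslope e he]
  have hcase : ∀ e ∈ E \ T, ∀ f ∈ E \ T, ω e = ω f → e.1 < f.1 →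
      chord y e (ω e) < chord y (φ f) (ω e) → chord y f (ω e) < chord y (φ e) (ω e) → False := by
    intro e he f hf hω hef h1 h2
    have heE := (Finset.mem_sdiff.1 he).1
    have hfE := (Finset.mem_sdiff.1 hf).1
    have hfw : f.1 < ω e := hω ▸ hω1 f hf
    have hyf : ∀ g : ℝ × ℝ, g.1 = f.1 → chord y g f.1 = y f.1 := by
      intro g hg; unfold chord; rw [hg]; ring
    rcases hfirst e he f.1 (hE f hfE).1 hef hfw with h | h
    · obtain ⟨x, hx1, hx2, hx⟩ := exists_chord_eq y (e := φ f) (f := e) hfw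
        (by rw [hyf _ (hφ1 f hf)]; exact h) h1
      refine hc (φ f) (hφE f hf) e heE ?_ ⟨x, by rw [hφ1 f hf]; exact hx1, ?_, by linarith, ?_, hx⟩
      · intro h'
        have := hφ1 f hf
        rw [h'] at this
        linarith
      · have := hω3 f hf
        rw [← hω] at this
        linarith
      · have := hω2 e he
        linarith
    · obtain ⟨x, hx1, hx2, hx⟩ := exists_chord_eq y (e := φ e) (f := f) hfw
        (by rw [hyf _ rfl]; exact h) h2
      refine hc (φ e) (hφE e he) f hfE ?_
        ⟨x, by rw [hφ1 e he]; linarith, ?_, hx1, ?_, hx⟩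
      · intro h'
        have := hφ1 e he
        rw [h'] at this
        linarith
      · have := hω3 e he
        linarith
      · have := hω2 f hf
        rw [← hω] at this
        linarith
  set S₁ := (E \ T).filter fun e => chord y e (ω e) = y (ω e) with hS₁
  set S₂ := (E \ T).filter fun e => ¬ chord y e (ω e) = y (ω e) with hS₂
  have hend : ∀ e ∈ S₁, ω e = e.2 := by
    intro e he
    obtain ⟨he, h⟩ := Finset.mem_filter.1 he
    by_contra hne
    exact hv e (Finset.mem_sdiff.1 he).1 (ω e) (hωA e he) (hω1 e he)
      (lt_of_le_of_ne (hω2 e he) hne) h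
  have hcard₁ : S₁.card ≤ A.card := by
    refine Finset.card_le_card_of_injOn ω (fun e he => hωA e (Finset.mem_filter.1 he).1) ?_
    have hno : ∀ e ∈ S₁, ∀ f ∈ S₁, ω e = ω f → ¬ e.1 < f.1 := by
      intro e he f hf hω hef
      obtain ⟨he, he'⟩ := Finset.mem_filter.1 he
      obtain ⟨hf, hf'⟩ := Finset.mem_filter.1 hf
      refine hcase e he f hf hω hef ?_ ?_
      · have := hlt f hf (ω f) (hω1 f hf)
        rw [he', hω, ← hf']; exact this
      · have := hlt e he (ω e) (hω1 e he)
        rw [hω, hf', ← hω, ← he']; exact this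
    intro e he f hf hω
    refine Prod.ext ?_ ?_
    · exact le_antisymm (not_lt.1 (hno f hf e he hω.symm)) (not_lt.1 (hno e he f hf hω))
    · rw [← hend e he, ← hend f hf, hω]
  have hcard₂ : S₂.card ≤ A.card := by
    refine Finset.card_le_card_of_injOn ω (fun e he => hωA e (Finset.mem_filter.1 he).1) ?_
    have hno : ∀ e ∈ S₂, ∀ f ∈ S₂, ω e = ω f → ¬ e.1 < f.1 := by
      intro e he f hf hω hef
      obtain ⟨he, he'⟩ := Finset.mem_filter.1 he
      obtain ⟨hf, hf'⟩ := Finset.mem_filter.1 hf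
      refine hcase e he f hf hω hef ?_ ?_
      · have := hω5 f hf
        rw [← hω] at this
        exact lt_of_lt_of_le (lt_of_le_of_ne (hω4 e he) he') this
      · have := hω5 e he
        refine lt_of_lt_of_le ?_ this
        rw [hω]
        exact lt_of_le_of_ne (hω4 f hf) hf'
    have hno' : ∀ e ∈ S₂, ∀ f ∈ S₂, ω e = ω f → e.1 = f.1 →
        ¬ chordSlope y e < chordSlope y f := by
      intro e he f hf hω hef hs
      obtain ⟨he, he'⟩ := Finset.mem_filter.1 he
      obtain ⟨hf, hf'⟩ := Finset.mem_filter.1 hf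
      have h1 := hmin e he f (Finset.mem_sdiff.1 hf).1 hef.symm hs
      have h2 : chord y (φ e) (ω e) ≤ chord y f (ω e) := by
        unfold chord
        rw [hφ1 e he, ← hef]
        nlinarith [hω1 e he]
      have h3 := lt_of_le_of_ne (hω4 f hf) hf'
      rw [← hω] at h3
      linarith [hω5 e he]
    intro e he f hf hω
    have h1 : e.1 = f.1 :=
      le_antisymm (not_lt.1 (hno f hf e he hω.symm)) (not_lt.1 (hno e he f hf hω))
    have hs : chordSlope y e = chordSlope y f :=
      le_antisymm (not_lt.1 (hno' f hf e he hω.symm h1.symm)) (not_lt.1 (hno' e he f hf hω h1))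
    have hch : chord y e = chord y f := by
      funext x; unfold chord; rw [hs, h1]
    have heE := (Finset.mem_sdiff.1 (Finset.mem_filter.1 he).1).1
    have hfE := (Finset.mem_sdiff.1 (Finset.mem_filter.1 hf).1).1
    rcases lt_trichotomy e.2 f.2 with h | h | h
    · exact absurd (by rw [← hch, chord_right y (hE e heE).2.2])
        (hv f hfE e.2 (hE e heE).2.1 (by rw [← h1]; exact (hE e heE).2.2) h)
    · exact Prod.ext h1 h
    · exact absurd (by rw [hch, chord_right y (hE f hfE).2.2])
        (hv e heE f.2 (hE f hfE).2.1 (by rw [h1]; exact (hE f hfE).2.2) h)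
  have h1 : S₁.card + S₂.card = (E \ T).card := Finset.card_filter_add_card_filter_not _
  have h2 : (E \ T).card + T.card = E.card :=
    Finset.card_sdiff_add_card_eq_card (Finset.filter_subset _ _)
  omega

/-! ### The crossing inequality -/

/-- The ordered pairs of distinct crossing edges. -/
def crossingPairs (y : ℝ → ℝ) (E : Finset (ℝ × ℝ)) : Finset ((ℝ × ℝ) × (ℝ × ℝ)) :=
  (E ×ˢ E).filter fun p => p.1 ≠ p.2 ∧ Crosses y p.1 p.2

theorem mem_crossingPairs {y : ℝ → ℝ} {E : Finset (ℝ × ℝ)} {p : (ℝ × ℝ) × (ℝ × ℝ)} :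
    p ∈ crossingPairs y E ↔ (p.1 ∈ E ∧ p.2 ∈ E) ∧ p.1 ≠ p.2 ∧ Crosses y p.1 p.2 := by
  simp [crossingPairs]

theorem card_le_three_mul_add_crossingPairs (y : ℝ → ℝ) (A : Finset ℝ) (E : Finset (ℝ × ℝ))
    (hE : ∀ e ∈ E, e.1 ∈ A ∧ e.2 ∈ A ∧ e.1 < e.2)
    (hv : ∀ e ∈ E, ∀ w ∈ A, e.1 < w → w < e.2 → chord y e w ≠ y w) :
    E.card ≤ 3 * A.card + (crossingPairs y E).card := by
  induction E using Finset.strongInduction with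
  | H E ih =>
    by_cases hc : ∀ e ∈ E, ∀ f ∈ E, e ≠ f → ¬ Crosses y e f
    · exact (card_le_three_mul_of_not_crosses y A E hE hv hc).trans (Nat.le_add_right _ _)
    push Not at hc
    obtain ⟨e, he, f, hf, hef, hcr⟩ := hc
    have h1 := ih (E.erase e) (Finset.erase_ssubset he)
      (fun g hg => hE g (Finset.mem_of_mem_erase hg))
      (fun g hg => hv g (Finset.mem_of_mem_erase hg))
    have h2 : (crossingPairs y (E.erase e)).card < (crossingPairs y E).card := by
      refine Finset.card_lt_card (Finset.ssubset_iff_subset_ne.2 ⟨fun p hp => ?_, fun h => ?_⟩)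
      · rw [mem_crossingPairs] at hp ⊢
        exact ⟨⟨Finset.mem_of_mem_erase hp.1.1, Finset.mem_of_mem_erase hp.1.2⟩, hp.2⟩
      · have : (e, f) ∈ crossingPairs y E := mem_crossingPairs.2 ⟨⟨he, hf⟩, hef, hcr⟩
        rw [← h, mem_crossingPairs] at this
        exact Finset.notMem_erase e E this.1.1
    have h3 := Finset.card_erase_add_one he
    omega

theorem chord_eq_of_eq_at_two (y : ℝ → ℝ) {e f : ℝ × ℝ} {a b : ℝ} (hab : a ≠ b)
    (ha : chord y e a = chord y f a) (hb : chord y e b = chord y f b) :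
    chord y e = chord y f := by
  have h : (chordSlope y e - chordSlope y f) * (a - b) = 0 := by
    unfold chord at ha hb; linarith
  have h' : chordSlope y e = chordSlope y f := by
    rcases mul_eq_zero.1 h with h | h
    · linarith
    · exact absurd (by linarith) hab
  funext x
  unfold chord at ha ⊢
  rw [h'] at ha ⊢
  linarith

theorem endpoints_ne_of_crosses (y : ℝ → ℝ) (A : Finset ℝ) (E : Finset (ℝ × ℝ))
    (hE : ∀ e ∈ E, e.1 ∈ A ∧ e.2 ∈ A ∧ e.1 < e.2)
    (hv : ∀ e ∈ E, ∀ w ∈ A, e.1 < w → w < e.2 → chord y e w ≠ y w)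
    {e f : ℝ × ℝ} (he : e ∈ E) (hf : f ∈ E) (hef : e ≠ f) (hc : Crosses y e f) :
    e.1 ≠ f.1 ∧ e.1 ≠ f.2 ∧ e.2 ≠ f.1 ∧ e.2 ≠ f.2 := by
  obtain ⟨x, h1, h2, h3, h4, hx⟩ := hc
  have hl : ∀ g : ℝ × ℝ, chord y g g.1 = y g.1 := by intro g; unfold chord; ring
  have her := chord_right y (hE e he).2.2
  have hfr := chord_right y (hE f hf).2.2
  refine ⟨fun h => ?_, by linarith, by linarith, fun h => ?_⟩
  · have hch : chord y e = chord y f := chord_eq_of_eq_at_two y h1.ne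
      (by rw [hl e, h, hl f]) hx
    rcases lt_trichotomy e.2 f.2 with h' | h' | h'
    · exact hv f hf e.2 (hE e he).2.1 (by linarith) h' (by rw [← hch, her])
    · exact hef (Prod.ext h h')
    · exact hv e he f.2 (hE f hf).2.1 (by linarith) h' (by rw [hch, hfr])
  · have hch : chord y e = chord y f := chord_eq_of_eq_at_two y h2.ne'
      (by rw [her, h, hfr]) hx
    rcases lt_trichotomy e.1 f.1 with h' | h' | h'
    · exact hv e he f.1 (hE f hf).1 h' (by linarith) (by rw [hch, hl])
    · exact hef (Prod.ext h' h)
    · exact hv f hf e.1 (hE e he).1 h' (by linarith) (by rw [← hch, hl])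

theorem pow_card_mul_card_agree {α : Type*} [Fintype α] {m : ℕ} (c : α → Fin m) (T : Finset α) :
    m ^ T.card * (Finset.univ.filter fun f : α → Fin m => ∀ a ∈ T, f a = c a).card =
      m ^ Fintype.card α := by
  have h : (Finset.univ.filter fun f : α → Fin m => ∀ a ∈ T, f a = c a) =
      Fintype.piFinset fun a => if a ∈ T then {c a} else Finset.univ := by
    ext f
    simp only [Finset.mem_filter, Finset.mem_univ, true_and, Fintype.mem_piFinset]
    refine forall_congr' fun a => ?_
    by_cases ha : a ∈ T <;> simp [ha]
  have h2 : ∀ a, (if a ∈ T then ({c a} : Finset (Fin m)) else Finset.univ).card =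
      if a ∈ T then 1 else m := by
    intro a; by_cases ha : a ∈ T <;> simp [ha]
  rw [h, Fintype.card_piFinset, Finset.prod_congr rfl fun a _ => h2 a, Finset.prod_ite]
  simp only [Finset.prod_const, one_pow, one_mul]
  rw [← pow_add, ← Finset.card_univ, ← Finset.card_filter_add_card_filter_not
    (s := (Finset.univ : Finset α)) (fun a => a ∈ T)]
  congr 3
  ext a; simp

theorem pow_mul_sum_card_agree {β : Type*} {m : ℕ} (A : Finset ℝ) (c : Fin m) (U : Finset β)
    (t : β → Finset ℝ) (k : ℕ) (htA : ∀ b ∈ U, t b ⊆ A) (htk : ∀ b ∈ U, (t b).card = k) :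
    m ^ k * ∑ f : A → Fin m, (U.filter fun b => ∀ a : A, a.1 ∈ t b → f a = c).card =
      U.card * m ^ A.card := by
  simp_rw [Finset.card_filter]
  rw [Finset.sum_comm, Finset.mul_sum, ← smul_eq_mul (U.card), ← Finset.sum_const]
  refine Finset.sum_congr rfl fun b hb => ?_
  have h := pow_card_mul_card_agree (fun _ => c) ((t b).subtype (· ∈ A))
  rw [Finset.card_subtype, Finset.filter_true_of_mem (fun x hx => htA b hb hx), htk b hb,
    Fintype.card_coe] at h
  simp only [Finset.mem_subtype] at h
  rw [← h, Finset.card_filter]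
  congr!

/-- The amplified crossing inequality for a straight-line graph. -/
theorem card_mul_sq_le (y : ℝ → ℝ) (A : Finset ℝ) (E : Finset (ℝ × ℝ))
    (hE : ∀ e ∈ E, e.1 ∈ A ∧ e.2 ∈ A ∧ e.1 < e.2)
    (hv : ∀ e ∈ E, ∀ w ∈ A, e.1 < w → w < e.2 → chord y e w ≠ y w) {m : ℕ} (hm : 0 < m) :
    E.card * m ^ 2 ≤ 3 * A.card * m ^ 3 + (crossingPairs y E).card := by
  let c : Fin m := ⟨0, hm⟩
  have hV := pow_mul_sum_card_agree A c A (fun a => {a}) 1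
    (by simp) (by simp)
  have hEd := pow_mul_sum_card_agree A c E (fun e => {e.1, e.2}) 2
    (by
      intro e he x hx
      simp only [Finset.mem_insert, Finset.mem_singleton] at hx
      rcases hx with rfl | rfl
      · exact (hE e he).1
      · exact (hE e he).2.1)
    (fun e he => Finset.card_pair (hE e he).2.2.ne)
  have hX := pow_mul_sum_card_agree A c (crossingPairs y E)
    (fun p => {p.1.1, p.1.2, p.2.1, p.2.2}) 4
    (by
      intro p hp x hx
      obtain ⟨⟨hp1, hp2⟩, -⟩ := mem_crossingPairs.1 hp
      simp only [Finset.mem_insert, Finset.mem_singleton] at hx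
      rcases hx with rfl | rfl | rfl | rfl
      · exact (hE _ hp1).1
      · exact (hE _ hp1).2.1
      · exact (hE _ hp2).1
      · exact (hE _ hp2).2.1)
    (by
      intro p hp
      obtain ⟨⟨hp1, hp2⟩, hne, hcr⟩ := mem_crossingPairs.1 hp
      obtain ⟨h1, h2, h3, h4⟩ := endpoints_ne_of_crosses y A E hE hv hp1 hp2 hne hcr
      have h5 := (hE _ hp1).2.2.ne
      have h6 := (hE _ hp2).2.2.ne
      rw [Finset.card_insert_of_notMem, Finset.card_insert_of_notMem, Finset.card_pair h6]
      · simp [h3, h4]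
      · simp [h1, h2, h5])
  have hf : ∀ f : A → Fin m,
      (E.filter fun e => ∀ a : A, a.1 ∈ ({e.1, e.2} : Finset ℝ) → f a = c).card ≤
      3 * (A.filter fun u => ∀ a : A, a.1 ∈ ({u} : Finset ℝ) → f a = c).card +
      ((crossingPairs y E).filter fun p => ∀ a : A,
        a.1 ∈ ({p.1.1, p.1.2, p.2.1, p.2.2} : Finset ℝ) → f a = c).card := by
    intro f
    refine (card_le_three_mul_add_crossingPairs y
      (A.filter fun u => ∀ a : A, a.1 ∈ ({u} : Finset ℝ) → f a = c) _ ?_ ?_).trans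
      (Nat.add_le_add_left (Finset.card_le_card ?_) _)
    · intro e he
      obtain ⟨he, h⟩ := Finset.mem_filter.1 he
      refine ⟨Finset.mem_filter.2 ⟨(hE e he).1, fun a ha => h a ?_⟩,
        Finset.mem_filter.2 ⟨(hE e he).2.1, fun a ha => h a ?_⟩, (hE e he).2.2⟩ <;>
      simp [Finset.mem_singleton.1 ha]
    · intro e he w hw
      exact hv e (Finset.mem_filter.1 he).1 w (Finset.mem_filter.1 hw).1
    · intro p hp
      obtain ⟨⟨hp1, hp2⟩, hne, hcr⟩ := mem_crossingPairs.1 hp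
      obtain ⟨hp1, h1⟩ := Finset.mem_filter.1 hp1
      obtain ⟨hp2, h2⟩ := Finset.mem_filter.1 hp2
      refine Finset.mem_filter.2 ⟨mem_crossingPairs.2 ⟨⟨hp1, hp2⟩, hne, hcr⟩, fun a ha => ?_⟩
      simp only [Finset.mem_insert, Finset.mem_singleton] at ha h1 h2
      rcases ha with ha | ha | ha | ha
      · exact h1 a (Or.inl ha)
      · exact h1 a (Or.inr ha)
      · exact h2 a (Or.inl ha)
      · exact h2 a (Or.inr ha)
  have hsum := Finset.sum_le_sum fun f (_ : f ∈ (Finset.univ : Finset (A → Fin m))) => hf f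
  rw [Finset.sum_add_distrib, ← Finset.mul_sum] at hsum
  refine Nat.le_of_mul_le_mul_right ?_ (pow_pos hm A.card)
  calc E.card * m ^ 2 * m ^ A.card = m ^ 2 * (E.card * m ^ A.card) := by ring
    _ ≤ _ := ?_
  rw [← hEd, add_mul, ← hX, show 3 * A.card * m ^ 3 * m ^ A.card =
    3 * m ^ 3 * (A.card * m ^ A.card) by ring, ← hV]
  calc _ ≤ m ^ 2 * (m ^ 2 * (3 * _ + _)) :=
        Nat.mul_le_mul_left _ (Nat.mul_le_mul_left _ hsum)
    _ = _ := by ring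

/-! ### The Szemerédi–Trotter bound for rich lines -/

/-- The abscissae in `A` at which the graph of `y` meets the line `x ↦ l.1 * x + l.2`. -/
def onLine (y : ℝ → ℝ) (A : Finset ℝ) (l : ℝ × ℝ) : Finset ℝ :=
  A.filter fun x => y x = l.1 * x + l.2

/-- The pairs of consecutive points of `onLine y A l`. -/
def lineEdges (y : ℝ → ℝ) (A : Finset ℝ) (l : ℝ × ℝ) : Finset (ℝ × ℝ) :=
  (onLine y A l ×ˢ onLine y A l).filter fun e =>
    e.1 < e.2 ∧ ∀ w ∈ onLine y A l, e.1 < w → ¬ w < e.2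

theorem mem_onLine {y : ℝ → ℝ} {A : Finset ℝ} {l : ℝ × ℝ} {x : ℝ} :
    x ∈ onLine y A l ↔ x ∈ A ∧ y x = l.1 * x + l.2 := by simp [onLine]

theorem mem_lineEdges {y : ℝ → ℝ} {A : Finset ℝ} {l e : ℝ × ℝ} :
    e ∈ lineEdges y A l ↔ (e.1 ∈ onLine y A l ∧ e.2 ∈ onLine y A l) ∧ e.1 < e.2 ∧
      ∀ w ∈ onLine y A l, e.1 < w → ¬ w < e.2 := by simp [lineEdges]

theorem line_eq_of_eq_at_two {l l' : ℝ × ℝ} {a b : ℝ} (hab : a ≠ b)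
    (ha : l.1 * a + l.2 = l'.1 * a + l'.2) (hb : l.1 * b + l.2 = l'.1 * b + l'.2) : l = l' := by
  have h : (l.1 - l'.1) * (a - b) = 0 := by linarith
  have h' : l.1 = l'.1 := by
    rcases mul_eq_zero.1 h with h | h
    · linarith
    · exact absurd (by linarith) hab
  refine Prod.ext h' ?_
  rw [h'] at ha
  linarith

theorem chord_eq_line {y : ℝ → ℝ} {A : Finset ℝ} {l e : ℝ × ℝ} (he : e ∈ lineEdges y A l) (x : ℝ) :
    chord y e x = l.1 * x + l.2 := by
  obtain ⟨⟨h1, h2⟩, hlt, -⟩ := mem_lineEdges.1 he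
  have h1 := (mem_onLine.1 h1).2
  have h2 := (mem_onLine.1 h2).2
  have hs : chordSlope y e = l.1 := by
    unfold chordSlope
    rw [div_eq_iff (by linarith), h1, h2]
    ring
  unfold chord
  rw [hs, h1]
  ring

theorem lineEdges_eq_of_mem_inter {y : ℝ → ℝ} {A : Finset ℝ} {l e f : ℝ × ℝ}
    (he : e ∈ lineEdges y A l) (hf : f ∈ lineEdges y A l) {x : ℝ} (h1 : e.1 < x) (h2 : x < e.2)
    (h3 : f.1 < x) (h4 : x < f.2) : e = f := by
  obtain ⟨⟨he1, he2⟩, -, he⟩ := mem_lineEdges.1 he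
  obtain ⟨⟨hf1, hf2⟩, -, hf⟩ := mem_lineEdges.1 hf
  refine Prod.ext ?_ ?_
  · rcases lt_trichotomy e.1 f.1 with h | h | h
    · exact absurd (by linarith) (he _ hf1 h)
    · exact h
    · exact absurd (by linarith) (hf _ he1 h)
  · rcases lt_trichotomy e.2 f.2 with h | h | h
    · exact absurd h (hf _ he2 (by linarith))
    · exact h
    · exact absurd h (he _ hf2 (by linarith))

theorem card_onLine_le_card_lineEdges (y : ℝ → ℝ) (A : Finset ℝ) (l : ℝ × ℝ) :
    (onLine y A l).card ≤ (lineEdges y A l).card + 1 := by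
  rcases (onLine y A l).eq_empty_or_nonempty with h | h
  · simp [h]
  have hsub : (onLine y A l).erase ((onLine y A l).max' h) ⊆ (lineEdges y A l).image Prod.fst := by
    intro u hu
    obtain ⟨hne, hu⟩ := Finset.mem_erase.1 hu
    have hlt : u < (onLine y A l).max' h := lt_of_le_of_ne (Finset.le_max' _ _ hu) hne
    have hS : ((onLine y A l).filter (u < ·)).Nonempty :=
      ⟨_, Finset.mem_filter.2 ⟨Finset.max'_mem _ h, hlt⟩⟩
    obtain ⟨v, hv, hmin⟩ := Finset.exists_min_image _ id hS
    obtain ⟨hv, huv⟩ := Finset.mem_filter.1 hv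
    refine Finset.mem_image.2 ⟨(u, v), mem_lineEdges.2 ⟨⟨hu, hv⟩, huv, fun w hw h1 h2 => ?_⟩, rfl⟩
    exact absurd (hmin w (Finset.mem_filter.2 ⟨hw, h1⟩)) (not_le.2 h2)
  have h1 := (Finset.card_le_card hsub).trans Finset.card_image_le
  rw [Finset.card_erase_of_mem (Finset.max'_mem _ h)] at h1
  omega

theorem lines_mul_sq_le (y : ℝ → ℝ) (A : Finset ℝ) (L : Finset (ℝ × ℝ)) {t m : ℕ} (hm : 0 < m)
    (ht : ∀ l ∈ L, t + 1 ≤ (onLine y A l).card) :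
    L.card * t * m ^ 2 ≤ 3 * A.card * m ^ 3 + L.card ^ 2 := by
  set E := L.biUnion (lineEdges y A) with hEdef
  have hline : ∀ e ∈ E, ∃ l ∈ L, e ∈ lineEdges y A l := fun e he => Finset.mem_biUnion.1 he
  choose! lam hlamL hlam using hline
  have hE : ∀ e ∈ E, e.1 ∈ A ∧ e.2 ∈ A ∧ e.1 < e.2 := by
    intro e he
    obtain ⟨⟨h1, h2⟩, h3, -⟩ := mem_lineEdges.1 (hlam e he)
    exact ⟨(mem_onLine.1 h1).1, (mem_onLine.1 h2).1, h3⟩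
  have hv : ∀ e ∈ E, ∀ w ∈ A, e.1 < w → w < e.2 → chord y e w ≠ y w := by
    intro e he w hw h1 h2 h
    rw [chord_eq_line (hlam e he)] at h
    exact (mem_lineEdges.1 (hlam e he)).2.2 w (mem_onLine.2 ⟨hw, h.symm⟩) h1 h2
  have hcard : L.card * t ≤ E.card := by
    rw [hEdef, Finset.card_biUnion, ← smul_eq_mul, ← Finset.sum_const]
    · refine Finset.sum_le_sum fun l hl => ?_
      have := card_onLine_le_card_lineEdges y A l
      have := ht l hl
      omega
    · intro l hl l' hl' hne
      refine Finset.disjoint_left.2 fun e he he' => hne ?_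
      refine line_eq_of_eq_at_two (mem_lineEdges.1 he).2.1.ne ?_ ?_
      · rw [← chord_eq_line he, chord_eq_line he']
      · rw [← chord_eq_line he, chord_eq_line he']
  have hX : (crossingPairs y E).card ≤ L.card ^ 2 := by
    rw [sq, ← Finset.card_product]
    refine Finset.card_le_card_of_injOn (fun p => (lam p.1, lam p.2)) ?_ ?_
    · intro p hp
      obtain ⟨⟨h1, h2⟩, -⟩ := mem_crossingPairs.1 hp
      exact Finset.mem_product.2 ⟨hlamL _ h1, hlamL _ h2⟩
    · intro p hp q hq hpq
      obtain ⟨⟨hp1, hp2⟩, hpne, x, hx1, hx2, hx3, hx4, hx⟩ := mem_crossingPairs.1 hp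
      obtain ⟨⟨hq1, hq2⟩, hqne, z, hz1, hz2, hz3, hz4, hz⟩ := mem_crossingPairs.1 hq
      obtain ⟨e1, e2⟩ := Prod.mk.inj hpq
      have hne : lam p.1 ≠ lam p.2 := fun h =>
        hpne (lineEdges_eq_of_mem_inter (hlam _ hp1) (h ▸ hlam _ hp2) hx1 hx2 hx3 hx4)
      rw [chord_eq_line (hlam _ hp1), chord_eq_line (hlam _ hp2)] at hx
      rw [chord_eq_line (hlam _ hq1), chord_eq_line (hlam _ hq2), ← e1, ← e2] at hz
      have hxz : x = z := by
        by_contra hxz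
        exact hne (line_eq_of_eq_at_two hxz hx hz)
      subst hxz
      exact Prod.ext
        (lineEdges_eq_of_mem_inter (hlam _ hp1) (e1 ▸ hlam _ hq1) hx1 hx2 hz1 hz2)
        (lineEdges_eq_of_mem_inter (hlam _ hp2) (e2 ▸ hlam _ hq2) hx3 hx4 hz3 hz4)
  have := card_mul_sq_le y A E hE hv hm
  calc _ ≤ E.card * m ^ 2 := Nat.mul_le_mul_right _ hcard
    _ ≤ _ := this
    _ ≤ _ := Nat.add_le_add_left hX _

/-- The number of lines containing at least `t ≥ 2` of `n` points is `O(n² / t³ + n / t)`. -/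
theorem card_rich_lines_le (y : ℝ → ℝ) (A : Finset ℝ) (L : Finset (ℝ × ℝ)) {t : ℕ} (ht2 : 2 ≤ t)
    (ht : ∀ l ∈ L, t ≤ (onLine y A l).card) :
    (L.card : ℝ) * t ^ 3 ≤ 2304 * ((A.card : ℝ) ^ 2 + A.card * t ^ 2) := by
  have htpos : (2 : ℝ) ≤ t := by exact_mod_cast ht2
  by_cases hsmall : (L.card : ℝ) * t < 12 * A.card
  · have : (0 : ℝ) ≤ (A.card : ℝ) ^ 2 := by positivity
    nlinarith [mul_le_mul_of_nonneg_right hsmall.le (sq_nonneg (t : ℝ)),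
      mul_nonneg (Nat.cast_nonneg (α := ℝ) A.card) (sq_nonneg (t : ℝ))]
  push Not at hsmall
  rcases L.eq_empty_or_nonempty with rfl | ⟨l, hl⟩
  · simp; positivity
  have hA : 0 < (A.card : ℝ) := by
    have h1 := (ht l hl).trans (Finset.card_le_card (Finset.filter_subset _ _))
    exact_mod_cast (by omega : 0 < A.card)
  have hL : 0 < (L.card : ℝ) := by exact_mod_cast Finset.card_pos.2 ⟨l, hl⟩
  set z : ℝ := (L.card : ℝ) * t / (12 * A.card) with hz
  have hz1 : 1 ≤ z := by rw [hz, le_div_iff₀ (by positivity)]; linarith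
  have hm : 0 < ⌊z⌋₊ := Nat.floor_pos.2 hz1
  have hm1 : (⌊z⌋₊ : ℝ) ≤ z := Nat.floor_le (by linarith)
  have hm2 : z / 2 ≤ ⌊z⌋₊ := by
    have h1 := Nat.lt_floor_add_one z
    have h2 : (1 : ℝ) ≤ ⌊z⌋₊ := by exact_mod_cast hm
    linarith
  have hmain := lines_mul_sq_le y A L (t := t - 1) hm (fun l hl => by have := ht l hl; omega)
  have hmain' : (L.card : ℝ) * ((t - 1 : ℕ) : ℝ) * (⌊z⌋₊ : ℝ) ^ 2 ≤
      3 * A.card * (⌊z⌋₊ : ℝ) ^ 3 + (L.card : ℝ) ^ 2 := by exact_mod_cast hmain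
  rw [Nat.cast_sub (by omega), Nat.cast_one] at hmain'
  have hzA : z * (12 * A.card) = L.card * t := by rw [hz]; field_simp
  generalize (⌊z⌋₊ : ℝ) = μ at *
  have h1 : 3 * A.card * μ ^ 3 ≤ (L.card : ℝ) * t / 4 * μ ^ 2 := by
    have : 3 * A.card * μ ≤ (L.card : ℝ) * t / 4 := by nlinarith
    nlinarith [mul_le_mul_of_nonneg_right this (sq_nonneg μ)]
  have h2 : (L.card : ℝ) * t / 2 * μ ^ 2 ≤ L.card * (t - 1) * μ ^ 2 :=
    mul_le_mul_of_nonneg_right (by nlinarith) (sq_nonneg μ)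
  have h3 : (L.card : ℝ) * (t * μ ^ 2) ≤ L.card * (4 * L.card) := by nlinarith
  have h4 : t * μ ^ 2 ≤ 4 * (L.card : ℝ) := le_of_mul_le_mul_left h3 hL
  have h5 : t * (z / 2) ^ 2 ≤ 4 * (L.card : ℝ) := by
    refine le_trans ?_ h4
    gcongr
  have h6 : t * (z * (12 * A.card)) ^ 2 ≤ L.card * (2304 * (A.card : ℝ) ^ 2) := by
    have := mul_le_mul_of_nonneg_right h5 (by positivity : (0 : ℝ) ≤ 576 * (A.card : ℝ) ^ 2)
    nlinarith
  rw [hzA] at h6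
  have h7 : (L.card : ℝ) * (L.card * t ^ 3) ≤ L.card * (2304 * (A.card : ℝ) ^ 2) := by
    linarith [h6]
  have h8 := le_of_mul_le_mul_left h7 hL
  have : 0 ≤ (A.card : ℝ) * t ^ 2 := by positivity
  linarith

/-! ### Pairs of points on rich lines -/

theorem card_le_mul_card_of_fiber_le {α β : Type*} (S : Finset α) (T : Finset β) (f : α → β)
    (hf : ∀ a ∈ S, f a ∈ T) (c : ℝ) (hc : ∀ b ∈ T, ((S.filter fun a => f a = b).card : ℝ) ≤ c) :
    (S.card : ℝ) ≤ c * T.card := by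
  rw [Finset.card_eq_sum_card_fiberwise hf]
  push_cast
  refine (Finset.sum_le_sum hc).trans ?_
  rw [Finset.sum_const, nsmul_eq_mul, mul_comm]

theorem sum_Ico_dyadic_le {a b : ℝ} (hb : 0 ≤ b) {i J : ℕ} (hiJ : i ≤ J) :
    ∑ k ∈ Finset.Ico i J, (a / 2 ^ k + b * 2 ^ k) ≤ a * (2 / 2 ^ i - 2 / 2 ^ J) + b * 2 ^ J := by
  induction J, hiJ using Nat.le_induction with
  | base => simp; positivity
  | succ J hJ ih =>
    rw [Finset.sum_Ico_succ_top hJ, pow_succ]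
    have h : (2 : ℝ) / (2 ^ J * 2) = 1 / 2 ^ J := by field_simp
    have h' : (2 : ℝ) / 2 ^ J = 2 * (1 / 2 ^ J) := by ring
    rw [h, div_eq_mul_one_div a]
    rw [h'] at ih
    linarith

theorem sum_card_sq_rich_lines_le (y : ℝ → ℝ) (A : Finset ℝ) (L : Finset (ℝ × ℝ)) {i R : ℕ}
    (hi : 1 ≤ i) (hlow : ∀ l ∈ L, 2 ^ i ≤ (onLine y A l).card)
    (hup : ∀ l ∈ L, (onLine y A l).card ≤ R) :
    ∑ l ∈ L, ((onLine y A l).card : ℝ) ^ 2 ≤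
      9216 * (2 * (A.card : ℝ) ^ 2 / 2 ^ i + 2 * A.card * R) := by
  rcases L.eq_empty_or_nonempty with rfl | ⟨l₀, hl₀⟩
  · simp; positivity
  have hR : 2 ^ i ≤ R := (hlow l₀ hl₀).trans (hup l₀ hl₀)
  have hR0 : R ≠ 0 := by have := Nat.two_pow_pos i; omega
  set J := Nat.log 2 R + 1 with hJ
  have hiJ : i ≤ J := (Nat.le_log_of_pow_le (by norm_num) hR).trans (Nat.le_succ _)
  have hmaps : ∀ l ∈ L, Nat.log 2 (onLine y A l).card ∈ Finset.Ico i J := by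
    intro l hl
    refine Finset.mem_Ico.2 ⟨Nat.le_log_of_pow_le (by norm_num) (hlow l hl), ?_⟩
    exact Nat.lt_succ_of_le (Nat.log_mono_right (hup l hl))
  rw [← Finset.sum_fiberwise_of_maps_to hmaps]
  have hfib : ∀ k ∈ Finset.Ico i J,
      ∑ l ∈ L.filter (fun l => Nat.log 2 (onLine y A l).card = k),
        ((onLine y A l).card : ℝ) ^ 2 ≤
      9216 * ((A.card : ℝ) ^ 2 / 2 ^ k + A.card * 2 ^ k) := by
    intro k hk
    have hk1 : 1 ≤ k := hi.trans (Finset.mem_Ico.1 hk).1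
    have hpos : ∀ l ∈ L, (onLine y A l).card ≠ 0 := fun l hl => by
      have := Nat.two_pow_pos i
      have := hlow l hl
      omega
    have hrich := card_rich_lines_le y A
      (L.filter (fun l => Nat.log 2 (onLine y A l).card = k)) (t := 2 ^ k)
      (by calc 2 = 2 ^ 1 := rfl
            _ ≤ 2 ^ k := Nat.pow_le_pow_right (by norm_num) hk1)
      (by
        intro l hl
        obtain ⟨hl', rfl⟩ := Finset.mem_filter.1 hl
        exact Nat.pow_log_le_self 2 (hpos l hl'))
    have hsum : ∑ l ∈ L.filter (fun l => Nat.log 2 (onLine y A l).card = k),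
        ((onLine y A l).card : ℝ) ^ 2 ≤
        ∑ l ∈ L.filter (fun l => Nat.log 2 (onLine y A l).card = k), ((2 : ℝ) ^ k * 2) ^ 2 := by
      refine Finset.sum_le_sum fun l hl => ?_
      obtain ⟨hl', rfl⟩ := Finset.mem_filter.1 hl
      have : (onLine y A l).card ≤ 2 ^ (Nat.log 2 (onLine y A l).card) * 2 := by
        rw [← pow_succ]
        exact (Nat.lt_pow_succ_log_self (by norm_num) _).le
      gcongr
      exact_mod_cast this
    rw [Finset.sum_const, nsmul_eq_mul] at hsum
    refine hsum.trans ?_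
    push_cast at hrich
    generalize ((L.filter (fun l => Nat.log 2 (onLine y A l).card = k)).card : ℝ) = N at *
    have h2 : (0 : ℝ) < 2 ^ k := by positivity
    generalize (2 : ℝ) ^ k = s at *
    have e : 9216 * ((A.card : ℝ) ^ 2 / s + A.card * s) =
        4 * (2304 * ((A.card : ℝ) ^ 2 + A.card * s ^ 2)) / s := by field_simp; ring
    rw [e, le_div_iff₀ h2]
    linarith
  refine (Finset.sum_le_sum hfib).trans ?_
  rw [← Finset.mul_sum]
  have h1 := sum_Ico_dyadic_le (a := (A.card : ℝ) ^ 2) (b := A.card) (by positivity) hiJ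
  have h2 : (2 : ℝ) ^ J ≤ 2 * R := by
    rw [hJ, pow_succ, mul_comm]
    have : 2 ^ Nat.log 2 R ≤ R := Nat.pow_log_le_self 2 hR0
    gcongr
    exact_mod_cast this
  have h3 : (0 : ℝ) ≤ (A.card : ℝ) ^ 2 * (2 / 2 ^ J) := by positivity
  have h4 : (A.card : ℝ) * 2 ^ J ≤ A.card * (2 * R) := by gcongr
  have h5 : 2 * (A.card : ℝ) ^ 2 / 2 ^ i = (A.card : ℝ) ^ 2 * (2 / 2 ^ i) := by ring
  rw [h5]
  linarith

/-- The line through the points of the graph of `y` over `e.1` and `e.2`. -/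
def lineThrough (y : ℝ → ℝ) (e : ℝ × ℝ) : ℝ × ℝ :=
  (chordSlope y e, y e.1 - chordSlope y e * e.1)

theorem mem_onLine_lineThrough {y : ℝ → ℝ} {A : Finset ℝ} {e : ℝ × ℝ} (he : e.1 ≠ e.2) {x : ℝ} :
    x ∈ onLine y A (lineThrough y e) ↔
      x ∈ A ∧ (e.2 - e.1) * (y x - y e.1) = (x - e.1) * (y e.2 - y e.1) := by
  have h : e.2 - e.1 ≠ 0 := sub_ne_zero.2 he.symm
  rw [mem_onLine, lineThrough]
  refine and_congr_right fun _ => ?_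
  have : chordSlope y e * (e.2 - e.1) = y e.2 - y e.1 := div_mul_cancel₀ _ h
  rw [← this]
  constructor
  · intro hx
    linear_combination (e.2 - e.1) * hx
  · intro hx
    refine mul_left_cancel₀ h ?_
    linear_combination hx

theorem card_pairs_on_rich_lines_le (y : ℝ → ℝ) (A : Finset ℝ) {i R : ℕ} (hi : 1 ≤ i)
    (hup : ∀ e ∈ A ×ˢ A, e.1 ≠ e.2 → (onLine y A (lineThrough y e)).card ≤ R) :
    (((A ×ˢ A).filter fun e => e.1 ≠ e.2 ∧ 2 ^ i ≤ (onLine y A (lineThrough y e)).card).card : ℝ) ≤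
      9216 * (2 * (A.card : ℝ) ^ 2 / 2 ^ i + 2 * A.card * R) := by
  set B := (A ×ˢ A).filter fun e => e.1 ≠ e.2 ∧ 2 ^ i ≤ (onLine y A (lineThrough y e)).card
  have hsub : B ⊆ (B.image (lineThrough y)).biUnion fun l => onLine y A l ×ˢ onLine y A l := by
    intro e he
    obtain ⟨hA, hne, -⟩ := Finset.mem_filter.1 he
    obtain ⟨h1, h2⟩ := Finset.mem_product.1 hA
    refine Finset.mem_biUnion.2 ⟨_, Finset.mem_image_of_mem _ he, Finset.mem_product.2 ⟨?_, ?_⟩⟩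
    · exact (mem_onLine_lineThrough hne).2 ⟨h1, by ring⟩
    · exact (mem_onLine_lineThrough hne).2 ⟨h2, by ring⟩
  have h1 := (Finset.card_le_card hsub).trans Finset.card_biUnion_le
  have h2 := sum_card_sq_rich_lines_le y A (B.image (lineThrough y)) (R := R) hi
    (by
      intro l hl
      obtain ⟨e, he, rfl⟩ := Finset.mem_image.1 hl
      exact (Finset.mem_filter.1 he).2.2)
    (by
      intro l hl
      obtain ⟨e, he, rfl⟩ := Finset.mem_image.1 hl
      exact hup e (Finset.mem_filter.1 he).1 (Finset.mem_filter.1 he).2.1)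
  refine le_trans ?_ h2
  simp only [Finset.card_product, ← sq] at h1
  exact_mod_cast h1

/-! ### Families of vectors -/

/-- The number of indices `i` with `v i ∈ W`. -/
def mass {V ι : Type} [AddCommGroup V] [Module ℝ V] [Fintype ι] (v : ι → V)
    (W : Submodule ℝ V) : ℕ :=
  (Finset.univ.filter fun i => v i ∈ W).card

/-- Almost all `j`-tuples from a family of vectors with bounded multiplicities, no large part of
which lies in a `j`-dimensional subspace, are linearly independent and span a subspace that
contains a bounded number of members of the family. -/
def GenericSpan (j : ℕ) : Prop :=
  ∀ ε : ℝ, 0 < ε → ∀ m : ℕ, ∃ α : ℝ, 0 < α ∧ ∃ C : ℕ,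
    ∀ (V : Type) [AddCommGroup V] [Module ℝ V] [FiniteDimensional ℝ V] (ι : Type) [Fintype ι]
      (v : ι → V),
      (∀ W : Submodule ℝ V, Module.finrank ℝ W ≤ 1 → mass v W ≤ m) →
      (∀ W : Submodule ℝ V, Module.finrank ℝ W ≤ j → (mass v W : ℝ) ≤ α * Fintype.card ι) →
      ((Finset.univ.filter fun x : Fin j → ι => ¬ (LinearIndependent ℝ (v ∘ x) ∧
        mass v (Submodule.span ℝ (Set.range (v ∘ x))) ≤ C)).card : ℝ) ≤
        ε * (Fintype.card ι : ℝ) ^ j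

section Families

variable {V ι : Type} [AddCommGroup V] [Module ℝ V] [Fintype ι]

theorem mass_mono (v : ι → V) {W W' : Submodule ℝ V} (h : W ≤ W') : mass v W ≤ mass v W' :=
  Finset.card_le_card fun _ hi =>
    Finset.mem_filter.2 ⟨Finset.mem_univ _, h (Finset.mem_filter.1 hi).2⟩

theorem finrank_span_singleton_le (p : V) : Module.finrank ℝ (Submodule.span ℝ {p}) ≤ 1 := by
  rw [← Finset.coe_singleton]
  exact finrank_span_finset_le_card (R := ℝ) ({p} : Finset V)

theorem finrank_span_pair_le (p q : V) : Module.finrank ℝ (Submodule.span ℝ {p, q}) ≤ 2 := by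
  rw [← Finset.coe_pair]
  exact (finrank_span_finset_le_card (R := ℝ) ({p, q} : Finset V)).trans Finset.card_le_two

/-- Generic coordinates on a finite set in an affine hyperplane: the first coordinate separates
points and the first two coordinates preserve collinearity and non-collinearity. -/
theorem exists_generic_coordinates (Q : Finset V) (h : Module.Dual ℝ V) (hQ : ∀ q ∈ Q, h q = 1) :
    ∃ f g : Module.Dual ℝ V, (∀ p ∈ Q, ∀ q ∈ Q, f p = f q → p = q) ∧
      ∀ p ∈ Q, ∀ q ∈ Q, ∀ r ∈ Q, p ≠ q →
        ((f q - f p) * (g r - g p) = (f r - f p) * (g q - g p) ↔ r ∈ Submodule.span ℝ {p, q}) := by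
  obtain ⟨f, hf⟩ := Module.exists_dual_forall_apply_ne_zero (K := ℝ)
    (fun z : {z : Q × Q // z.1.1 ≠ z.2.1} => z.1.1.1 - z.1.2.1) (fun z => sub_ne_zero.2 z.2)
  obtain ⟨g, hg⟩ := Module.exists_dual_forall_apply_ne_zero (K := ℝ)
    (fun z : {z : Q × Q × Q // (f z.2.1 - f z.1) • (z.2.2.1 - z.1.1) -
        (f z.2.2 - f z.1) • (z.2.1.1 - z.1.1) ≠ 0} =>
      (f z.1.2.1 - f z.1.1) • (z.1.2.2.1 - z.1.1.1) -
        (f z.1.2.2 - f z.1.1) • (z.1.2.1.1 - z.1.1.1)) (fun z => z.2)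
  have hinj : ∀ p ∈ Q, ∀ q ∈ Q, f p = f q → p = q := by
    intro p hp q hq hpq
    by_contra hne
    refine hf ⟨(⟨p, hp⟩, ⟨q, hq⟩), hne⟩ ?_
    rw [map_sub, sub_eq_zero]
    exact hpq
  refine ⟨f, g, hinj, fun p hp q hq r hr hpq => ⟨fun heq => ?_, fun hmem => ?_⟩⟩
  · have hz : (f q - f p) • (r - p) - (f r - f p) • (q - p) = 0 := by
      by_contra hne
      refine hg ⟨(⟨p, hp⟩, ⟨q, hq⟩, ⟨r, hr⟩), hne⟩ ?_
      simp only [map_sub, map_smul, smul_eq_mul]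
      linarith
    have hfne : f q - f p ≠ 0 := fun h0 => hpq (hinj q hq p hp (by linarith)).symm
    have hr' : r = p + ((f q - f p)⁻¹ * (f r - f p)) • (q - p) := by
      rw [mul_smul, ← sub_eq_zero.1 hz, smul_smul, inv_mul_cancel₀ hfne, one_smul]
      abel
    have hp' : p ∈ Submodule.span ℝ ({p, q} : Set V) := Submodule.subset_span (by simp)
    have hq' : q ∈ Submodule.span ℝ ({p, q} : Set V) := Submodule.subset_span (by simp)
    rw [hr']
    exact Submodule.add_mem _ hp' (Submodule.smul_mem _ _ (Submodule.sub_mem _ hq' hp'))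
  · obtain ⟨a, b, rfl⟩ := Submodule.mem_span_pair.1 hmem
    have h1 := hQ _ hr
    simp only [map_add, map_smul, smul_eq_mul, hQ p hp, hQ q hq, mul_one] at h1 ⊢
    obtain rfl : a = 1 - b := by linarith
    ring

end Families

theorem genericSpan_two : GenericSpan 2 := by
  intro ε hε m
  obtain ⟨i₀, hi₀⟩ : ∃ i₀ : ℕ, 36864 * (m : ℝ) ^ 2 / ε < 2 ^ i₀ :=
    pow_unbounded_of_one_lt _ (by norm_num)
  set i := i₀ + 1 with hi
  set D : ℝ := 2 * (2 + 18432 * (m : ℝ) ^ 2) with hD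
  have hDpos : 0 < D := by positivity
  refine ⟨ε / D, by positivity, m + m * 2 ^ i, ?_⟩
  intro V _ _ _ ι _ v hm hα
  set α := ε / D with hαdef
  have hαpos : 0 < α := by positivity
  set n : ℝ := (Fintype.card ι : ℝ) with hn
  have hn0 : 0 ≤ n := by positivity
  obtain ⟨h, hh⟩ := Module.exists_dual_forall_apply_ne_zero (K := ℝ)
    (fun z : {i : ι // v i ≠ 0} => v z.1) (fun z => z.2)
  replace hh : ∀ i, v i ≠ 0 → h (v i) ≠ 0 := fun i hi => hh ⟨i, hi⟩
  set u : ι → V := fun i => (h (v i))⁻¹ • v i with hu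
  have hvu : ∀ i, v i = h (v i) • u i := by
    intro i
    by_cases h0 : v i = 0
    · simp [h0]
    · rw [hu, smul_smul, mul_inv_cancel₀ (hh i h0), one_smul]
  set N : Finset ι := Finset.univ.filter fun i => v i ≠ 0 with hN
  have hmemN : ∀ i, i ∈ N ↔ v i ≠ 0 := fun i => by simp [hN]
  set Q := N.image u with hQ
  have huQ : ∀ i, v i ≠ 0 → u i ∈ Q := fun i hi => Finset.mem_image_of_mem _ ((hmemN i).2 hi)
  have hhQ : ∀ q ∈ Q, h q = 1 := by
    intro q hq
    obtain ⟨i, hi, rfl⟩ := Finset.mem_image.1 hq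
    simp [hu, inv_mul_cancel₀ (hh i ((hmemN i).1 hi))]
  obtain ⟨f, g, hinj, hcol⟩ := exists_generic_coordinates Q h hhQ
  set A := Q.image f with hA
  set y : ℝ → ℝ := fun s => g (Function.invFunOn f Q s) with hy
  have hyf : ∀ q ∈ Q, y (f q) = g q := by
    intro q hq
    have hex : ∃ a ∈ (Q : Set V), f a = f q := ⟨q, hq, rfl⟩
    rw [hy]
    exact congrArg g (hinj _ (Function.invFunOn_mem hex) _ hq (Function.invFunOn_eq hex))
  have hline : ∀ p ∈ Q, ∀ q ∈ Q, p ≠ q → ∀ r ∈ Q,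
      (f r ∈ onLine y A (lineThrough y (f p, f q)) ↔ r ∈ Submodule.span ℝ {p, q}) := by
    intro p hp q hq hpq r hr
    rw [mem_onLine_lineThrough (fun h0 => hpq (hinj p hp q hq h0))]
    simp only [hyf p hp, hyf q hq, hyf r hr]
    rw [hcol p hp q hq r hr hpq]
    exact and_iff_right (Finset.mem_image_of_mem _ hr)
  have hAn : (A.card : ℝ) ≤ n := by
    rw [hn]
    have : A.card ≤ Fintype.card ι :=
      Finset.card_image_le.trans (Finset.card_image_le.trans (Finset.card_le_univ N))
    exact_mod_cast this
  have hup : ∀ e ∈ A ×ˢ A, e.1 ≠ e.2 →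
      (onLine y A (lineThrough y e)).card ≤ ⌊α * n⌋₊ := by
    rintro ⟨s, t⟩ he hne
    obtain ⟨hs, ht⟩ := Finset.mem_product.1 he
    obtain ⟨p, hp, rfl⟩ := Finset.mem_image.1 hs
    obtain ⟨q, hq, rfl⟩ := Finset.mem_image.1 ht
    have hpq : p ≠ q := fun h0 => hne (by simp [h0])
    refine Nat.le_floor ((Nat.cast_le.2 ?_).trans (hα _ (finrank_span_pair_le p q)))
    have hsub : onLine y A (lineThrough y (f p, f q)) ⊆
        (Finset.univ.filter fun i => v i ∈ Submodule.span ℝ {p, q}).image fun i => f (u i) := by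
      intro s hs
      obtain ⟨r, hr, rfl⟩ := Finset.mem_image.1 (mem_onLine.1 hs).1
      have hmem := (hline p hp q hq hpq r hr).1 hs
      obtain ⟨i, hi, rfl⟩ := Finset.mem_image.1 hr
      refine Finset.mem_image.2 ⟨i, Finset.mem_filter.2 ⟨Finset.mem_univ _, ?_⟩, rfl⟩
      rw [hvu i]
      exact Submodule.smul_mem _ _ hmem
    exact (Finset.card_le_card hsub).trans Finset.card_image_le
  have hfib : ∀ s ∈ A, (N.filter fun i => f (u i) = s).card ≤ m := by
    intro s hs
    obtain ⟨q, hq, rfl⟩ := Finset.mem_image.1 hs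
    refine (Finset.card_le_card fun i hi => ?_).trans (hm _ (finrank_span_singleton_le q))
    obtain ⟨hi, hi'⟩ := Finset.mem_filter.1 hi
    refine Finset.mem_filter.2 ⟨Finset.mem_univ _, ?_⟩
    rw [hvu i, hinj _ (huQ i ((hmemN i).1 hi)) q hq hi']
    exact Submodule.smul_mem _ _ (Submodule.mem_span_singleton_self q)
  have hmass : ∀ p ∈ Q, ∀ q ∈ Q, p ≠ q → mass v (Submodule.span ℝ {p, q}) ≤
      m + m * (onLine y A (lineThrough y (f p, f q))).card := by
    intro p hp q hq hpq
    set S := N.filter fun i => v i ∈ Submodule.span ℝ {p, q} with hS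
    have h1 : (Finset.univ.filter fun i => v i ∈ Submodule.span ℝ {p, q}) ⊆
        (Finset.univ.filter fun i => v i ∈ (⊥ : Submodule ℝ V)) ∪ S := by
      intro i hi
      by_cases h0 : v i = 0
      · simp [h0]
      · simp only [hS, Finset.mem_union, Finset.mem_filter, hmemN]
        exact Or.inr ⟨h0, (Finset.mem_filter.1 hi).2⟩
    have h2 : S.card ≤ m * (onLine y A (lineThrough y (f p, f q))).card := by
      refine Finset.card_le_mul_card_image_of_maps_to (f := fun i => f (u i)) ?_ m ?_
      · intro i hi
        obtain ⟨hi, hi'⟩ := Finset.mem_filter.1 hi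
        refine (hline p hp q hq hpq _ (huQ i ((hmemN i).1 hi))).2 ?_
        exact Submodule.smul_mem _ _ hi'
      · intro s hs
        refine (Finset.card_le_card ?_).trans (hfib s (mem_onLine.1 hs).1)
        exact Finset.filter_subset_filter _ (Finset.filter_subset _ _)
    have h3 : mass v (⊥ : Submodule ℝ V) ≤ m := hm _ (by simp)
    exact ((Finset.card_le_card h1).trans (Finset.card_union_le _ _)).trans (Nat.add_le_add h3 h2)
  have hpairs := card_pairs_on_rich_lines_le y A (i := i) (by omega) hup
  set B := (A ×ˢ A).filter fun e => e.1 ≠ e.2 ∧ 2 ^ i ≤ (onLine y A (lineThrough y e)).card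
    with hB
  set S₀ := Finset.univ.filter fun x : Fin 2 → ι => v (x 0) ∈ (⊥ : Submodule ℝ V) with hS₀
  set S₁ := Finset.univ.filter fun x : Fin 2 → ι => v (x 1) ∈ Submodule.span ℝ {v (x 0)} with hS₁
  set S₂ := Finset.univ.filter fun x : Fin 2 → ι =>
    x 0 ∈ N ∧ x 1 ∈ N ∧ (f (u (x 0)), f (u (x 1))) ∈ B with hS₂
  have hsub : (Finset.univ.filter fun x : Fin 2 → ι => ¬ (LinearIndependent ℝ (v ∘ x) ∧
      mass v (Submodule.span ℝ (Set.range (v ∘ x))) ≤ m + m * 2 ^ i)) ⊆ S₀ ∪ S₁ ∪ S₂ := by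
    intro x hx
    by_contra hcon
    simp only [hS₀, hS₁, hS₂, Finset.mem_union, Finset.mem_filter, Finset.mem_univ, true_and,
      not_or, Submodule.mem_bot, hmemN] at hcon
    obtain ⟨⟨h0, h1⟩, h2⟩ := hcon
    have hv1 : v (x 1) ≠ 0 := fun h' => h1 (h' ▸ Submodule.zero_mem _)
    have hvx : v ∘ x = ![v (x 0), v (x 1)] := by
      funext k; fin_cases k <;> rfl
    have huu : u (x 0) ≠ u (x 1) := by
      intro h'
      refine h1 ?_
      rw [hvu (x 1), ← h']
      exact Submodule.smul_mem _ _ (Submodule.smul_mem _ _ (Submodule.mem_span_singleton_self _))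
    have hq0 := huQ _ h0
    have hq1 := huQ _ hv1
    have hnB : (onLine y A (lineThrough y (f (u (x 0)), f (u (x 1))))).card ≤ 2 ^ i := by
      by_contra hlt
      refine h2 ⟨h0, hv1, Finset.mem_filter.2 ⟨Finset.mem_product.2
        ⟨Finset.mem_image_of_mem _ hq0, Finset.mem_image_of_mem _ hq1⟩, fun h' => huu
          (hinj _ hq0 _ hq1 h'), (not_le.1 hlt).le⟩⟩
    refine (Finset.mem_filter.1 hx).2 ⟨?_, ?_⟩
    · rw [hvx, LinearIndependent.pair_iff' h0]
      intro a ha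
      exact h1 (ha ▸ Submodule.smul_mem _ _ (Submodule.mem_span_singleton_self _))
    · have hle : Submodule.span ℝ (Set.range (v ∘ x)) ≤
          Submodule.span ℝ {u (x 0), u (x 1)} := by
        rw [Submodule.span_le]
        rintro _ ⟨k, rfl⟩
        have h' : u (x k) ∈ ({u (x 0), u (x 1)} : Set V) := by fin_cases k <;> simp
        rw [Function.comp_apply, hvu (x k)]
        exact Submodule.smul_mem _ _ (Submodule.subset_span h')
      refine (mass_mono v hle).trans ((hmass _ hq0 _ hq1 huu).trans ?_)
      exact Nat.add_le_add_left (Nat.mul_le_mul_left _ hnB) _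
  have hc₀ : (S₀.card : ℝ) ≤ α * n * n := by
    refine (card_le_mul_card_of_fiber_le S₀ Finset.univ (fun x => x 1) (by simp) (α * n) ?_)
    intro b _
    refine (Nat.cast_le.2 (Finset.card_le_card_of_injOn (fun x => x 0) ?_ ?_)).trans
      (hα ⊥ (by simp))
    · intro x hx
      simpa [hS₀] using (Finset.mem_filter.1 hx).1
    · intro x hx x' hx' hxx
      have e1 := (Finset.mem_filter.1 hx).2
      have e2 := (Finset.mem_filter.1 hx').2
      funext k
      fin_cases k
      · exact hxx
      · exact e1.trans e2.symm
  have hc₁ : (S₁.card : ℝ) ≤ α * n * n := by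
    refine (card_le_mul_card_of_fiber_le S₁ Finset.univ (fun x => x 0) (by simp) (α * n) ?_)
    intro b _
    refine (Nat.cast_le.2 (Finset.card_le_card_of_injOn (fun x => x 1) ?_ ?_)).trans
      (hα (Submodule.span ℝ {v b}) ((finrank_span_singleton_le _).trans (by norm_num)))
    · intro x hx
      obtain ⟨hx, rfl⟩ := Finset.mem_filter.1 hx
      simpa [hS₁] using hx
    · intro x hx x' hx' hxx
      have e1 := (Finset.mem_filter.1 hx).2
      have e2 := (Finset.mem_filter.1 hx').2
      funext k
      fin_cases k
      · exact e1.trans e2.symm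
      · exact hxx
  have hc₂ : (S₂.card : ℝ) ≤ (m : ℝ) ^ 2 * B.card := by
    refine card_le_mul_card_of_fiber_le S₂ B (fun x => (f (u (x 0)), f (u (x 1))))
      (fun x hx => (Finset.mem_filter.1 hx).2.2.2) _ ?_
    rintro ⟨s, t⟩ hst
    obtain ⟨hs, ht⟩ := Finset.mem_product.1 (Finset.mem_filter.1 hst).1
    have : (S₂.filter fun x => (f (u (x 0)), f (u (x 1))) = (s, t)).card ≤
        ((N.filter fun i => f (u i) = s) ×ˢ (N.filter fun i => f (u i) = t)).card := by
      refine Finset.card_le_card_of_injOn (fun x => (x 0, x 1)) ?_ ?_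
      · intro x hx
        obtain ⟨hx, hx'⟩ := Finset.mem_filter.1 hx
        obtain ⟨-, h0, h1, -⟩ := Finset.mem_filter.1 hx
        obtain ⟨e1, e2⟩ := Prod.mk.inj hx'
        exact Finset.mem_product.2 ⟨Finset.mem_filter.2 ⟨h0, e1⟩, Finset.mem_filter.2 ⟨h1, e2⟩⟩
      · intro x hx x' hx' hxx
        obtain ⟨e1, e2⟩ := Prod.mk.inj hxx
        funext k
        fin_cases k
        · exact e1
        · exact e2
    rw [Finset.card_product] at this
    have h' := this.trans (Nat.mul_le_mul (hfib s hs) (hfib t ht))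
    rw [← sq] at h'
    have h'' : (((S₂.filter fun x => (f (u (x 0)), f (u (x 1))) = (s, t)).card : ℕ) : ℝ) ≤
        (m : ℝ) ^ 2 := by exact_mod_cast h'
    convert h''
  have hcard := (Finset.card_le_card hsub).trans ((Finset.card_union_le _ _).trans
    (Nat.add_le_add_right (Finset.card_union_le _ _) _))
  have hcard' : ((Finset.univ.filter fun x : Fin 2 → ι => ¬ (LinearIndependent ℝ (v ∘ x) ∧
      mass v (Submodule.span ℝ (Set.range (v ∘ x))) ≤ m + m * 2 ^ i)).card : ℝ) ≤
      S₀.card + S₁.card + S₂.card := by exact_mod_cast hcard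
  have hfl : (⌊α * n⌋₊ : ℝ) ≤ α * n := Nat.floor_le (by positivity)
  have hBle : (B.card : ℝ) ≤ 9216 * (2 * n ^ 2 / 2 ^ i + 2 * n * (α * n)) := by
    have hgen : ∀ a z s b : ℝ, 0 ≤ a → a ≤ n → 0 ≤ z → z ≤ b → 0 < s →
        9216 * (2 * a ^ 2 / s + 2 * a * z) ≤ 9216 * (2 * n ^ 2 / s + 2 * n * b) := by
      intro a z s b h1 h2 h3 h4 h5
      gcongr
    exact hpairs.trans (hgen _ _ _ _ (Nat.cast_nonneg _) hAn (Nat.cast_nonneg _) hfl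
      (pow_pos two_pos _))
  have hpow : 9216 * 2 * (m : ℝ) ^ 2 / 2 ^ i ≤ ε / 2 := by
    have e : (2 : ℝ) ^ i = 2 ^ i₀ * 2 := pow_succ 2 i₀
    have e0 : (0 : ℝ) < 2 ^ i₀ := pow_pos two_pos i₀
    rw [div_lt_iff₀ hε] at hi₀
    rw [e, div_le_iff₀ (mul_pos e0 two_pos)]
    linarith [sq_nonneg (m : ℝ)]
  have hDα : D * α = ε := mul_div_cancel₀ ε hDpos.ne'
  have h1 : (m : ℝ) ^ 2 * B.card ≤ (m : ℝ) ^ 2 * (9216 * (2 * n ^ 2 / 2 ^ i + 2 * n * (α * n))) :=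
    mul_le_mul_of_nonneg_left hBle (by positivity)
  have h2 := mul_le_mul_of_nonneg_right hpow (sq_nonneg n)
  have h3 : (m : ℝ) ^ 2 * (9216 * (2 * n ^ 2 / 2 ^ i + 2 * n * (α * n))) =
      9216 * 2 * (m : ℝ) ^ 2 / 2 ^ i * n ^ 2 + 18432 * (m : ℝ) ^ 2 * α * n ^ 2 := by ring
  have h4 : 2 * α * n ^ 2 + 18432 * (m : ℝ) ^ 2 * α * n ^ 2 = ε / 2 * n ^ 2 := by
    rw [← hDα, hD]; ring
  linarith

theorem genericSpan_one : GenericSpan 1 := by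
  intro ε hε m
  refine ⟨ε, hε, m, ?_⟩
  intro V _ _ _ ι _ v hm hα
  refine le_trans (Nat.cast_le.2 ?_) ((hα ⊥ (by simp)).trans (by simp))
  refine Finset.card_le_card_of_injOn (fun x => x 0) (fun x hx => ?_) (fun x _ y _ h => ?_)
  · simp only [Finset.coe_filter, Finset.mem_univ, true_and, Set.mem_ofPred_eq] at hx
    simp only [Finset.coe_filter, Finset.mem_univ, true_and, Set.mem_ofPred_eq, Submodule.mem_bot]
    by_contra h0
    refine hx ⟨?_, ?_⟩
    · exact (linearIndependent_unique_iff (v := v ∘ x)).2 h0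
    · refine hm _ ?_
      simpa [Set.finrank] using finrank_range_le_card (R := ℝ) (v ∘ x)
  · funext i
    rw [Subsingleton.elim i 0]
    exact h

section Tuples

variable {ι : Type} [Fintype ι] {j : ℕ}

theorem card_le_mul_of_insertNth_coordinate (i : Fin (j + 1)) (S : Finset (Fin (j + 1) → ι))
    (c : ℝ)
    (h : ∀ y : Fin j → ι,
      ((Finset.univ.filter fun r : ι => i.insertNth (α := fun _ => ι) r y ∈ S).card : ℝ) ≤ c) :
    (S.card : ℝ) ≤ c * (Fintype.card ι : ℝ) ^ j := by
  have := card_le_mul_card_of_fiber_le S (Finset.univ : Finset (Fin j → ι))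
    (fun x => i.removeNth x) (fun _ _ => Finset.mem_univ _) c (fun y _ => ?_)
  · simpa using this
  · refine le_trans (Nat.cast_le.2 ?_) (h y)
    refine Finset.card_le_card_of_injOn (fun x => x i) (fun x hx => ?_) (fun x hx x' hx' hxx => ?_)
    · simp only [Finset.coe_filter, Set.mem_ofPred_eq] at hx
      obtain ⟨hx, rfl⟩ := hx
      refine Finset.mem_filter.2 ⟨Finset.mem_univ _, ?_⟩
      rwa [Fin.insertNth_self_removeNth]
    · simp only [Finset.coe_filter, Set.mem_ofPred_eq] at hx hx'
      obtain ⟨-, hx⟩ := hx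
      obtain ⟨-, hx'⟩ := hx'
      rw [← Fin.insertNth_self_removeNth i x, ← Fin.insertNth_self_removeNth i x', hx, hx']
      exact congrArg (fun r => i.insertNth (α := fun _ => ι) r y) hxx

theorem card_le_mul_of_insertNth_rest (i : Fin (j + 1)) (S : Finset (Fin (j + 1) → ι))
    (c : ℝ)
    (h : ∀ r : ι, ((Finset.univ.filter fun y : Fin j → ι =>
      i.insertNth (α := fun _ => ι) r y ∈ S).card : ℝ) ≤ c) :
    (S.card : ℝ) ≤ c * Fintype.card ι := by
  refine card_le_mul_card_of_fiber_le S (Finset.univ : Finset ι)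
    (fun x => x i) (fun _ _ => Finset.mem_univ _) c (fun r _ => ?_)
  refine le_trans (Nat.cast_le.2 ?_) (h r)
  refine Finset.card_le_card_of_injOn (fun x => i.removeNth x) (fun x hx => ?_)
    (fun x hx x' hx' hxx => ?_)
  · obtain ⟨hx, rfl⟩ := Finset.mem_filter.1 hx
    refine Finset.mem_filter.2 ⟨Finset.mem_univ _, ?_⟩
    rwa [Fin.insertNth_self_removeNth]
  · obtain ⟨-, hx⟩ := Finset.mem_filter.1 hx
    obtain ⟨-, hx'⟩ := Finset.mem_filter.1 hx'
    rw [← Fin.insertNth_self_removeNth i x, ← Fin.insertNth_self_removeNth i x', hx, hx']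
    exact congrArg (fun y => i.insertNth (α := fun _ => ι) r y) hxx

end Tuples

section Quotients

variable {V ι : Type} [AddCommGroup V] [Module ℝ V] [Fintype ι]

theorem finrank_comap_mkQ [FiniteDimensional ℝ V] (L : Submodule ℝ V) (W : Submodule ℝ (V ⧸ L)) :
    Module.finrank ℝ (W.comap L.mkQ) = Module.finrank ℝ W + Module.finrank ℝ L := by
  have hle : L ≤ W.comap L.mkQ := fun x hx => by
    rw [Submodule.mem_comap, Submodule.mkQ_apply, (Submodule.Quotient.mk_eq_zero L).2 hx]
    exact W.zero_mem
  have h1 := (Submodule.quotientQuotientEquivQuotient L (W.comap L.mkQ) hle).finrank_eq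
  rw [Submodule.map_comap_eq_of_surjective L.mkQ_surjective] at h1
  have h2 := Submodule.finrank_quotient_add_finrank W
  have h3 := Submodule.finrank_quotient_add_finrank L
  have h4 := Submodule.finrank_quotient_add_finrank (W.comap L.mkQ)
  omega

/-- The images of the vectors `v q`, `q ∈ G`, in the quotient by the line of `v p`. -/
def projected (v : ι → V) (G : Finset ι) (p : ι) (q : G) : V ⧸ Submodule.span ℝ {v p} :=
  (Submodule.span ℝ {v p}).mkQ (v q)

theorem mass_projected_le (v : ι → V) (G : Finset ι) (p : ι)
    (W : Submodule ℝ (V ⧸ Submodule.span ℝ {v p})) :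
    mass (projected v G p) W ≤ mass v (W.comap (Submodule.span ℝ {v p}).mkQ) := by
  refine Finset.card_le_card_of_injOn Subtype.val (fun q hq => ?_)
    (Subtype.val_injective.injOn)
  have hq := (Finset.mem_filter.1 hq).2
  exact Finset.mem_filter.2 ⟨Finset.mem_univ _, hq⟩

theorem linearIndependent_of_quotient {j : ℕ} (u : Fin (j + 1) → V) (h0 : u 0 ≠ 0)
    (h : LinearIndependent ℝ fun i : Fin j => (Submodule.span ℝ {u 0}).mkQ (u i.succ)) :
    LinearIndependent ℝ u := by
  rw [linearIndependent_finSucc]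
  refine ⟨LinearIndependent.of_comp (Submodule.span ℝ {u 0}).mkQ h, fun hmem => h0 ?_⟩
  obtain ⟨c, hc⟩ := (Submodule.mem_span_range_iff_exists_fun ℝ).1 hmem
  have hz : ∑ i, c i • (Submodule.span ℝ {u 0}).mkQ (u i.succ) = 0 := by
    have := congrArg (Submodule.span ℝ {u 0}).mkQ hc
    rw [map_sum] at this
    simp only [map_smul, Fin.tail] at this
    rw [this, Submodule.mkQ_apply]
    exact (Submodule.Quotient.mk_eq_zero _).2 (Submodule.mem_span_singleton_self _)
  have hc0 := Fintype.linearIndependent_iff.1 h c hz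
  rw [← hc]
  simp [hc0]

theorem mkQ_mem_span_of_mem_span {j : ℕ} (u : Fin (j + 1) → V) {z : V}
    (hz : z ∈ Submodule.span ℝ (Set.range u)) :
    (Submodule.span ℝ {u 0}).mkQ z ∈
      Submodule.span ℝ (Set.range fun i : Fin j => (Submodule.span ℝ {u 0}).mkQ (u i.succ)) := by
  refine (Submodule.span_le (p := (Submodule.span ℝ (Set.range fun i : Fin j =>
    (Submodule.span ℝ {u 0}).mkQ (u i.succ))).comap (Submodule.span ℝ {u 0}).mkQ)).2 ?_ hz
  rintro _ ⟨i, rfl⟩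
  rw [SetLike.mem_coe, Submodule.mem_comap]
  refine Fin.cases ?_ (fun i => Submodule.subset_span ⟨i, rfl⟩) i
  rw [Submodule.mkQ_apply,
    (Submodule.Quotient.mk_eq_zero _).2 (Submodule.mem_span_singleton_self (u 0))]
  exact Submodule.zero_mem _

theorem card_rich_extensions_mul_le (v : ι → V) (A : Set V) (R : Finset ι) (C D K : ℕ)
    (hA : mass v (Submodule.span ℝ A) ≤ C)
    (hrich : ∀ r ∈ R, C + K ≤ mass v (Submodule.span ℝ (insert (v r) A)))
    (hR : ∀ r ∈ R, (R.filter fun s => v s ∈ Submodule.span ℝ (insert (v r) A)).card ≤ D) :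
    R.card * K ≤ Fintype.card ι * D := by
  have := Finset.card_mul_le_card_mul (s := R)
    (t := Finset.univ.filter fun s => v s ∉ Submodule.span ℝ A) (m := K) (n := D)
    (fun r s => v s ∈ Submodule.span ℝ (insert (v r) A)) (fun r hr => ?_) (fun s hs => ?_)
  · exact this.trans (Nat.mul_le_mul_right _ (Finset.card_le_univ _))
  · have h1 := hrich r hr
    have h2 : mass v (Submodule.span ℝ (insert (v r) A)) ≤ mass v (Submodule.span ℝ A) +
        (Finset.bipartiteAbove (fun r s => v s ∈ Submodule.span ℝ (insert (v r) A))
          (Finset.univ.filter fun s => v s ∉ Submodule.span ℝ A) r).card := by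
      refine le_trans (Finset.card_le_card fun i hi => ?_) (Finset.card_union_le _ _)
      have hi := (Finset.mem_filter.1 hi).2
      by_cases hiA : v i ∈ Submodule.span ℝ A
      · exact Finset.mem_union_left _ (Finset.mem_filter.2 ⟨Finset.mem_univ _, hiA⟩)
      · refine Finset.mem_union_right _ (Finset.mem_filter.2 ⟨?_, hi⟩)
        exact Finset.mem_filter.2 ⟨Finset.mem_univ _, hiA⟩
    omega
  · have hs := (Finset.mem_filter.1 hs).2
    rcases Finset.eq_empty_or_nonempty (Finset.bipartiteBelow
      (fun r s => v s ∈ Submodule.span ℝ (insert (v r) A)) R s) with h0 | ⟨r, hr⟩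
    · rw [h0]
      simp
    · obtain ⟨hrR, hrs⟩ := Finset.mem_filter.1 hr
      refine (Finset.card_le_card fun t ht => ?_).trans (hR r hrR)
      obtain ⟨htR, hts⟩ := Finset.mem_filter.1 ht
      refine Finset.mem_filter.2 ⟨htR, ?_⟩
      have h1 := mem_span_insert_exchange hts hs
      refine Submodule.span_le.2 ?_ h1
      rintro z (rfl | hz)
      · exact hrs
      · exact Submodule.subset_span (Set.mem_insert_of_mem _ hz)

end Quotients

theorem card_filter_mem_span_le_mass_projected {V ι : Type} [AddCommGroup V] [Module ℝ V]
    {j : ℕ} (v : ι → V) (x : Fin (j + 1) → ι)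
    {R G : Finset ι} (hRG : R ⊆ G) :
    (R.filter fun s => v s ∈ Submodule.span ℝ (Set.range (v ∘ x))).card ≤
      mass (projected v G (x 0)) (Submodule.span ℝ
        (Set.range fun i => (Submodule.span ℝ {v (x 0)}).mkQ (v (Fin.tail x i)))) := by
  refine le_trans (Finset.card_le_card fun s hs => ?_) (Finset.card_image_le (f := Subtype.val))
  obtain ⟨hsR, hs⟩ := Finset.mem_filter.1 hs
  exact Finset.mem_image.2 ⟨⟨s, hRG hsR⟩, Finset.mem_filter.2 ⟨Finset.mem_univ _,
    mkQ_mem_span_of_mem_span (v ∘ x) hs⟩, rfl⟩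

section GoodPairs

variable {V ι : Type} [AddCommGroup V] [Module ℝ V] [Fintype ι]

/-- The vectors `v p` and `v q` span a plane that contains at most `C` members of the family. -/
def GoodPair (v : ι → V) (C : ℕ) (p q : ι) : Prop :=
  LinearIndependent ℝ (v ∘ ![p, q]) ∧ mass v (Submodule.span ℝ (Set.range (v ∘ ![p, q]))) ≤ C

theorem mass_projected_le_of_goodPair [FiniteDimensional ℝ V] {v : ι → V} {C : ℕ} {G : Finset ι}
    {p : ι} (hG : ∀ q ∈ G, GoodPair v C p q) (W : Submodule ℝ (V ⧸ Submodule.span ℝ {v p}))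
    (hW : Module.finrank ℝ W ≤ 1) : mass (projected v G p) W ≤ C := by
  rcases Finset.eq_empty_or_nonempty (Finset.univ.filter fun q => projected v G p q ∈ W)
    with h0 | ⟨⟨q, hq⟩, hqW⟩
  · rw [mass, h0]
    simp
  · obtain ⟨hli, hC⟩ := hG q hq
    have hqW : v q ∈ W.comap (Submodule.span ℝ {v p}).mkQ := (Finset.mem_filter.1 hqW).2
    have hpW : v p ∈ W.comap (Submodule.span ℝ {v p}).mkQ := by
      rw [Submodule.mem_comap, Submodule.mkQ_apply,
        (Submodule.Quotient.mk_eq_zero _).2 (Submodule.mem_span_singleton_self _)]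
      exact W.zero_mem
    have hle : Submodule.span ℝ (Set.range (v ∘ ![p, q])) ≤
        W.comap (Submodule.span ℝ {v p}).mkQ := by
      refine Submodule.span_le.2 ?_
      rintro _ ⟨i, rfl⟩
      fin_cases i
      · exact hpW
      · exact hqW
    have hfin := finrank_comap_mkQ _ W
    have h1 := finrank_span_singleton_le (v p)
    have h2 := finrank_span_eq_card hli
    rw [Fintype.card_fin] at h2
    have heq := Submodule.eq_of_le_of_finrank_le hle (by omega)
    refine (mass_projected_le v G p W).trans ?_
    rwa [← heq]

theorem mul_card_not_goodPair_le (v : ι → V) (C : ℕ) (c : ℝ) :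
    c * ((Finset.univ.filter fun p =>
        c < ((Finset.univ.filter fun q => ¬ GoodPair v C p q).card : ℝ)).card : ℝ) ≤
      ((Finset.univ.filter fun x : Fin 2 → ι => ¬ (LinearIndependent ℝ (v ∘ x) ∧
        mass v (Submodule.span ℝ (Set.range (v ∘ x))) ≤ C)).card : ℝ) := by
  set B := Finset.univ.filter fun p =>
    c < ((Finset.univ.filter fun q => ¬ GoodPair v C p q).card : ℝ) with hB
  have h1 : (B.sigma fun p => Finset.univ.filter fun q => ¬ GoodPair v C p q).card ≤
      (Finset.univ.filter fun x : Fin 2 → ι => ¬ (LinearIndependent ℝ (v ∘ x) ∧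
        mass v (Submodule.span ℝ (Set.range (v ∘ x))) ≤ C)).card := by
    refine Finset.card_le_card_of_injOn (fun z => ![z.1, z.2]) (fun z hz => ?_)
      (fun z _ z' _ h => ?_)
    · exact Finset.mem_filter.2 ⟨Finset.mem_univ _,
        (Finset.mem_filter.1 (Finset.mem_sigma.1 hz).2).2⟩
    · obtain ⟨a, b⟩ := z
      obtain ⟨a', b'⟩ := z'
      have h0 : a = a' := congrFun h 0
      have h1 : b = b' := congrFun h 1
      rw [h0, h1]
  refine le_trans ?_ (Nat.cast_le.2 h1)
  rw [Finset.card_sigma, Nat.cast_sum, mul_comm, ← nsmul_eq_mul]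
  exact Finset.card_nsmul_le_sum _ _ _ fun p hp => (Finset.mem_filter.1 hp).2.le

end GoodPairs

theorem GenericSpan.succ {j : ℕ} (hj1 : 1 ≤ j) (hj : GenericSpan j) : GenericSpan (j + 1) := by
  intro ε hε m
  set e : ℝ := ε / 5 with he
  have hepos : 0 < e := by positivity
  set δ : ℝ := min (1 / 2) (e / j) with hδ
  have hjpos : (0 : ℝ) < j := by exact_mod_cast hj1
  have hδpos : 0 < δ := by positivity
  have hδhalf : δ ≤ 1 / 2 := min_le_left _ _
  have hδe : j * δ ≤ e := by
    have : δ ≤ e / j := min_le_right _ _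
    rw [le_div_iff₀ hjpos] at this
    linarith
  obtain ⟨α₂, hα₂, C₂, h₂⟩ := genericSpan_two (δ * e) (by positivity) m
  obtain ⟨α₃, hα₃, C₃, h₃⟩ := hj e hepos m
  obtain ⟨α₄, hα₄, C₄, h₄⟩ := hj e hepos C₂
  set K : ℕ := ⌈(C₄ : ℝ) / e⌉₊ + 1 with hK
  have hKe : (C₄ : ℝ) ≤ e * K := by
    have h1 : (C₄ : ℝ) / e ≤ K := (Nat.le_ceil _).trans (by simp [hK])
    rw [div_le_iff₀ hepos] at h1
    linarith
  refine ⟨min α₂ (min α₃ (α₄ / 2)), by positivity, C₃ + K, ?_⟩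
  intro V _ _ _ ι _ v hm hα
  set n : ℝ := (Fintype.card ι : ℝ) with hn
  have hn0 : 0 ≤ n := by positivity
  have hle : ∀ a : ℝ, min α₂ (min α₃ (α₄ / 2)) ≤ a → ∀ W : Submodule ℝ V,
      Module.finrank ℝ W ≤ j + 1 → (mass v W : ℝ) ≤ a * n := fun a ha W hW =>
    (hα W hW).trans (mul_le_mul_of_nonneg_right ha hn0)
  have hb₂ := h₂ V ι v hm fun W hW => hle α₂ (min_le_left _ _) W (by omega)
  have hb₃ := h₃ V ι v hm fun W hW =>
    hle α₃ ((min_le_right _ _).trans (min_le_left _ _)) W (by omega)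
  have hα₄n := hle (α₄ / 2) ((min_le_right _ _).trans (min_le_right _ _))
  set G : ι → Finset ι := fun p => Finset.univ.filter fun q => GoodPair v C₂ p q with hG
  have hmemG : ∀ p q, q ∈ G p ↔ GoodPair v C₂ p q := fun p q => by simp [hG]
  set Bad : ι → Prop := fun p =>
    δ * n < ((Finset.univ.filter fun q => ¬ GoodPair v C₂ p q).card : ℝ) with hBad
  have hbad : ((Finset.univ.filter Bad).card : ℝ) ≤ e * n := by
    rcases hn0.eq_or_lt with h0 | hpos
    · have : ((Finset.univ.filter Bad).card : ℝ) ≤ n :=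
        Nat.cast_le.2 (Finset.card_le_univ _)
      exact this.trans (by rw [← h0, mul_zero])
    · have h1 := (mul_card_not_goodPair_le v C₂ (δ * n)).trans hb₂
      have h2 : (δ * n) * ((Finset.univ.filter Bad).card : ℝ) ≤ (δ * n) * (e * n) := by
        calc _ ≤ δ * e * n ^ 2 := h1
          _ = _ := by ring
      exact le_of_mul_le_mul_left h2 (by positivity)
  have hGhalf : ∀ p, ¬ Bad p → n ≤ 2 * ((G p).card : ℝ) := by
    intro p hp
    have h1 := Finset.card_filter_add_card_filter_not (s := (Finset.univ : Finset ι))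
      (fun q => GoodPair v C₂ p q)
    have h2 : ((G p).card : ℝ) +
        ((Finset.univ.filter fun q => ¬ GoodPair v C₂ p q).card : ℝ) = n := by
      rw [hn]
      exact_mod_cast h1
    have h3 := not_lt.1 hp
    nlinarith
  set QGood : ι → (Fin j → ι) → Prop := fun p y =>
    LinearIndependent ℝ (fun i => (Submodule.span ℝ {v p}).mkQ (v (y i))) ∧
      mass (projected v (G p) p) (Submodule.span ℝ
        (Set.range fun i => (Submodule.span ℝ {v p}).mkQ (v (y i)))) ≤ C₄ with hQGood
  have hquot : ∀ p, ¬ Bad p → ((Finset.univ.filter fun y : Fin j → ι =>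
      (∀ i, y i ∈ G p) ∧ ¬ QGood p y).card : ℝ) ≤ e * n ^ j := by
    intro p hp
    have h1 := h₄ _ (G p) (projected v (G p) p)
      (mass_projected_le_of_goodPair fun q hq => (hmemG p q).1 hq) (fun W hW => ?_)
    · rw [Fintype.card_coe] at h1
      refine le_trans (le_trans (Nat.cast_le.2 ?_) h1) ?_
      · refine le_trans (Finset.card_le_card (t := Finset.image
          (fun (y : Fin j → G p) i => (y i : ι)) _) fun y hy => ?_) Finset.card_image_le
        obtain ⟨hyG, hyQ⟩ := (Finset.mem_filter.1 hy).2
        exact Finset.mem_image.2 ⟨fun i => ⟨y i, hyG i⟩,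
          Finset.mem_filter.2 ⟨Finset.mem_univ _, hyQ⟩, rfl⟩
      · refine mul_le_mul_of_nonneg_left ?_ hepos.le
        refine pow_le_pow_left₀ (by positivity) ?_ _
        exact Nat.cast_le.2 (Finset.card_le_univ _)
    · rw [Fintype.card_coe]
      have hfin := finrank_comap_mkQ _ W
      have h1 := finrank_span_singleton_le (v p)
      calc (mass (projected v (G p) p) W : ℝ)
          ≤ mass v (W.comap (Submodule.span ℝ {v p}).mkQ) :=
            Nat.cast_le.2 (mass_projected_le v (G p) p W)
        _ ≤ α₄ / 2 * n := hα₄n _ (by omega)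
        _ ≤ α₄ / 2 * (2 * (G p).card) :=
            mul_le_mul_of_nonneg_left (hGhalf p hp) (by positivity)
        _ = α₄ * (G p).card := by ring
  set Sa : Finset (Fin (j + 1) → ι) := Finset.univ.filter fun x => Bad (x 0) with hSa
  set Sb : Fin j → Finset (Fin (j + 1) → ι) := fun i =>
    Finset.univ.filter fun x => ¬ Bad (x 0) ∧ x i.succ ∉ G (x 0) with hSb
  set Sc : Finset (Fin (j + 1) → ι) := Finset.univ.filter fun x =>
    ¬ Bad (x 0) ∧ (∀ i, Fin.tail x i ∈ G (x 0)) ∧ ¬ QGood (x 0) (Fin.tail x) with hSc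
  set Sd : Finset (Fin (j + 1) → ι) := Finset.univ.filter fun x =>
    ¬ (LinearIndependent ℝ (v ∘ Fin.init x) ∧
      mass v (Submodule.span ℝ (Set.range (v ∘ Fin.init x))) ≤ C₃) with hSd
  set Se : Finset (Fin (j + 1) → ι) := Finset.univ.filter fun x =>
    (∀ i, Fin.tail x i ∈ G (x 0)) ∧ QGood (x 0) (Fin.tail x) ∧
      mass v (Submodule.span ℝ (Set.range (v ∘ Fin.init x))) ≤ C₃ ∧
      C₃ + K ≤ mass v (Submodule.span ℝ (Set.range (v ∘ x))) with hSe
  have hSa_card : (Sa.card : ℝ) ≤ e * n * n ^ j := by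
    refine card_le_mul_of_insertNth_coordinate 0 Sa _ fun y => ?_
    simpa [hSa] using hbad
  have hSb_card : ∀ i, ((Sb i).card : ℝ) ≤ δ * n * n ^ j := by
    intro i
    refine card_le_mul_of_insertNth_coordinate i.succ (Sb i) _ fun y => ?_
    obtain ⟨k, hk⟩ := Fin.exists_succAbove_eq (Fin.succ_ne_zero i).symm
    have h0 : ∀ r, i.succ.insertNth (α := fun _ => ι) r y 0 = y k := fun r => by
      rw [← hk, Fin.insertNth_apply_succAbove]
    simp only [hSb, Finset.mem_filter, Finset.mem_univ, true_and, h0, Fin.insertNth_apply_same,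
      hmemG]
    by_cases hb : Bad (y k)
    · simp only [hb, not_true_eq_false, false_and, Finset.filter_false, Finset.card_empty,
        Nat.cast_zero]
      positivity
    · simpa only [hb, not_false_eq_true, true_and] using not_lt.1 hb
  have hSc_card : (Sc.card : ℝ) ≤ e * n ^ j * n := by
    refine card_le_mul_of_insertNth_rest 0 Sc _ fun r => ?_
    simp only [hSc, Finset.mem_filter, Finset.mem_univ, true_and, Fin.insertNth_zero',
      Fin.cons_zero, Fin.tail_cons]
    by_cases hb : Bad r
    · simp only [hb, not_true_eq_false, false_and, Finset.filter_false, Finset.card_empty,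
        Nat.cast_zero]
      positivity
    · simpa only [hb, not_false_eq_true, true_and] using hquot r hb
  have hSd_card : (Sd.card : ℝ) ≤ e * n ^ j * n := by
    refine card_le_mul_of_insertNth_rest (Fin.last j) Sd _ fun r => ?_
    simpa only [hSd, Finset.mem_filter, Finset.mem_univ, true_and, Fin.insertNth_last',
      Fin.init_snoc] using hb₃
  have hSe_card : (Se.card : ℝ) ≤ e * n * n ^ j := by
    refine card_le_mul_of_insertNth_coordinate (Fin.last j) Se _ fun y => ?_
    obtain ⟨j', rfl⟩ : ∃ j', j = j' + 1 := ⟨j - 1, by omega⟩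
    set R := Finset.univ.filter fun r =>
      (Fin.last (j' + 1)).insertNth (α := fun _ => ι) r y ∈ Se with hR
    rcases R.eq_empty_or_nonempty with hemp | ⟨r₀, hr₀⟩
    · rw [hemp, Finset.card_empty, Nat.cast_zero]
      positivity
    have hRmem : ∀ r ∈ R, ∃ x : Fin (j' + 1 + 1) → ι, x 0 = y 0 ∧ x (Fin.last (j' + 1)) = r ∧
        Set.range (v ∘ x) = insert (v r) (Set.range (v ∘ y)) ∧
        (∀ i, Fin.tail x i ∈ G (x 0)) ∧ QGood (x 0) (Fin.tail x) ∧
        mass v (Submodule.span ℝ (Set.range (v ∘ y))) ≤ C₃ ∧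
        C₃ + K ≤ mass v (Submodule.span ℝ (Set.range (v ∘ x))) := by
      intro r hr
      have hx := (Finset.mem_filter.1 (Finset.mem_filter.1 hr).2).2
      rw [Fin.insertNth_last', Fin.init_snoc] at hx
      refine ⟨Fin.snoc (α := fun _ => ι) y r, ?_, ?_, ?_, hx⟩
      · rw [← Fin.castSucc_zero, Fin.snoc_castSucc]
      · rw [Fin.snoc_last]
      · rw [Fin.comp_snoc, Fin.range_snoc]
    have hcard := card_rich_extensions_mul_le v (Set.range (v ∘ y)) R C₃ C₄ K
      (by obtain ⟨x, -, -, -, -, -, h, -⟩ := hRmem r₀ hr₀; exact h)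
      (fun r hr => by
        obtain ⟨x, -, -, hx, -, -, -, h⟩ := hRmem r hr
        rwa [← hx])
      (fun r hr => by
        obtain ⟨x, hx0, -, hx, -, hQ, -, -⟩ := hRmem r hr
        have hRG : R ⊆ G (x 0) := fun s hs => by
          obtain ⟨x', hx0', hlast, -, hG', -⟩ := hRmem s hs
          have := hG' (Fin.last j')
          rwa [Fin.tail, Fin.succ_last, hlast, hx0', ← hx0] at this
        rw [← hx]
        exact (card_filter_mem_span_le_mass_projected v x hRG).trans hQ.2)
    have hcard' : (R.card : ℝ) * K ≤ n * C₄ := by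
      rw [hn]
      exact_mod_cast hcard
    have hKpos : (0 : ℝ) < K := by positivity
    refine le_of_mul_le_mul_right (hcard'.trans ?_) hKpos
    calc n * C₄ ≤ n * (e * K) := mul_le_mul_of_nonneg_left hKe hn0
      _ = e * n * K := by ring
  have hsub : (Finset.univ.filter fun x : Fin (j + 1) → ι => ¬ (LinearIndependent ℝ (v ∘ x) ∧
      mass v (Submodule.span ℝ (Set.range (v ∘ x))) ≤ C₃ + K)) ⊆
      Sa ∪ Finset.univ.biUnion Sb ∪ Sc ∪ Sd ∪ Se := by
    intro x hx
    have hx := (Finset.mem_filter.1 hx).2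
    simp only [Finset.mem_union, Finset.mem_biUnion, hSa, hSb, hSc, hSd, hSe, Finset.mem_filter,
      Finset.mem_univ, true_and]
    by_contra hcon
    simp only [not_or, not_and, not_exists, not_not] at hcon
    obtain ⟨⟨⟨⟨ha, hb⟩, hc⟩, hd⟩, h_e⟩ := hcon
    have hGx : ∀ i, Fin.tail x i ∈ G (x 0) := fun i => hb i ha
    have hQ := hc ha hGx
    have hp0 : v (x 0) ≠ 0 := by
      have h1 := ((hmemG _ _).1 (hGx ⟨0, hj1⟩)).1.ne_zero 0
      simpa using h1
    refine hx ⟨linearIndependent_of_quotient (v ∘ x) hp0 hQ.1, ?_⟩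
    exact (not_le.1 (h_e hGx hQ (not_not.1 (Classical.not_imp.1 hd).2))).le
  have hfinal : ((Sa ∪ Finset.univ.biUnion Sb ∪ Sc ∪ Sd ∪ Se).card : ℝ) ≤
      Sa.card + (∑ i, ((Sb i).card : ℝ)) + Sc.card + Sd.card + Se.card := by
    have h1 := Finset.card_union_le (Sa ∪ Finset.univ.biUnion Sb ∪ Sc ∪ Sd) Se
    have h2 := Finset.card_union_le (Sa ∪ Finset.univ.biUnion Sb ∪ Sc) Sd
    have h3 := Finset.card_union_le (Sa ∪ Finset.univ.biUnion Sb) Sc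
    have h4 := Finset.card_union_le Sa (Finset.univ.biUnion Sb)
    have h5 : (Finset.univ.biUnion Sb).card ≤ ∑ i, (Sb i).card := Finset.card_biUnion_le
    rw [← Nat.cast_sum]
    exact_mod_cast (by omega : _ ≤ Sa.card + (∑ i, (Sb i).card) + Sc.card + Sd.card + Se.card)
  have hsum : ∑ i, ((Sb i).card : ℝ) ≤ e * (n * n ^ j) := by
    calc ∑ i, ((Sb i).card : ℝ) ≤ ∑ _i : Fin j, δ * n * n ^ j :=
          Finset.sum_le_sum fun i _ => hSb_card i
      _ = j * δ * (n * n ^ j) := by simp; ring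
      _ ≤ e * (n * n ^ j) := mul_le_mul_of_nonneg_right hδe (by positivity)
  refine (Nat.cast_le.2 (Finset.card_le_card hsub)).trans (hfinal.trans ?_)
  have hεe : ε * n ^ (j + 1) = 5 * (e * (n * n ^ j)) := by rw [he]; ring
  rw [hεe]
  linarith [hSa_card, hSc_card, hSd_card, hSe_card, hsum]

theorem genericSpan {k : ℕ} (hk : 1 ≤ k) : GenericSpan k :=
  Nat.le_induction genericSpan_one (fun _ hj h => h.succ hj) k hk

/-! ### Affine flats and homogeneous coordinates -/

theorem exists_le_finrank_eq {V : Type} [AddCommGroup V] [Module ℝ V] [FiniteDimensional ℝ V]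
    (D : Submodule ℝ V) {r : ℕ} (hD : Module.finrank ℝ D ≤ r) (hr : r ≤ Module.finrank ℝ V) :
    ∃ U : Submodule ℝ V, D ≤ U ∧ Module.finrank ℝ U = r := by
  have hq := Submodule.finrank_quotient_add_finrank D
  obtain ⟨s, hs, hli⟩ := exists_finset_linearIndependent_of_le_finrank (R := ℝ) (M := V ⧸ D)
    (n := r - Module.finrank ℝ D) (by omega)
  refine ⟨(Submodule.span ℝ (s : Set (V ⧸ D))).comap D.mkQ, fun x hx => ?_, ?_⟩
  · rw [Submodule.mem_comap, Submodule.mkQ_apply, (Submodule.Quotient.mk_eq_zero D).2 hx]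
    exact Submodule.zero_mem _
  · have h1 := finrank_span_finset_eq_card hli
    rw [finrank_comap_mkQ, h1, hs]
    omega

/-- Homogeneous coordinates `z ↦ (z, 1)`. -/
def homogenize (E : Type) [AddCommGroup E] [Module ℝ E] : E →ᵃ[ℝ] E × ℝ :=
  (AffineMap.id ℝ E).prod (AffineMap.const ℝ E 1)

section Homogenize

variable {E : Type} [AddCommGroup E] [Module ℝ E]

theorem homogenize_apply (z : E) : homogenize E z = (z, 1) := rfl

theorem homogenize_mem_span {S : Set E} {z : E} (hz : z ∈ affineSpan ℝ S) :
    homogenize E z ∈ Submodule.span ℝ (homogenize E '' S) := by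
  have : affineSpan ℝ S ≤
      (Submodule.span ℝ (homogenize E '' S)).toAffineSubspace.comap (homogenize E) :=
    affineSpan_le.2 fun x hx => Submodule.subset_span (Set.mem_image_of_mem _ hx)
  exact this hz

theorem affineIndependent_of_linearIndependent_homogenize {κ : Type} {p : κ → E}
    (h : LinearIndependent ℝ (homogenize E ∘ p)) : AffineIndependent ℝ p := by
  refine affineIndependent_iff.2 fun s w hw hp => linearIndependent_iff'.1 h s w ?_
  ext
  · simpa [homogenize_apply, Prod.fst_sum] using hp
  · simpa [homogenize_apply, Prod.snd_sum] using hw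

theorem finrank_comap_inl_lt [FiniteDimensional ℝ E] (W : Submodule ℝ (E × ℝ)) {z : E}
    (hz : homogenize E z ∈ W) :
    Module.finrank ℝ (W.comap (LinearMap.inl ℝ E ℝ)) < Module.finrank ℝ W := by
  rw [(Submodule.equivMapOfInjective (LinearMap.inl ℝ E ℝ) LinearMap.inl_injective _).finrank_eq]
  refine Submodule.finrank_lt_finrank_of_lt (lt_of_le_of_ne (Submodule.map_comap_le _ _) ?_)
  intro heq
  rw [← heq] at hz
  obtain ⟨y, -, hy⟩ := hz
  have := congrArg Prod.snd hy
  simp [homogenize_apply] at this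

end Homogenize

theorem exists_isKFlat_of_finrank_le {d k : ℕ} (hk : 1 ≤ k) (hkd : k ≤ d)
    (W : Submodule ℝ (Pt d × ℝ)) (hW : Module.finrank ℝ W ≤ k) :
    ∃ G : AffineSubspace ℝ (Pt d), IsKFlat (k - 1) G ∧
      ∀ z, homogenize (Pt d) z ∈ W → z ∈ G := by
  have hd : Module.finrank ℝ (Pt d) = d := by simp
  by_cases hex : ∃ z, homogenize (Pt d) z ∈ W
  · obtain ⟨z₀, hz₀⟩ := hex
    have hlt := finrank_comap_inl_lt W hz₀
    obtain ⟨U, hDU, hU⟩ := exists_le_finrank_eq (W.comap (LinearMap.inl ℝ (Pt d) ℝ))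
      (r := k - 1) (by omega) (by omega)
    refine ⟨AffineSubspace.mk' z₀ U, ⟨⟨z₀, AffineSubspace.self_mem_mk' _ _⟩, ?_⟩, fun z hz => ?_⟩
    · rw [AffineSubspace.direction_mk', hU]
    · rw [AffineSubspace.mem_mk']
      refine hDU ?_
      have := W.sub_mem hz hz₀
      simpa [homogenize_apply] using this
  · obtain ⟨U, -, hU⟩ := exists_le_finrank_eq (⊥ : Submodule ℝ (Pt d))
      (r := k - 1) (by simp) (by omega)
    refine ⟨AffineSubspace.mk' 0 U, ⟨⟨0, AffineSubspace.self_mem_mk' _ _⟩, ?_⟩,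
      fun z hz => absurd ⟨z, hz⟩ hex⟩
    rw [AffineSubspace.direction_mk', hU]

theorem mass_homogenize_le_one {E : Type} [AddCommGroup E] [Module ℝ E] (Q : Finset E)
    [FiniteDimensional ℝ E] (W : Submodule ℝ (E × ℝ)) (hW : Module.finrank ℝ W ≤ 1) :
    mass (fun q : Q => homogenize E q) W ≤ 1 := by
  refine Finset.card_le_one.2 fun a ha b hb => Subtype.ext ?_
  have ha := (Finset.mem_filter.1 ha).2
  have hb := (Finset.mem_filter.1 hb).2
  have hlt := finrank_comap_inl_lt W ha
  have h0 : W.comap (LinearMap.inl ℝ E ℝ) = ⊥ := Submodule.finrank_eq_zero.1 (by omega)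
  have hmem : (a : E) - b ∈ W.comap (LinearMap.inl ℝ E ℝ) := by
    have := W.sub_mem ha hb
    simpa [homogenize_apply] using this
  rw [h0, Submodule.mem_bot, sub_eq_zero] at hmem
  exact hmem

theorem card_fun_le_two_mul {d k : ℕ} (Q : Finset (Pt d)) (C : ℕ)
    (B : Finset (AffineSubspace ℝ (Pt d)))
    (T : Finset (Fin k → Q))
    (hT : ∀ x ∈ T, LinearIndependent ℝ ((fun q : Q => homogenize (Pt d) q) ∘ x) ∧
      mass (fun q : Q => homogenize (Pt d) q) (Submodule.span ℝ
        (Set.range ((fun q : Q => homogenize (Pt d) q) ∘ x))) ≤ C)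
    (hB : ∀ x ∈ T, affineSpan ℝ (Set.range fun i => (x i : Pt d)) ∈ B) :
    (T.card : ℝ) ≤ (C : ℝ) ^ k * B.card := by
  refine card_le_mul_card_of_fiber_le T B
    (fun x => affineSpan ℝ (Set.range fun i => (x i : Pt d))) hB _ fun b _ => ?_
  rcases Finset.eq_empty_or_nonempty
    (T.filter fun x => affineSpan ℝ (Set.range fun i => (x i : Pt d)) = b) with h0 | ⟨x₀, hx₀⟩
  · rw [h0]
    simp
  · obtain ⟨hx₀T, rfl⟩ := Finset.mem_filter.1 hx₀
    set N : Finset Q := Finset.univ.filter fun q =>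
      (q : Pt d) ∈ affineSpan ℝ (Set.range fun i => (x₀ i : Pt d)) with hN
    have hNC : N.card ≤ C := by
      refine le_trans (Finset.card_le_card fun q hq => ?_) (hT x₀ hx₀T).2
      refine Finset.mem_filter.2 ⟨Finset.mem_univ _, ?_⟩
      have := homogenize_mem_span (Finset.mem_filter.1 hq).2
      rwa [← Set.range_comp] at this
    have hle : (T.filter fun x => affineSpan ℝ (Set.range fun i => (x i : Pt d)) =
        affineSpan ℝ (Set.range fun i => (x₀ i : Pt d))).card ≤ C ^ k := by
      refine le_trans (Finset.card_le_card (t := Fintype.piFinset fun _ => N) fun x hx => ?_) ?_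
      · refine Fintype.mem_piFinset.2 fun i => Finset.mem_filter.2 ⟨Finset.mem_univ _, ?_⟩
        rw [← (Finset.mem_filter.1 hx).2]
        exact subset_affineSpan ℝ _ ⟨i, rfl⟩
      · rw [Fintype.card_piFinset_const]
        exact Nat.pow_le_pow_left hNC k
    exact_mod_cast hle

/-- Beck's theorem, as stated in the paper: if no `(k−1)`-flat contains more
than an `α`-fraction of `P ∩ F`, then `P ∩ F` spans at least `β · |P ∩ F|^k` distinct
`(k−1)`-flats. -/
theorem beck_degenerate_flats (k : ℕ) (hk : 1 ≤ k) :
    ∃ α β : ℝ, 0 < α ∧ 0 < β ∧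
      ∀ d : ℕ, k ≤ d →
        ∀ P : Finset (Pt d), ∀ F : AffineSubspace ℝ (Pt d), IsKFlat k F →
          (∀ G : AffineSubspace ℝ (Pt d), IsKFlat (k - 1) G →
            (((↑P : Set (Pt d)) ∩ (F : Set (Pt d)) ∩ (G : Set (Pt d))).ncard : ℝ) ≤
              α * (((↑P : Set (Pt d)) ∩ (F : Set (Pt d))).ncard : ℝ)) →
          β * (((↑P : Set (Pt d)) ∩ (F : Set (Pt d))).ncard : ℝ) ^ k ≤
            ({G : AffineSubspace ℝ (Pt d) |
                ∃ S : Finset (Pt d), ↑S ⊆ (↑P : Set (Pt d)) ∩ (F : Set (Pt d)) ∧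
                  S.card = k ∧ AffineIndependent ℝ ((↑) : ↥S → Pt d) ∧
                  G = affineSpan ℝ (↑S : Set (Pt d))}.ncard : ℝ) := by
  obtain ⟨α, hα, C, hgen⟩ := genericSpan hk (1 / 2) (by norm_num) 1
  refine ⟨α, 1 / (2 * ((C : ℝ) + 1) ^ k), hα, by positivity, ?_⟩
  intro d hkd P F _ hrich
  obtain ⟨Q, hQ⟩ : ∃ Q : Finset (Pt d), (Q : Set (Pt d)) = (↑P : Set (Pt d)) ∩ (F : Set (Pt d)) :=
    ⟨P.filter (· ∈ F), by ext; simp⟩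
  rw [← hQ] at hrich ⊢
  rw [Set.ncard_coe_finset] at hrich ⊢
  set Φ : Set (AffineSubspace ℝ (Pt d)) := {G | ∃ S : Finset (Pt d), ↑S ⊆ (Q : Set (Pt d)) ∧
    S.card = k ∧ AffineIndependent ℝ ((↑) : ↥S → Pt d) ∧ G = affineSpan ℝ (↑S : Set (Pt d))}
    with hΦ
  have hΦfin : Φ.Finite := by
    refine (Q.powerset.finite_toSet.image fun S : Finset (Pt d) =>
      affineSpan ℝ (S : Set (Pt d))).subset ?_
    rintro G ⟨S, hS, -, -, rfl⟩
    exact ⟨S, Finset.mem_coe.2 (Finset.mem_powerset.2 (Finset.coe_subset.1 hS)), rfl⟩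
  set v : Q → Pt d × ℝ := fun q => homogenize (Pt d) q with hv
  have hbad := hgen (Pt d × ℝ) Q v (mass_homogenize_le_one Q) (fun W hW => by
    obtain ⟨G, hG, hWG⟩ := exists_isKFlat_of_finrank_le hk hkd W hW
    rw [Fintype.card_coe]
    refine le_trans (Nat.cast_le.2 ?_) (hrich G hG)
    have hfin : ((Q : Set (Pt d)) ∩ (G : Set (Pt d))).Finite := Q.finite_toSet.inter_of_left _
    rw [Set.ncard_eq_toFinset_card _ hfin]
    refine Finset.card_le_card_of_injOn Subtype.val (fun q hq => ?_) Subtype.val_injective.injOn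
    rw [Set.Finite.coe_toFinset]
    exact ⟨q.2, hWG q (Finset.mem_filter.1 hq).2⟩)
  set T : Finset (Fin k → Q) := Finset.univ.filter fun x => LinearIndependent ℝ (v ∘ x) ∧
    mass v (Submodule.span ℝ (Set.range (v ∘ x))) ≤ C with hT
  have hcompl := Finset.card_filter_add_card_filter_not (s := (Finset.univ : Finset (Fin k → Q)))
    (fun x => LinearIndependent ℝ (v ∘ x) ∧
      mass v (Submodule.span ℝ (Set.range (v ∘ x))) ≤ C)
  have hTcard : (Q.card : ℝ) ^ k ≤ 2 * T.card := by
    have hcompl' : (T.card : ℝ) + ((Finset.univ.filter fun x : Fin k → Q =>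
        ¬ (LinearIndependent ℝ (v ∘ x) ∧
          mass v (Submodule.span ℝ (Set.range (v ∘ x))) ≤ C)).card : ℝ) = (Q.card : ℝ) ^ k := by
      have h1 : (Finset.univ : Finset (Fin k → Q)).card = Q.card ^ k := by simp
      rw [h1] at hcompl
      exact_mod_cast hcompl
    rw [Fintype.card_coe] at hbad
    linarith
  have hTB := card_fun_le_two_mul Q C hΦfin.toFinset T
    (fun x hx => (Finset.mem_filter.1 hx).2) (fun x hx => by
      rw [Set.Finite.mem_toFinset]
      have hx := (Finset.mem_filter.1 hx).2.1
      have haff : AffineIndependent ℝ fun i => (x i : Pt d) :=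
        affineIndependent_of_linearIndependent_homogenize hx
      have hcoe : ((Finset.univ.image fun i => (x i : Pt d) : Finset (Pt d)) : Set (Pt d)) =
          Set.range fun i => (x i : Pt d) := by simp
      refine ⟨Finset.univ.image fun i => (x i : Pt d), ?_, ?_, ?_, by rw [hcoe]⟩
      · rw [hcoe]
        rintro _ ⟨i, rfl⟩
        exact (x i).2
      · rw [Finset.card_image_of_injective _ haff.injective, Finset.card_univ, Fintype.card_fin]
      · have h1 := haff.range
        rw [← hcoe] at h1
        exact h1)
  rw [← Set.ncard_eq_toFinset_card Φ hΦfin] at hTB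
  have hpow : (C : ℝ) ^ k ≤ ((C : ℝ) + 1) ^ k :=
    pow_le_pow_left₀ (by positivity) (by linarith) k
  have hΦ0 : (0 : ℝ) ≤ Φ.ncard := by positivity
  rw [one_div_mul_eq_div, div_le_iff₀ (by positivity)]
  nlinarith [mul_le_mul_of_nonneg_right hpow hΦ0]
end
end

section
/- There exist absolute constants c₁, c₂, c₃, c₄ > 0 such that for every integer s ≥ 1 there is a partition of the unit sphere S² ⊂ ℝ³ (centered at the origin) into 6s² measurable regions with the following properties: each region has spherical surface area at least c₁/s² and at most c₂/s²; each region is contained in a Euclidean ball of radius c₃/s; and every plane in ℝ³ intersects at most c₄ · s of the regions. -/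
open scoped Classical

noncomputable section

open MeasureTheory

/-- The sign of a face of the cube `[-1, 1]³`. -/
def boolSign (τ : Bool) : ℝ := cond τ 1 (-1)

theorem boolSign_sq (τ : Bool) : boolSign τ * boolSign τ = 1 := by
  cases τ <;> simp [boolSign]

/-- The closed cone over the square `[α, α + h] × [β, β + h]` in the face of the cube `[-1, 1]³`
on which the `k`-th coordinate is the sign `τ`, apex removed. -/
def cubeCone (k : Fin 3) (τ : Bool) (α β h : ℝ) : Set (Pt 3) :=
  {x | 0 < boolSign τ * x k ∧
    α * (boolSign τ * x k) ≤ boolSign τ * x (k + 1) ∧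
    boolSign τ * x (k + 1) ≤ (α + h) * (boolSign τ * x k) ∧
    β * (boolSign τ * x k) ≤ boolSign τ * x (k + 2) ∧
    boolSign τ * x (k + 2) ≤ (β + h) * (boolSign τ * x k)}

/-- The open cone corresponding to `cubeCone`. -/
def openCubeCone (k : Fin 3) (τ : Bool) (α β h : ℝ) : Set (Pt 3) :=
  {x | 0 < boolSign τ * x k ∧
    α * (boolSign τ * x k) < boolSign τ * x (k + 1) ∧
    boolSign τ * x (k + 1) < (α + h) * (boolSign τ * x k) ∧
    β * (boolSign τ * x k) < boolSign τ * x (k + 2) ∧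
    boolSign τ * x (k + 2) < (β + h) * (boolSign τ * x k)}

theorem openCubeCone_subset_cubeCone (k : Fin 3) (τ : Bool) (α β h : ℝ) :
    openCubeCone k τ α β h ⊆ cubeCone k τ α β h :=
  fun _ hx => ⟨hx.1, hx.2.1.le, hx.2.2.1.le, hx.2.2.2.1.le, hx.2.2.2.2.le⟩

theorem measurableSet_cubeCone (k : Fin 3) (τ : Bool) (α β h : ℝ) :
    MeasurableSet (cubeCone k τ α β h) := by
  have hm (i : Fin 3) : Measurable fun x : Pt 3 => boolSign τ * x i := by fun_prop
  exact (measurableSet_lt measurable_const (hm k)).inter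
    ((measurableSet_le ((hm k).const_mul α) (hm _)).inter
    ((measurableSet_le (hm _) ((hm k).const_mul (α + h))).inter
    ((measurableSet_le ((hm k).const_mul β) (hm _)).inter
    (measurableSet_le (hm _) ((hm k).const_mul (β + h))))))

theorem Fin.eq_or_eq_add_one_or_eq_add_two (k m : Fin 3) : m = k ∨ m = k + 1 ∨ m = k + 2 := by
  revert k m; decide

theorem Pt.norm_sq_eq_cyclic (k : Fin 3) (x : Pt 3) :
    ‖x‖ ^ 2 = x k ^ 2 + x (k + 1) ^ 2 + x (k + 2) ^ 2 := by
  rw [EuclideanSpace.real_norm_sq_eq, Fin.sum_univ_three]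
  fin_cases k <;> simp <;> ring

theorem Pt.abs_apply_le_norm {d : ℕ} (x : Pt d) (i : Fin d) : |x i| ≤ ‖x‖ := by
  simpa using PiLp.norm_apply_le x i

theorem boolSign_mul_sq (τ : Bool) (t : ℝ) : t ^ 2 = (boolSign τ * t) ^ 2 := by
  rw [mul_pow, sq (boolSign τ), boolSign_sq, one_mul]

theorem abs_boolSign_mul (τ : Bool) (t : ℝ) : |boolSign τ * t| = |t| := by
  cases τ <;> simp [boolSign]

theorem abs_apply_le_of_mem_cubeCone {k : Fin 3} {τ : Bool} {α β h : ℝ} (hα : -1 ≤ α)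
    (hα' : α + h ≤ 1) (hβ : -1 ≤ β) (hβ' : β + h ≤ 1) {x : Pt 3}
    (hx : x ∈ cubeCone k τ α β h) (m : Fin 3) : |x m| ≤ |x k| := by
  obtain ⟨h0, h1, h2, h3, h4⟩ := hx
  rw [← abs_boolSign_mul τ (x m), ← abs_boolSign_mul τ (x k), abs_of_pos h0]
  rcases Fin.eq_or_eq_add_one_or_eq_add_two k m with rfl | rfl | rfl
  · rw [abs_of_pos h0]
  · rw [abs_le]; constructor <;> nlinarith
  · rw [abs_le]; constructor <;> nlinarith

theorem abs_apply_lt_of_mem_openCubeCone {k : Fin 3} {τ : Bool} {α β h : ℝ} (hα : -1 ≤ α)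
    (hα' : α + h ≤ 1) (hβ : -1 ≤ β) (hβ' : β + h ≤ 1) {x : Pt 3}
    (hx : x ∈ openCubeCone k τ α β h) {m : Fin 3} (hm : m ≠ k) : |x m| < |x k| := by
  obtain ⟨h0, h1, h2, h3, h4⟩ := hx
  rw [← abs_boolSign_mul τ (x m), ← abs_boolSign_mul τ (x k), abs_of_pos h0]
  rcases Fin.eq_or_eq_add_one_or_eq_add_two k m with rfl | rfl | rfl
  · exact absurd rfl hm
  · rw [abs_lt]; constructor <;> nlinarith
  · rw [abs_lt]; constructor <;> nlinarith

/-- The point with coordinates `p` in the face of `[-1, 1]³` with direction `k` and sign `τ`. -/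
def facePoint (k : Fin 3) (τ : Bool) (p : Fin 2 → ℝ) : Pt 3 :=
  WithLp.toLp 2 fun i =>
    boolSign τ * (if i = k then 1 else if i = k + 1 then p 0 else p 1)

section facePoint

variable (k : Fin 3) (τ : Bool) (p : Fin 2 → ℝ)

theorem boolSign_mul_facePoint : boolSign τ * facePoint k τ p k = 1 := by
  simp [facePoint, boolSign_sq]

theorem boolSign_mul_facePoint_add_one : boolSign τ * facePoint k τ p (k + 1) = p 0 := by
  have h : k + 1 ≠ k := by revert k; decide
  simp [facePoint, ← mul_assoc, boolSign_sq]

theorem boolSign_mul_facePoint_add_two : boolSign τ * facePoint k τ p (k + 2) = p 1 := by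
  have h : k + 2 ≠ k := by revert k; decide
  have h' : k + 2 ≠ k + 1 := by revert k; decide
  simp [facePoint, ← mul_assoc, boolSign_sq]

theorem norm_facePoint_sq : ‖facePoint k τ p‖ ^ 2 = 1 + p 0 ^ 2 + p 1 ^ 2 := by
  have h := boolSign_mul_sq τ
  rw [Pt.norm_sq_eq_cyclic k, h (facePoint k τ p k), h (facePoint k τ p (k + 1)),
    h (facePoint k τ p (k + 2)), boolSign_mul_facePoint, boolSign_mul_facePoint_add_one,
    boolSign_mul_facePoint_add_two, one_pow]

theorem one_le_norm_facePoint : 1 ≤ ‖facePoint k τ p‖ := by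
  nlinarith [norm_facePoint_sq k τ p, norm_nonneg (facePoint k τ p), sq_nonneg (p 0),
    sq_nonneg (p 1)]

theorem norm_facePoint_sub_le (q : Fin 2 → ℝ) :
    ‖facePoint k τ p - facePoint k τ q‖ ≤ 2 * ‖p - q‖ := by
  have h := boolSign_mul_sq τ
  have h0 : |p 0 - q 0| ≤ ‖p - q‖ := norm_le_pi_norm (p - q) 0
  have h1 : |p 1 - q 1| ≤ ‖p - q‖ := norm_le_pi_norm (p - q) 1
  have key : ‖facePoint k τ p - facePoint k τ q‖ ^ 2 = (p 0 - q 0) ^ 2 + (p 1 - q 1) ^ 2 := by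
    rw [Pt.norm_sq_eq_cyclic k, h ((facePoint k τ p - facePoint k τ q) k),
      h ((facePoint k τ p - facePoint k τ q) (k + 1)),
      h ((facePoint k τ p - facePoint k τ q) (k + 2))]
    simp only [PiLp.sub_apply, mul_sub, boolSign_mul_facePoint, boolSign_mul_facePoint_add_one,
      boolSign_mul_facePoint_add_two]
    ring
  refine abs_le_of_sq_le_sq' ?_ (by positivity) |>.2
  rw [key]
  nlinarith [sq_le_sq' (abs_le.1 h0).1 (abs_le.1 h0).2, sq_le_sq' (abs_le.1 h1).1 (abs_le.1 h1).2,
    sq_nonneg ‖p - q‖]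

end facePoint

theorem norm_inv_norm_smul_sub_le {E : Type*} [NormedAddCommGroup E] [NormedSpace ℝ E] {x y : E}
    (hx : 1 ≤ ‖x‖) (hy : 1 ≤ ‖y‖) : ‖‖x‖⁻¹ • x - ‖y‖⁻¹ • y‖ ≤ 2 * ‖x - y‖ := by
  have hx0 : 0 < ‖x‖ := by linarith
  have hy0 : 0 < ‖y‖ := by linarith
  have e : ‖x‖⁻¹ • x - ‖y‖⁻¹ • y = ‖x‖⁻¹ • ((x - y) + ((‖y‖ - ‖x‖) * ‖y‖⁻¹) • y) := by
    rw [smul_add, smul_sub, smul_smul, sub_mul, mul_inv_cancel₀ hy0.ne', mul_sub,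
      inv_mul_cancel_left₀ hx0.ne', sub_smul]
    module
  have h1 : ‖((‖y‖ - ‖x‖) * ‖y‖⁻¹) • y‖ ≤ ‖x - y‖ := by
    rw [norm_smul, norm_mul, norm_inv, norm_norm, mul_assoc, inv_mul_cancel₀ hy0.ne', mul_one,
      Real.norm_eq_abs, norm_sub_rev]
    exact abs_norm_sub_norm_le y x
  calc _ ≤ 1 * (‖x - y‖ + ‖x - y‖) := by
        rw [e, norm_smul, norm_inv, norm_norm]
        gcongr
        · exact inv_le_one_of_one_le₀ hx
        · exact (norm_add_le _ _).trans (by gcongr)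
    _ = _ := by ring

/-- Central projection to the unit sphere of the face of `[-1, 1]³` with direction `k` and
sign `τ`. -/
def sphereChart (k : Fin 3) (τ : Bool) (p : Fin 2 → ℝ) : Pt 3 :=
  ‖facePoint k τ p‖⁻¹ • facePoint k τ p

/-- Gnomonic coordinates in direction `k`, inverse to `sphereChart`. -/
def gnomonic (k : Fin 3) (x : Pt 3) : Fin 2 → ℝ := ![x (k + 1) / x k, x (k + 2) / x k]

theorem lipschitzWith_sphereChart (k : Fin 3) (τ : Bool) : LipschitzWith 4 (sphereChart k τ) := by
  refine LipschitzWith.of_dist_le_mul fun p q => ?_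
  rw [dist_eq_norm, dist_eq_norm]
  have h1 := norm_inv_norm_smul_sub_le (one_le_norm_facePoint k τ p) (one_le_norm_facePoint k τ q)
  have h2 := norm_facePoint_sub_le k τ p q
  have : ((4 : NNReal) : ℝ) = 4 := rfl
  rw [this]
  exact h1.trans (by linarith)

theorem norm_sphereChart (k : Fin 3) (τ : Bool) (p : Fin 2 → ℝ) : ‖sphereChart k τ p‖ = 1 := by
  have := one_le_norm_facePoint k τ p
  rw [sphereChart, norm_smul, norm_inv, norm_norm, inv_mul_cancel₀ (by linarith)]

theorem gnomonic_sphereChart (k : Fin 3) (τ : Bool) (p : Fin 2 → ℝ) :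
    gnomonic k (sphereChart k τ p) = p := by
  have h := one_le_norm_facePoint k τ p
  have hn : ‖facePoint k τ p‖⁻¹ ≠ 0 := inv_ne_zero (by linarith)
  have hτ : boolSign τ ≠ 0 := fun h0 => by simpa [h0] using boolSign_sq τ
  have e (i : Fin 3) : sphereChart k τ p i / sphereChart k τ p k =
      boolSign τ * facePoint k τ p i / (boolSign τ * facePoint k τ p k) := by
    simp only [sphereChart, PiLp.smul_apply, smul_eq_mul]
    rw [mul_div_mul_left _ _ hn, mul_div_mul_left _ _ hτ]
  ext i
  fin_cases i <;> simp [gnomonic, e, boolSign_mul_facePoint, boolSign_mul_facePoint_add_one,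
    boolSign_mul_facePoint_add_two]

theorem sphereChart_gnomonic {k : Fin 3} {τ : Bool} {x : Pt 3} (hx : ‖x‖ = 1)
    (hk : 0 < boolSign τ * x k) : sphereChart k τ (gnomonic k x) = x := by
  have hx0 : x k ≠ 0 := right_ne_zero_of_mul hk.ne'
  have hf : facePoint k τ (gnomonic k x) = (boolSign τ * x k)⁻¹ • x := by
    have hτ : (boolSign τ)⁻¹ = boolSign τ := inv_eq_of_mul_eq_one_left (boolSign_sq τ)
    ext m
    have h1 : k + 1 ≠ k := by clear * -; revert k; decide
    have h2 : k + 2 ≠ k := by clear * -; revert k; decide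
    have h3 : k + 2 ≠ k + 1 := by clear * -; revert k; decide
    rcases Fin.eq_or_eq_add_one_or_eq_add_two k m with rfl | rfl | rfl <;>
      simp [facePoint, gnomonic, hτ, h2, h3] <;> field_simp
  rw [sphereChart, hf, norm_smul, hx, norm_inv, Real.norm_of_nonneg hk.le, mul_one, inv_inv,
    smul_smul, mul_inv_cancel₀ hk.ne', one_smul]

theorem sphereChart_mem_openCubeCone {k : Fin 3} {τ : Bool} {α β h : ℝ} {p : Fin 2 → ℝ}
    (h0 : p 0 ∈ Set.Ioo α (α + h)) (h1 : p 1 ∈ Set.Ioo β (β + h)) :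
    sphereChart k τ p ∈ openCubeCone k τ α β h := by
  have h := one_le_norm_facePoint k τ p
  have hn : 0 < ‖facePoint k τ p‖⁻¹ := inv_pos.2 (by linarith)
  have e (i : Fin 3) : boolSign τ * sphereChart k τ p i =
      ‖facePoint k τ p‖⁻¹ * (boolSign τ * facePoint k τ p i) := by
    simp only [sphereChart, PiLp.smul_apply, smul_eq_mul]; ring
  simp only [openCubeCone, Set.mem_ofPred_eq, e, boolSign_mul_facePoint,
    boolSign_mul_facePoint_add_one, boolSign_mul_facePoint_add_two]
  refine ⟨by linarith, ?_, ?_, ?_, ?_⟩ <;> nlinarith [h0.1, h0.2, h1.1, h1.2]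

theorem gnomonic_mem_of_mem_cubeCone {k : Fin 3} {τ : Bool} {α β h : ℝ} {x : Pt 3}
    (hx : x ∈ cubeCone k τ α β h) :
    gnomonic k x 0 ∈ Set.Icc α (α + h) ∧ gnomonic k x 1 ∈ Set.Icc β (β + h) := by
  obtain ⟨h0, h1, h2, h3, h4⟩ := hx
  have hτ : boolSign τ ≠ 0 := left_ne_zero_of_mul h0.ne'
  have e (i : Fin 3) : x i / x k = boolSign τ * x i / (boolSign τ * x k) := by
    rw [mul_div_mul_left _ _ hτ]
  simp only [gnomonic, Matrix.cons_val_zero, Matrix.cons_val_one, e, Set.mem_Icc, le_div_iff₀ h0,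
    div_le_iff₀ h0]
  exact ⟨⟨h1, h2⟩, h3, h4⟩

theorem half_le_abs_apply_of_forall_abs_le {x : Pt 3} {k : Fin 3} (hx : ‖x‖ = 1)
    (h : ∀ m, |x m| ≤ |x k|) : 1 / 2 ≤ |x k| := by
  have e := Pt.norm_sq_eq_cyclic k x
  have h1 := sq_le_sq.2 (h (k + 1))
  have h2 := sq_le_sq.2 (h (k + 2))
  rw [← sq_abs (x k)] at *
  rw [hx] at e
  nlinarith [abs_nonneg (x k)]

theorem lipschitzOnWith_gnomonic (k : Fin 3) :
    LipschitzOnWith 4 (gnomonic k) {x | ‖x‖ = 1 ∧ ∀ m, |x m| ≤ |x k|} := by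
  refine LipschitzOnWith.of_dist_le_mul fun x hx y hy => ?_
  have hx2 := half_le_abs_apply_of_forall_abs_le hx.1 hx.2
  have hy2 := half_le_abs_apply_of_forall_abs_le hy.1 hy.2
  have hx0 : x k ≠ 0 := abs_pos.1 (by linarith)
  have hy0 : y k ≠ 0 := abs_pos.1 (by linarith)
  have key (m : Fin 3) : |x m / x k - y m / y k| ≤ 4 * ‖x - y‖ := by
    have hm : |x m - y m| ≤ ‖x - y‖ := Pt.abs_apply_le_norm (x - y) m
    have hk : |x k - y k| ≤ ‖x - y‖ := Pt.abs_apply_le_norm (x - y) k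
    have e : x m / x k - y m / y k = ((x m - y m) - y m / y k * (x k - y k)) / x k := by
      field_simp; ring
    have hq : |y m / y k| ≤ 1 := by
      rw [abs_div]; exact div_le_one_of_le₀ (hy.2 m) (abs_nonneg _)
    have hn : |(x m - y m) - y m / y k * (x k - y k)| ≤ 2 * ‖x - y‖ := by
      refine (abs_sub _ _).trans ?_
      rw [abs_mul]
      nlinarith [abs_nonneg (x k - y k), abs_nonneg (y m / y k)]
    rw [e, abs_div, div_le_iff₀ (by linarith)]
    nlinarith [norm_nonneg (x - y)]
  rw [dist_eq_norm x y, dist_pi_le_iff (by positivity)]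
  intro i
  fin_cases i
  · exact key (k + 1)
  · exact key (k + 2)

theorem volume_planar_annulus_le {A B : ℝ} (hAB : A ≤ B) :
    volume {p : Fin 2 → ℝ | A ≤ p 0 ^ 2 + p 1 ^ 2 ∧ p 0 ^ 2 + p 1 ^ 2 ≤ B} ≤
      ENNReal.ofReal ((B - A) * Real.pi) := by
  have hpi := Real.pi_pos
  have hmeas : MeasurableSet {p : Fin 2 → ℝ | A ≤ p 0 ^ 2 + p 1 ^ 2 ∧ p 0 ^ 2 + p 1 ^ 2 ≤ B} := by
    have hm : Measurable fun p : Fin 2 → ℝ => p 0 ^ 2 + p 1 ^ 2 := by fun_prop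
    exact (measurableSet_le measurable_const hm).inter (measurableSet_le hm measurable_const)
  rw [← (PiLp.volume_preserving_ofLp (Fin 2)).measure_preimage hmeas.nullMeasurableSet]
  have hnorm (x : Pt 2) : x 0 ^ 2 + x 1 ^ 2 = ‖x‖ ^ 2 := by
    rw [EuclideanSpace.real_norm_sq_eq, Fin.sum_univ_two]
  rcases lt_or_ge B 0 with hB | hB
  · convert zero_le (a := ENNReal.ofReal ((B - A) * Real.pi))
    convert measure_empty (μ := (volume : Measure (Pt 2)))
    refine Set.eq_empty_of_forall_notMem fun x hx => ?_
    have : x 0 ^ 2 + x 1 ^ 2 ≤ B := hx.2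
    nlinarith [sq_nonneg (x 0), sq_nonneg (x 1)]
  rcases le_or_gt A 0 with hA | hA
  · calc _ ≤ volume (Metric.closedBall (0 : Pt 2) √B) := by
          refine measure_mono fun x hx => ?_
          have : x 0 ^ 2 + x 1 ^ 2 ≤ B := hx.2
          rw [mem_closedBall_zero_iff]
          exact Real.le_sqrt_of_sq_le (by rwa [← hnorm])
      _ = ENNReal.ofReal (B * Real.pi) := by
          rw [EuclideanSpace.volume_closedBall_fin_two, ← ENNReal.ofReal_pow (by positivity),
            Real.sq_sqrt hB, ENNReal.ofReal_mul hB]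
      _ ≤ _ := by gcongr; linarith
  · calc _ ≤ volume (Metric.closedBall (0 : Pt 2) √B \ Metric.ball 0 √A) := by
          refine measure_mono fun x hx => ?_
          have h1 : A ≤ x 0 ^ 2 + x 1 ^ 2 := hx.1
          have h2 : x 0 ^ 2 + x 1 ^ 2 ≤ B := hx.2
          rw [hnorm] at h1 h2
          simp only [Set.mem_sdiff, mem_closedBall_zero_iff, mem_ball_zero_iff, not_lt]
          exact ⟨Real.le_sqrt_of_sq_le h2, (Real.sqrt_le_left (norm_nonneg x)).2 h1⟩
      _ = ENNReal.ofReal (B * Real.pi) - ENNReal.ofReal (A * Real.pi) := by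
          rw [measure_sdiff _ measurableSet_ball.nullMeasurableSet measure_ball_lt_top.ne,
            EuclideanSpace.volume_closedBall_fin_two, EuclideanSpace.volume_ball_fin_two,
            ← ENNReal.ofReal_pow (by positivity), ← ENNReal.ofReal_pow (by positivity),
            Real.sq_sqrt hB, Real.sq_sqrt hA.le, ENNReal.ofReal_mul hB, ENNReal.ofReal_mul hA.le]
          exact (Metric.ball_subset_ball (Real.sqrt_le_sqrt hAB)).trans Metric.ball_subset_closedBall
      _ = _ := by
          rw [← ENNReal.ofReal_sub _ (by positivity), sub_mul]

theorem volume_slab_inter_shell_le {a : Pt 3} (ha : ‖a‖ = 1) (b : ℝ) {h A B : ℝ}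
    (hAB : A ≤ B) :
    volume {x : Pt 3 | |inner ℝ a x - b| ≤ h ∧ A ≤ ‖x‖ ^ 2 ∧ ‖x‖ ^ 2 ≤ B} ≤
      ENNReal.ofReal (2 * h) * ENNReal.ofReal ((B - A) * Real.pi) := by
  obtain ⟨e, he⟩ : ∃ e : OrthonormalBasis (Fin 3) ℝ (Pt 3), ∀ i ∈ ({0} : Set (Fin 3)), e i = a :=
    Orthonormal.exists_orthonormalBasis_extension_of_card_eq (v := fun _ => a) (by simp)
      ⟨fun _ => ha, fun i j hij => absurd (Subsingleton.elim i j) hij⟩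
  have he0 : e 0 = a := he 0 rfl
  set S : Set (ℝ × (Fin 2 → ℝ)) := {q | |q.1 - b| ≤ h ∧
    A ≤ q.1 ^ 2 + (q.2 0 ^ 2 + q.2 1 ^ 2) ∧ q.1 ^ 2 + (q.2 0 ^ 2 + q.2 1 ^ 2) ≤ B} with hS
  have hSm : MeasurableSet S := by
    have hm₁ : Measurable fun q : ℝ × (Fin 2 → ℝ) => |q.1 - b| := by fun_prop
    have hm₂ : Measurable fun q : ℝ × (Fin 2 → ℝ) => q.1 ^ 2 + (q.2 0 ^ 2 + q.2 1 ^ 2) := by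
      fun_prop
    exact (measurableSet_le hm₁ measurable_const).inter
      ((measurableSet_le measurable_const hm₂).inter (measurableSet_le hm₂ measurable_const))
  have hmp := ((volume_preserving_piFinSuccAbove (fun _ : Fin 3 => ℝ) 0).comp
    (PiLp.volume_preserving_ofLp (Fin 3))).comp e.measurePreserving_repr
  have hset : {x : Pt 3 | |inner ℝ a x - b| ≤ h ∧ A ≤ ‖x‖ ^ 2 ∧ ‖x‖ ^ 2 ≤ B} =
      ((MeasurableEquiv.piFinSuccAbove (fun _ : Fin 3 => ℝ) 0 ∘ WithLp.ofLp) ∘ e.repr) ⁻¹' S := by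
    ext x
    have h1 : inner ℝ a x = e.repr x 0 := by rw [e.repr_apply_apply, he0]
    have h2 : ‖x‖ ^ 2 = e.repr x 0 ^ 2 + (e.repr x 1 ^ 2 + e.repr x 2 ^ 2) := by
      rw [← e.repr.norm_map x, EuclideanSpace.real_norm_sq_eq, Fin.sum_univ_three, add_assoc]
    simp only [Set.mem_ofPred_eq, h1, h2]
    rfl
  rw [hset, hmp.measure_preimage hSm.nullMeasurableSet, Measure.volume_eq_prod,
    Measure.prod_apply hSm]
  calc _ ≤ ∫⁻ z : ℝ, (Set.Icc (b - h) (b + h)).indicator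
          (fun _ => ENNReal.ofReal ((B - A) * Real.pi)) z := by
        refine lintegral_mono fun z => ?_
        by_cases hz : z ∈ Set.Icc (b - h) (b + h)
        · rw [Set.indicator_of_mem hz]
          calc _ ≤ volume {p : Fin 2 → ℝ | A - z ^ 2 ≤ p 0 ^ 2 + p 1 ^ 2 ∧
                  p 0 ^ 2 + p 1 ^ 2 ≤ B - z ^ 2} := by
                refine measure_mono fun p hp => ?_
                have hp' : A ≤ z ^ 2 + (p 0 ^ 2 + p 1 ^ 2) ∧ z ^ 2 + (p 0 ^ 2 + p 1 ^ 2) ≤ B := hp.2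
                exact ⟨by linarith [hp'.1], by linarith [hp'.2]⟩
            _ ≤ _ := volume_planar_annulus_le (by linarith)
            _ = _ := by congr 2; ring
        · rw [Set.indicator_of_notMem hz, nonpos_iff_eq_zero]
          convert measure_empty (μ := (volume : Measure (Fin 2 → ℝ)))
          refine Set.eq_empty_of_forall_notMem fun p hp => hz ?_
          have hp' : |z - b| ≤ h := hp.1
          rw [abs_le] at hp'
          exact ⟨by linarith, by linarith⟩
    _ = _ := by
        rw [lintegral_indicator measurableSet_Icc, setLIntegral_const, Real.volume_Icc, mul_comm]
        congr 2; ring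

theorem card_mul_le_of_balls_subset_slab {ι : Type*} (I : Finset ι) {c : ι → Pt 3} {r : ℝ}
    (hr : 0 ≤ r) (hc : Pairwise (Function.onFun Disjoint fun i => Metric.ball (c i) r))
    {a : Pt 3} (ha : ‖a‖ = 1) (b : ℝ) {h A B : ℝ} (hh : 0 ≤ h) (hAB : A ≤ B)
    (hI : ∀ i ∈ I, Metric.ball (c i) r ⊆
      {x : Pt 3 | |inner ℝ a x - b| ≤ h ∧ A ≤ ‖x‖ ^ 2 ∧ ‖x‖ ^ 2 ≤ B}) :
    I.card * (4 * r ^ 3) ≤ 6 * h * (B - A) := by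
  have hpi := Real.pi_pos
  have key : ENNReal.ofReal (I.card * (r ^ 3 * (Real.pi * 4 / 3))) ≤
      ENNReal.ofReal ((2 * h) * ((B - A) * Real.pi)) := by
    calc _ = volume (⋃ i ∈ I, Metric.ball (c i) r) := by
          rw [measure_biUnion_finset (fun i _ j _ hij => hc hij) fun _ _ => measurableSet_ball]
          simp only [EuclideanSpace.volume_ball_fin_three, Finset.sum_const, nsmul_eq_mul]
          rw [ENNReal.ofReal_mul (by positivity), ENNReal.ofReal_natCast,
            ENNReal.ofReal_mul (by positivity), ENNReal.ofReal_pow hr]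
      _ ≤ _ := measure_mono (Set.iUnion₂_subset hI)
      _ ≤ _ := volume_slab_inter_shell_le ha b hAB
      _ = _ := (ENNReal.ofReal_mul (by positivity)).symm
  rw [ENNReal.ofReal_le_ofReal_iff
    (mul_nonneg (by positivity) (mul_nonneg (by linarith) hpi.le))] at key
  refine le_of_mul_le_mul_right ?_ hpi
  nlinarith

theorem exists_measurable_partition_of_cover {X : Type*} [MeasurableSpace X] {n : ℕ}
    {T O : Fin n → Set X} (hT : ∀ i, MeasurableSet (T i)) (hOT : ∀ i, O i ⊆ T i)
    (hdisj : ∀ i j, i ≠ j → Disjoint (O i) (T j)) :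
    ∃ R : Fin n → Set X, (∀ i, MeasurableSet (R i)) ∧ Pairwise (Function.onFun Disjoint R) ∧
      (⋃ i, R i) = ⋃ i, T i ∧ ∀ i, O i ⊆ R i ∧ R i ⊆ T i := by
  refine ⟨disjointed T, fun i => disjointedRec (fun _ _ ht => ht.diff (hT _)) (hT i),
    disjoint_disjointed T, iUnion_disjointed, fun i => ⟨fun x hx => ?_, disjointed_subset T i⟩⟩
  rw [disjointed_eq_inter_compl]
  refine ⟨hOT i hx, Set.mem_iInter₂.2 fun j hj hxj => ?_⟩
  exact Set.disjoint_left.1 (hdisj i j hj.ne') hx hxj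

theorem exists_unit_normal {F : AffineSubspace ℝ (Pt 3)} (hF : IsKFlat 2 F) :
    ∃ a : Pt 3, ∃ b : ℝ, ‖a‖ = 1 ∧ ∀ x ∈ F, inner ℝ a x = b := by
  obtain ⟨⟨x₀, hx₀⟩, hd⟩ := hF
  have h := Submodule.finrank_add_finrank_orthogonal F.direction
  rw [hd, finrank_euclideanSpace_fin] at h
  have : Nontrivial F.directionᗮ := Module.nontrivial_of_finrank_pos (R := ℝ) (by omega)
  obtain ⟨⟨v, hv⟩, hv0⟩ := exists_ne (0 : F.directionᗮ)
  have hv0 : v ≠ 0 := fun h0 => hv0 (Subtype.ext h0)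
  refine ⟨‖v‖⁻¹ • v, inner ℝ (‖v‖⁻¹ • v) x₀, norm_smul_inv_norm hv0, fun x hx => ?_⟩
  have hperp : inner ℝ (x - x₀) v = 0 :=
    (Submodule.mem_orthogonal _ v).1 hv _ (AffineSubspace.vsub_mem_direction hx hx₀)
  rw [← sub_eq_zero, ← inner_sub_right, real_inner_smul_left, real_inner_comm, hperp, mul_zero]

section region

variable {k : Fin 3} {τ : Bool} {α β h : ℝ} {R : Set (Pt 3)}

theorem ofReal_sq_le_hausdorffMeasure_of_openCubeCone_subset (hα : -1 ≤ α) (hα' : α + h ≤ 1)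
    (hβ : -1 ≤ β) (hβ' : β + h ≤ 1) (hh : 0 ≤ h)
    (hO : openCubeCone k τ α β h ∩ Metric.sphere 0 1 ⊆ R)
    (hT : R ⊆ cubeCone k τ α β h ∩ Metric.sphere 0 1) :
    ENNReal.ofReal (h ^ 2 / 16) ≤ μH[2] R := by
  have hL : LipschitzOnWith 4 (gnomonic k) R := (lipschitzOnWith_gnomonic k).mono fun x hx =>
    ⟨mem_sphere_zero_iff_norm.1 (hT hx).2, abs_apply_le_of_mem_cubeCone hα hα' hβ hβ' (hT hx).1⟩
  have hbox : (Set.univ.pi fun i => Set.Ioo (![α, β] i) (![α, β] i + h)) ⊆ gnomonic k '' R := by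
    intro p hp
    refine ⟨sphereChart k τ p, hO ⟨sphereChart_mem_openCubeCone (hp 0 trivial) (hp 1 trivial),
      mem_sphere_zero_iff_norm.2 (norm_sphereChart k τ p)⟩, gnomonic_sphereChart k τ p⟩
  have hvol : ENNReal.ofReal (h ^ 2) ≤ 16 * μH[2] R := by
    calc _ = μH[2] (Set.univ.pi fun i => Set.Ioo (![α, β] i) (![α, β] i + h)) := by
          have e : (μH[2] : Measure (Fin 2 → ℝ)) = volume := by
            simpa using hausdorffMeasure_pi_real (ι := Fin 2)
          rw [e, Real.volume_pi_Ioo]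
          simp [← ENNReal.ofReal_pow hh]
      _ ≤ μH[2] (gnomonic k '' R) := measure_mono hbox
      _ ≤ _ := hL.hausdorffMeasure_image_le zero_le_two
      _ = _ := by norm_num
  rw [ENNReal.ofReal_div_of_pos (by norm_num)]
  refine ENNReal.div_le_of_le_mul' ?_
  simpa using hvol

theorem cubeCone_inter_sphere_subset_image :
    cubeCone k τ α β h ∩ Metric.sphere 0 1 ⊆
      sphereChart k τ '' (Set.univ.pi fun i => Set.Icc (![α, β] i) (![α, β] i + h)) := by
  rintro x ⟨hx, hx1⟩
  have hg := gnomonic_mem_of_mem_cubeCone hx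
  refine ⟨gnomonic k x, fun i _ => ?_, sphereChart_gnomonic (mem_sphere_zero_iff_norm.1 hx1) hx.1⟩
  fin_cases i
  exacts [hg.1, hg.2]

theorem hausdorffMeasure_le_of_subset_cubeCone (hh : 0 ≤ h)
    (hT : R ⊆ cubeCone k τ α β h ∩ Metric.sphere 0 1) :
    μH[2] R ≤ ENNReal.ofReal (16 * h ^ 2) := by
  calc _ ≤ μH[2] (sphereChart k τ '' (Set.univ.pi fun i => Set.Icc (![α, β] i) (![α, β] i + h))) :=
        measure_mono (hT.trans cubeCone_inter_sphere_subset_image)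
    _ ≤ _ := (lipschitzWith_sphereChart k τ).lipschitzOnWith.hausdorffMeasure_image_le zero_le_two
    _ = _ := by
        have e : (μH[2] : Measure (Fin 2 → ℝ)) = volume := by
          simpa using hausdorffMeasure_pi_real (ι := Fin 2)
        rw [e, Set.pi_univ_Icc, Real.volume_Icc_pi, ENNReal.ofReal_mul (by norm_num)]
        simp [← ENNReal.ofReal_pow hh]
        norm_num

/-- The centre of the spherical cell `cubeCone k τ α β h ∩ sphere 0 1`. -/
def cellCenter (k : Fin 3) (τ : Bool) (α β h : ℝ) : Pt 3 :=
  sphereChart k τ ![α + h / 2, β + h / 2]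

theorem cubeCone_inter_sphere_subset_closedBall (hh : 0 ≤ h) :
    cubeCone k τ α β h ∩ Metric.sphere 0 1 ⊆ Metric.closedBall (cellCenter k τ α β h) (2 * h) := by
  refine cubeCone_inter_sphere_subset_image.trans ?_
  rintro _ ⟨p, hp, rfl⟩
  have h0 : α ≤ p 0 ∧ p 0 ≤ α + h := hp 0 trivial
  have h1 : β ≤ p 1 ∧ p 1 ≤ β + h := hp 1 trivial
  have hd : dist p ![α + h / 2, β + h / 2] ≤ h / 2 := by
    rw [dist_pi_le_iff (by positivity)]
    intro i
    rw [Real.dist_eq, abs_le]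
    fin_cases i
    · exact ⟨by simp; linarith, by simp; linarith⟩
    · exact ⟨by simp; linarith, by simp; linarith⟩
  refine ((lipschitzWith_sphereChart k τ).dist_le_mul _ _).trans ?_
  have : ((4 : NNReal) : ℝ) = 4 := rfl
  rw [this]
  linarith

theorem ball_cellCenter_subset_openCubeCone (hα : -1 ≤ α) (hα' : α + h ≤ 1) (hβ : -1 ≤ β)
    (hβ' : β + h ≤ 1) (hh : 0 < h) :
    Metric.ball (cellCenter k τ α β h) (h / 12) ⊆ openCubeCone k τ α β h := by
  intro y hy
  rw [Metric.mem_ball, dist_eq_norm] at hy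
  set p : Fin 2 → ℝ := ![α + h / 2, β + h / 2] with hp
  have hc : cellCenter k τ α β h = sphereChart k τ p := rfl
  set n := ‖facePoint k τ p‖⁻¹ with hn
  have h1 := one_le_norm_facePoint k τ p
  have h2 : ‖facePoint k τ p‖ ≤ 2 := by
    have := norm_facePoint_sq k τ p
    have e0 : p 0 = α + h / 2 := rfl
    have e1 : p 1 = β + h / 2 := rfl
    rw [e0, e1] at this
    nlinarith
  have hn2 : 1 / 2 ≤ n := by
    rw [hn, one_div]
    exact inv_anti₀ (by linarith) h2
  have e (i : Fin 3) : boolSign τ * cellCenter k τ α β h i =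
      n * (boolSign τ * facePoint k τ p i) := by
    simp only [hc, sphereChart, PiLp.smul_apply, smul_eq_mul]; ring
  have hd (i : Fin 3) : |boolSign τ * y i - boolSign τ * cellCenter k τ α β h i| < h / 12 := by
    rw [← mul_sub, abs_boolSign_mul]
    exact (Pt.abs_apply_le_norm (y - cellCenter k τ α β h) i).trans_lt hy
  have d0 := hd k
  have d1 := hd (k + 1)
  have d2 := hd (k + 2)
  rw [e, boolSign_mul_facePoint, abs_lt] at d0
  rw [e, boolSign_mul_facePoint_add_one, abs_lt] at d1
  rw [e, boolSign_mul_facePoint_add_two, abs_lt] at d2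
  have e0 : p 0 = α + h / 2 := rfl
  have e1 : p 1 = β + h / 2 := rfl
  rw [e0] at d1
  rw [e1] at d2
  obtain ⟨t, ht⟩ : ∃ t, boolSign τ * y k = n * 1 + t := ⟨boolSign τ * y k - n * 1, by ring⟩
  have hnh : h / 4 ≤ n * (h / 2) := by nlinarith
  have bound {γ : ℝ} (hγ : -1 ≤ γ) (hγ' : γ ≤ 1) : |γ * t| ≤ h / 12 := by
    rw [abs_mul]
    have := abs_le.2 ⟨hγ, hγ'⟩
    have ht' : |t| ≤ h / 12 := abs_le.2 ⟨by linarith [d0.1], by linarith [d0.2]⟩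
    nlinarith [abs_nonneg t, abs_nonneg γ]
  have b1 := abs_le.1 (bound hα (by linarith))
  have b2 := abs_le.1 (bound (by linarith : -1 ≤ α + h) hα')
  have b3 := abs_le.1 (bound hβ (by linarith))
  have b4 := abs_le.1 (bound (by linarith : -1 ≤ β + h) hβ')
  refine ⟨by linarith [d0.1], ?_, ?_, ?_, ?_⟩ <;> rw [ht]
  · linarith [d1.1]
  · linarith [d1.2]
  · linarith [d2.1]
  · linarith [d2.2]

end region

/-- Indices for the cells: a coordinate direction, a sign, and a square of the grid. -/
abbrev CellIndex (s : ℕ) : Type := (Fin 3 × Bool) × (Fin s × Fin s)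

/-- Left endpoint of the `i`-th of the `s` intervals of equal length subdividing `[-1, 1]`. -/
def gridPoint (s : ℕ) (i : Fin s) : ℝ := -1 + i * (2 / s)

theorem neg_one_le_gridPoint {s : ℕ} (i : Fin s) : -1 ≤ gridPoint s i := by
  have : 0 ≤ (i : ℝ) * (2 / s) := by positivity
  unfold gridPoint; linarith

theorem gridPoint_add_le_one {s : ℕ} (i : Fin s) : gridPoint s i + 2 / s ≤ 1 := by
  have hs : (0 : ℝ) < s := by exact_mod_cast i.pos
  have h : (i : ℝ) + 1 ≤ s := by exact_mod_cast i.isLt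
  have : ((i : ℝ) + 1) * (2 / s) ≤ s * (2 / s) := by gcongr
  rw [mul_div_cancel₀ _ hs.ne'] at this
  unfold gridPoint; linarith

theorem exists_gridPoint_le {s : ℕ} (hs : 1 ≤ s) {u : ℝ} (hu : -1 ≤ u) (hu' : u ≤ 1) :
    ∃ i : Fin s, gridPoint s i ≤ u ∧ u ≤ gridPoint s i + 2 / s := by
  have hs0 : (0 : ℝ) < s := by exact_mod_cast hs
  set w := (u + 1) * (s / 2) with hw
  have hw0 : 0 ≤ w := mul_nonneg (by linarith) (by positivity)
  have huw : u = -1 + w * (2 / s) := by rw [hw]; field_simp; ring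
  have hws : w ≤ s := by rw [hw]; nlinarith
  have step {i : ℕ} (h1 : (i : ℝ) ≤ w) (h2 : w ≤ i + 1) :
      -1 + i * (2 / s : ℝ) ≤ u ∧ u ≤ -1 + i * (2 / s : ℝ) + 2 / s := by
    have h3 : (i : ℝ) * (2 / s) ≤ w * (2 / s) := by gcongr
    have h4 : w * (2 / s) ≤ (i + 1) * (2 / s) := by gcongr
    constructor <;> linarith
  rcases hws.lt_or_eq with h | h
  · exact ⟨⟨⌊w⌋₊, (Nat.floor_lt hw0).2 h⟩, step (Nat.floor_le hw0) (Nat.lt_floor_add_one w).le⟩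
  · refine ⟨⟨s - 1, by omega⟩, step (i := s - 1) ?_ ?_⟩ <;> rw [Nat.cast_pred (by omega)] <;>
      linarith

theorem le_of_gridPoint_lt {s : ℕ} {i j : Fin s} {u v : ℝ} (hv : 0 < v)
    (h1 : gridPoint s i * v < u) (h2 : u ≤ (gridPoint s j + 2 / s) * v) : i ≤ j := by
  have hs : (0 : ℝ) < s := by exact_mod_cast i.pos
  have h := lt_of_mul_lt_mul_right (h1.trans_le h2) hv.le
  have h3 : (i : ℝ) * (2 / s) < ((j : ℝ) + 1) * (2 / s) := by
    unfold gridPoint at h; linarith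
  have h4 : (i : ℝ) < (j : ℝ) + 1 := lt_of_mul_lt_mul_right h3 (by positivity)
  have h5 : (i : ℕ) < j + 1 := by exact_mod_cast h4
  exact Fin.le_def.2 (by omega)

theorem ge_of_lt_gridPoint {s : ℕ} {i j : Fin s} {u v : ℝ} (hv : 0 < v)
    (h1 : u < (gridPoint s i + 2 / s) * v) (h2 : gridPoint s j * v ≤ u) : j ≤ i := by
  have hs : (0 : ℝ) < s := by exact_mod_cast i.pos
  have h := lt_of_mul_lt_mul_right (h2.trans_lt h1) hv.le
  have h3 : (j : ℝ) * (2 / s) < ((i : ℝ) + 1) * (2 / s) := by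
    unfold gridPoint at h; linarith
  have h4 : (j : ℝ) < (i : ℝ) + 1 := lt_of_mul_lt_mul_right h3 (by positivity)
  have h5 : (j : ℕ) < i + 1 := by exact_mod_cast h4
  exact Fin.le_def.2 (by omega)

/-- The closed cone of the cell with the given index. -/
def gridCone {s : ℕ} (c : CellIndex s) : Set (Pt 3) :=
  cubeCone c.1.1 c.1.2 (gridPoint s c.2.1) (gridPoint s c.2.2) (2 / s)

/-- The open cone of the cell with the given index. -/
def openGridCone {s : ℕ} (c : CellIndex s) : Set (Pt 3) :=
  openCubeCone c.1.1 c.1.2 (gridPoint s c.2.1) (gridPoint s c.2.2) (2 / s)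

theorem disjoint_openGridCone_gridCone {s : ℕ} {c d : CellIndex s} (hcd : c ≠ d) :
    Disjoint (openGridCone c) (gridCone d) := by
  rw [Set.disjoint_left]
  intro x hx hy
  refine hcd ?_
  obtain ⟨⟨k, τ⟩, i, j⟩ := c
  obtain ⟨⟨k', τ'⟩, i', j'⟩ := d
  have hk : k = k' := by
    by_contra hne
    have h1 := abs_apply_lt_of_mem_openCubeCone (neg_one_le_gridPoint i) (gridPoint_add_le_one i)
      (neg_one_le_gridPoint j) (gridPoint_add_le_one j) hx (m := k') (Ne.symm hne)
    have h2 := abs_apply_le_of_mem_cubeCone (neg_one_le_gridPoint i') (gridPoint_add_le_one i')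
      (neg_one_le_gridPoint j') (gridPoint_add_le_one j') hy k
    exact absurd h1 h2.not_gt
  subst hk
  obtain ⟨h0, h1, h2, h3, h4⟩ := hx
  obtain ⟨g0, g1, g2, g3, g4⟩ := hy
  have hτ : τ = τ' := by
    cases τ <;> cases τ' <;> simp only [boolSign, cond_true, cond_false] at h0 g0 <;>
      first | rfl | linarith
  subst hτ
  have hi : i = i' := le_antisymm (le_of_gridPoint_lt h0 h1 g2) (ge_of_lt_gridPoint h0 h2 g1)
  have hj : j = j' := le_antisymm (le_of_gridPoint_lt h0 h3 g4) (ge_of_lt_gridPoint h0 h4 g3)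
  rw [hi, hj]

theorem exists_mem_gridCone {s : ℕ} (hs : 1 ≤ s) {x : Pt 3} (hx : x ≠ 0) :
    ∃ c : CellIndex s, x ∈ gridCone c := by
  obtain ⟨k, hk⟩ := Finite.exists_max fun m => |x m|
  have hk0 : x k ≠ 0 := fun h0 => hx <| by
    ext m
    simpa [h0] using hk m
  obtain ⟨τ, hτ⟩ : ∃ τ, 0 < boolSign τ * x k := by
    rcases hk0.lt_or_gt with h | h
    · exact ⟨false, by simpa [boolSign] using h⟩
    · exact ⟨true, by simpa [boolSign] using h⟩
  have key (m : Fin 3) : ∃ i : Fin s, gridPoint s i * (boolSign τ * x k) ≤ boolSign τ * x m ∧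
      boolSign τ * x m ≤ (gridPoint s i + 2 / s) * (boolSign τ * x k) := by
    have hm := hk m
    simp only at hm
    rw [← abs_boolSign_mul τ (x m), ← abs_boolSign_mul τ (x k), abs_of_pos hτ, abs_le] at hm
    obtain ⟨i, hi, hi'⟩ := exists_gridPoint_le hs (u := boolSign τ * x m / (boolSign τ * x k))
      (by rw [le_div_iff₀ hτ]; linarith [hm.1]) (by rw [div_le_iff₀ hτ]; linarith [hm.2])
    exact ⟨i, (le_div_iff₀ hτ).1 hi, (div_le_iff₀ hτ).1 hi'⟩
  obtain ⟨i, hi⟩ := key (k + 1)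
  obtain ⟨j, hj⟩ := key (k + 2)
  exact ⟨((k, τ), i, j), hτ, hi.1, hi.2, hj.1, hj.2⟩

/-- The centre on the sphere of the cell with the given index. -/
def gridCenter {s : ℕ} (c : CellIndex s) : Pt 3 :=
  cellCenter c.1.1 c.1.2 (gridPoint s c.2.1) (gridPoint s c.2.2) (2 / s)

theorem norm_gridCenter {s : ℕ} (c : CellIndex s) : ‖gridCenter c‖ = 1 := norm_sphereChart _ _ _

theorem gridCone_inter_sphere_subset_closedBall {s : ℕ} (c : CellIndex s) :
    gridCone c ∩ Metric.sphere 0 1 ⊆ Metric.closedBall (gridCenter c) (4 / s) := by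
  have e : 4 / (s : ℝ) = 2 * (2 / s) := by ring
  rw [e]
  exact cubeCone_inter_sphere_subset_closedBall (by positivity)

theorem ball_gridCenter_subset_openGridCone {s : ℕ} (c : CellIndex s) :
    Metric.ball (gridCenter c) (1 / (6 * s)) ⊆ openGridCone c := by
  have hs : (0 : ℝ) < s := by exact_mod_cast c.2.1.pos
  have e : 1 / (6 * (s : ℝ)) = 2 / s / 12 := by field_simp; norm_num
  rw [e]
  exact ball_cellCenter_subset_openCubeCone (neg_one_le_gridPoint c.2.1)
    (gridPoint_add_le_one c.2.1) (neg_one_le_gridPoint c.2.2) (gridPoint_add_le_one c.2.2)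
    (by positivity)

theorem card_le_of_gridCone_inter_plane_nonempty {s : ℕ} (hs : 1 ≤ s) {a : Pt 3} (ha : ‖a‖ = 1)
    {b : ℝ} (I : Finset (CellIndex s))
    (hI : ∀ c ∈ I, ∃ x ∈ gridCone c ∩ Metric.sphere 0 1, inner ℝ a x = b) :
    (I.card : ℝ) ≤ 1080 * s := by
  have hs0 : (0 : ℝ) < s := by exact_mod_cast hs
  have hs1 : (1 : ℝ) ≤ s := by exact_mod_cast hs
  have hr : 1 / (6 * (s : ℝ)) ≤ 1 := by
    rw [div_le_one (by positivity)]; linarith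
  have hr0 : 0 < 1 / (6 * (s : ℝ)) := by positivity
  have key := card_mul_le_of_balls_subset_slab I (c := gridCenter) (r := 1 / (6 * s))
    (h := 5 / s) (A := (1 - 1 / (6 * s)) ^ 2) (B := (1 + 1 / (6 * s)) ^ 2) hr0.le
    (fun c d hcd => (disjoint_openGridCone_gridCone hcd).mono
      (ball_gridCenter_subset_openGridCone c)
      ((ball_gridCenter_subset_openGridCone d).trans (openCubeCone_subset_cubeCone _ _ _ _ _)))
    ha b (by positivity) (by nlinarith) ?_
  · have e : (I.card : ℝ) * (4 * (1 / (6 * s)) ^ 3) = I.card * (1 / (54 * s ^ 3)) := by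
      field_simp; ring
    have e' : 6 * (5 / s) * ((1 + 1 / (6 * s)) ^ 2 - (1 - 1 / (6 * s)) ^ 2) =
        1080 * s * (1 / (54 * (s : ℝ) ^ 3)) := by
      field_simp; ring
    rw [e, e'] at key
    exact le_of_mul_le_mul_right key (by positivity)
  · intro c hc y hy
    obtain ⟨x, hx, hxb⟩ := hI c hc
    have hxc := gridCone_inter_sphere_subset_closedBall c hx
    have hn := norm_gridCenter c
    rw [Metric.mem_closedBall] at hxc
    rw [Metric.mem_ball] at hy
    have hyx : ‖y - x‖ ≤ 5 / s := by
      rw [← dist_eq_norm]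
      have h1 := dist_triangle_right y x (gridCenter c)
      have h2 : 1 / (6 * (s : ℝ)) ≤ 1 / s := by gcongr; linarith
      have h3 : 5 / (s : ℝ) = 4 / s + 1 / s := by ring
      linarith
    have hnorm : |‖y‖ - 1| ≤ 1 / (6 * s) := by
      have h := abs_norm_sub_norm_le y (gridCenter c)
      rw [hn, ← dist_eq_norm] at h
      exact h.trans hy.le
    rw [abs_le] at hnorm
    refine ⟨?_, ?_, ?_⟩
    · rw [← hxb, ← inner_sub_right]
      calc _ ≤ ‖a‖ * ‖y - x‖ := abs_real_inner_le_norm _ _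
        _ ≤ _ := by rw [ha, one_mul]; exact hyx
    · exact pow_le_pow_left₀ (by linarith) (by linarith [hnorm.1]) 2
    · exact pow_le_pow_left₀ (norm_nonneg y) (by linarith [hnorm.2]) 2

theorem card_cellIndex (s : ℕ) : Fintype.card (CellIndex s) = 6 * s ^ 2 := by
  simp; ring

/-- For every `s ≥ 1`, the unit sphere `S² ⊂ ℝ³` can be partitioned into
`6s²` measurable regions, each of surface area `Θ(1/s²)`, each contained in a ball of
radius `O(1/s)`, and such that every plane meets at most `O(s)` regions. -/
theorem sphere_partition_into_regions :
    ∃ c₁ c₂ c₃ c₄ : ℝ, 0 < c₁ ∧ 0 < c₂ ∧ 0 < c₃ ∧ 0 < c₄ ∧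
      ∀ s : ℕ, 1 ≤ s →
        ∃ R : Fin (6 * s ^ 2) → Set (Pt 3),
          (∀ i, MeasurableSet (R i)) ∧
          Pairwise (Function.onFun Disjoint R) ∧
          (⋃ i, R i) = Metric.sphere (0 : Pt 3) 1 ∧
          (∀ i, ENNReal.ofReal (c₁ / (s : ℝ) ^ 2) ≤ μH[2] (R i) ∧
                μH[2] (R i) ≤ ENNReal.ofReal (c₂ / (s : ℝ) ^ 2)) ∧
          (∀ i, ∃ x : Pt 3, R i ⊆ Metric.closedBall x (c₃ / (s : ℝ))) ∧
          (∀ F : AffineSubspace ℝ (Pt 3), IsKFlat 2 F →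
            ({i : Fin (6 * s ^ 2) | (R i ∩ (F : Set (Pt 3))).Nonempty}.ncard : ℝ) ≤
              c₄ * (s : ℝ)) := by
  refine ⟨1 / 4, 64, 4, 1080, by norm_num, by norm_num, by norm_num, by norm_num, fun s hs => ?_⟩
  have hs0 : (0 : ℝ) < s := by exact_mod_cast hs
  let e : Fin (6 * s ^ 2) ≃ CellIndex s := (Fintype.equivFinOfCardEq (card_cellIndex s)).symm
  obtain ⟨R, hRm, hRd, hRu, hR⟩ := exists_measurable_partition_of_cover
    (T := fun i => gridCone (e i) ∩ Metric.sphere 0 1)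
    (O := fun i => openGridCone (e i) ∩ Metric.sphere 0 1)
    (fun i => (measurableSet_cubeCone _ _ _ _ _).inter Metric.isClosed_sphere.measurableSet)
    (fun i => Set.inter_subset_inter_left _ (openCubeCone_subset_cubeCone _ _ _ _ _))
    (fun i j hij => (disjoint_openGridCone_gridCone (e.injective.ne hij)).mono
      Set.inter_subset_left Set.inter_subset_left)
  refine ⟨R, hRm, hRd, ?_, fun i => ⟨?_, ?_⟩, fun i =>
    ⟨gridCenter (e i), (hR i).2.trans (gridCone_inter_sphere_subset_closedBall _)⟩, fun F hF => ?_⟩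
  · rw [hRu]
    refine Set.Subset.antisymm (Set.iUnion_subset fun i => Set.inter_subset_right) fun x hx => ?_
    obtain ⟨c, hc⟩ := exists_mem_gridCone hs (ne_zero_of_mem_unit_sphere ⟨x, hx⟩)
    exact Set.mem_iUnion.2 ⟨e.symm c, by simpa using hc, hx⟩
  · convert ofReal_sq_le_hausdorffMeasure_of_openCubeCone_subset (neg_one_le_gridPoint _)
      (gridPoint_add_le_one _) (neg_one_le_gridPoint _) (gridPoint_add_le_one _) (by positivity)
      (hR i).1 (hR i).2 using 2
    ring
  · convert hausdorffMeasure_le_of_subset_cubeCone (by positivity) (hR i).2 using 2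
    ring
  · obtain ⟨a, b, ha, hab⟩ := exists_unit_normal hF
    rw [Set.ncard_eq_toFinset_card', ← Finset.card_map e.toEmbedding]
    refine card_le_of_gridCone_inter_plane_nonempty hs ha (b := b) _ fun c hc => ?_
    simp only [Finset.mem_map, Set.mem_toFinset, Set.mem_ofPred_eq] at hc
    obtain ⟨i, ⟨x, hxR, hxF⟩, rfl⟩ := hc
    exact ⟨x, (hR i).2 hxR, hab x hxF⟩
end
end

section
/- For every constant b > 0 there exist constants c > 0 and n₀ ∈ ℕ (depending only on b) such that the following holds: for every b-homogeneous set P of n ≥ n₀ points in ℝ³ there exists a subset P₀ ⊆ P with |P₀| ≥ c·n such that every point p ∈ P₀ lies on at least c·n distinct lines, each of which contains p and at least one other point of P. -/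
open scoped Classical

noncomputable section

/-- Cauchy–Schwarz for the fibres of a map on a finite set. -/
lemma card_sq_le_card_image_mul_card_filter {α β : Type*} [DecidableEq β] (s : Finset α)
    (f : α → β) :
    s.card ^ 2 ≤ (s.image f).card * ((s ×ˢ s).filter fun x => f x.1 = f x.2).card := by
  have h1 : s.card = ∑ y ∈ s.image f, (s.filter fun x => f x = y).card :=
    Finset.card_eq_sum_card_image f s
  have h2 : ((s ×ˢ s).filter fun x => f x.1 = f x.2).card =
      ∑ y ∈ s.image f, (s.filter fun x => f x = y).card ^ 2 := by
    rw [Finset.card_eq_sum_card_fiberwise (f := fun x => f x.1) (t := s.image f)]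
    · refine Finset.sum_congr rfl fun y _ => ?_
      rw [sq, ← Finset.card_product]
      congr 1
      ext x
      simp only [Finset.mem_filter, Finset.mem_product]
      constructor
      · rintro ⟨⟨⟨h, h'⟩, e⟩, rfl⟩
        exact ⟨⟨h, rfl⟩, h', e.symm⟩
      · rintro ⟨⟨h, rfl⟩, h', e⟩
        exact ⟨⟨⟨h, h'⟩, e.symm⟩, rfl⟩
    · intro x hx
      have hx' := Finset.mem_filter.1 (Finset.mem_coe.1 hx)
      exact Finset.mem_coe.2 (Finset.mem_image_of_mem f (Finset.mem_product.1 hx'.1).1)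
  rw [h2]
  conv_lhs => rw [h1]
  exact sq_sum_le_card_mul_sum_sq

/-- Any two points of `S` differ most in the coordinate `i`. -/
def DominatedBy {d : ℕ} (S : Finset (Pt d)) (i : Fin d) : Prop :=
  ∀ x ∈ S, ∀ y ∈ S, ∀ j, |x j - y j| ≤ |x i - y i|

/-- The pairs of distinct points of `S` at sup-distance at most `ρ`. -/
def closePairs {d : ℕ} (S : Finset (Pt d)) (ρ : ℝ) : Finset (Pt d × Pt d) :=
  S.offDiag.filter fun x => ∀ j, |x.1 j - x.2 j| ≤ ρ

lemma exists_dominatedBy_of_subset_line {d : ℕ} [NeZero d] (S : Finset (Pt d)) (p q : Pt d)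
    (hS : ∀ x ∈ S, x ∈ affineSpan ℝ ({p, q} : Set (Pt d))) : ∃ i, DominatedBy S i := by
  obtain ⟨i, -, hi⟩ := Finset.exists_max_image Finset.univ (fun i => |q i - p i|)
    Finset.univ_nonempty
  refine ⟨i, fun x hx y hy j => ?_⟩
  obtain ⟨s, rfl⟩ := mem_affineSpan_pair_iff_exists_lineMap_eq.1 (hS x hx)
  obtain ⟨t, rfl⟩ := mem_affineSpan_pair_iff_exists_lineMap_eq.1 (hS y hy)
  have key : ∀ j, AffineMap.lineMap p q s j - AffineMap.lineMap p q t j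
      = (s - t) * (q j - p j) := by
    intro j
    simp only [AffineMap.lineMap_apply, vsub_eq_sub, vadd_eq_add, PiLp.add_apply,
      PiLp.smul_apply, PiLp.sub_apply, smul_eq_mul]
    ring
  rw [key, key, abs_mul, abs_mul]
  exact mul_le_mul_of_nonneg_left (hi j (Finset.mem_univ j)) (abs_nonneg _)

lemma card_sq_le_mul_card_close {d : ℕ} {S : Finset (Pt d)} {a : Fin d → ℝ} {D : ℝ}
    (hD : 0 < D) (hS : (S : Set (Pt d)) ⊆ openCube a D) {i : Fin d} (hi : DominatedBy S i)
    {m : ℕ} (hm : 0 < m) :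
    S.card ^ 2 ≤ m * ((S ×ˢ S).filter fun x => ∀ j, |x.1 j - x.2 j| ≤ D / m).card := by
  have hm' : (0 : ℝ) < m := by exact_mod_cast hm
  have hr : 0 < D / m := by positivity
  refine (card_sq_le_card_image_mul_card_filter S
    (fun x => ⌊(x i - a i) / (D / m)⌋₊)).trans (Nat.mul_le_mul ?_ (Finset.card_le_card ?_))
  · refine (Finset.card_le_card (t := Finset.range m) fun y hy => ?_).trans_eq
      (Finset.card_range m)
    obtain ⟨x, hx, rfl⟩ := Finset.mem_image.1 hy
    have := hS hx i
    rw [Finset.mem_range, Nat.floor_lt (div_nonneg (by linarith) hr.le), div_lt_iff₀ hr,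
      mul_div_cancel₀ _ hm'.ne']
    linarith
  · intro x hx
    simp only [Finset.mem_filter, Finset.mem_product] at hx ⊢
    obtain ⟨⟨h1, h2⟩, h⟩ := hx
    refine ⟨⟨h1, h2⟩, fun j => (hi _ h1 _ h2 j).trans ?_⟩
    have p1 := hS h1 i
    have p2 := hS h2 i
    have a1 := Nat.floor_le (div_nonneg (by linarith : 0 ≤ x.1 i - a i) hr.le)
    have a2 := Nat.floor_le (div_nonneg (by linarith : 0 ≤ x.2 i - a i) hr.le)
    have b1 := Nat.lt_floor_add_one ((x.1 i - a i) / (D / m))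
    have b2 := Nat.lt_floor_add_one ((x.2 i - a i) / (D / m))
    rw [← h, le_div_iff₀ hr] at a2
    rw [← h, div_lt_iff₀ hr] at b2
    rw [le_div_iff₀ hr] at a1
    rw [div_lt_iff₀ hr] at b1
    rw [abs_le]
    constructor <;> nlinarith

lemma card_close_le {d : ℕ} {b : ℝ} {P : Finset (Pt d)} (hP : WellSeparated b P) (hb : 0 ≤ b)
    (p : Pt d) {ρ : ℝ} (hρ : 0 ≤ ρ) :
    ((P.filter fun q => ∀ j, |p j - q j| ≤ ρ).card : ℝ) ≤ b * (2 * ρ + 1) ^ d := by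
  have h := Finset.card_le_mul_card_image_of_maps_to
    (s := P.filter fun q => ∀ j, |p j - q j| ≤ ρ)
    (f := fun q j => ⌊q j - p j + ρ⌋₊)
    (t := Fintype.piFinset fun _ : Fin d => Finset.range (⌊2 * ρ⌋₊ + 1)) ?_ ⌊b⌋₊ ?_
  · have h' : ((P.filter fun q => ∀ j, |p j - q j| ≤ ρ).card : ℝ)
        ≤ (⌊b⌋₊ : ℝ) * ((⌊2 * ρ⌋₊ : ℝ) + 1) ^ d := by
      have h3 := h
      simp only [Fintype.card_piFinset, Finset.card_range, Finset.prod_const, Finset.card_univ,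
        Fintype.card_fin] at h3
      exact_mod_cast h3
    have h1 := Nat.floor_le hb
    have h2 := Nat.floor_le (by linarith : 0 ≤ 2 * ρ)
    refine h'.trans ?_
    gcongr
  · intro q hq
    simp only [Fintype.mem_piFinset, Finset.mem_range, Nat.lt_add_one_iff]
    intro j
    have := abs_le.1 ((Finset.mem_filter.1 hq).2 j)
    exact Nat.floor_le_floor (by linarith)
  · intro g _
    refine Nat.le_floor (le_trans ?_ (hP fun j => p j - ρ + g j))
    rw [← Set.ncard_coe_finset]
    refine Nat.cast_le.2 (Set.ncard_le_ncard (fun q hq => ?_)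
      (P.finite_toSet.subset Set.inter_subset_left))
    simp only [Finset.coe_filter, Finset.mem_filter, Set.mem_ofPred_eq] at hq
    obtain ⟨⟨hqP, hq⟩, rfl⟩ := hq
    refine ⟨hqP, fun j => ?_⟩
    have h0 := abs_le.1 (hq j)
    have h1 := Nat.floor_le (by linarith : 0 ≤ q j - p j + ρ)
    have h2 := Nat.lt_floor_add_one (q j - p j + ρ)
    constructor <;> linarith

lemma card_filter_product_eq_sum {α β : Type*} (S : Finset α) (T : Finset β) (r : α → β → Prop)
    [∀ x y, Decidable (r x y)] :
    ((S ×ˢ T).filter fun x => r x.1 x.2).card = ∑ p ∈ S, (T.filter fun q => r p q).card := by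
  simp only [Finset.card_filter, Finset.sum_product]

lemma card_le_of_dominatedBy {d : ℕ} {b : ℝ} {P S : Finset (Pt d)} (hP : WellSeparated b P)
    (hb : 0 ≤ b) (hSP : S ⊆ P) {a : Fin d → ℝ} {D : ℝ} (hD : 1 ≤ D)
    (hS : (S : Set (Pt d)) ⊆ openCube a D) {i : Fin d} (hi : DominatedBy S i) :
    (S.card : ℝ) ≤ 2 * (b * 3 ^ d) * D := by
  have hm : 0 < ⌈D⌉₊ := Nat.ceil_pos.2 (by linarith)
  have hm' : (0 : ℝ) < ⌈D⌉₊ := by exact_mod_cast hm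
  have h1 : ((S.card : ℝ)) ^ 2 ≤
      ⌈D⌉₊ * (((S ×ˢ S).filter fun x => ∀ j, |x.1 j - x.2 j| ≤ D / ⌈D⌉₊).card : ℝ) := by
    exact_mod_cast card_sq_le_mul_card_close (by linarith) hS hi hm
  rw [card_filter_product_eq_sum S S fun x y => ∀ j, |x j - y j| ≤ D / ⌈D⌉₊] at h1
  have h2 : ((∑ p ∈ S, (S.filter fun q => ∀ j, |p j - q j| ≤ D / ⌈D⌉₊).card : ℕ) : ℝ)
      ≤ S.card * (b * 3 ^ d) := by
    push_cast
    rw [← nsmul_eq_mul]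
    refine Finset.sum_le_card_nsmul _ _ _ fun p _ => ?_
    refine le_trans (Nat.cast_le.2 (Finset.card_le_card ?_))
      ((card_close_le hP hb p zero_le_one).trans_eq (by norm_num))
    intro q hq
    rw [Finset.mem_filter] at hq ⊢
    exact ⟨hSP hq.1, fun j => (hq.2 j).trans ((div_le_one hm').2 (Nat.le_ceil D))⟩
  have h3 : (⌈D⌉₊ : ℝ) ≤ 2 * D := by
    have := Nat.ceil_lt_add_one (by linarith : 0 ≤ D)
    linarith
  have hc : (0 : ℝ) ≤ b * 3 ^ d := by positivity
  rcases (Nat.cast_nonneg (α := ℝ) S.card).eq_or_lt with h0 | h0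
  · rw [← h0]; positivity
  · refine le_of_mul_le_mul_left ?_ h0
    calc (S.card : ℝ) * S.card = (S.card : ℝ) ^ 2 := (sq _).symm
      _ ≤ ⌈D⌉₊ * (S.card * (b * 3 ^ d)) := h1.trans (by gcongr)
      _ ≤ 2 * D * (S.card * (b * 3 ^ d)) := by gcongr
      _ = _ := by ring

lemma card_cube_le_sum_closePairs {d : ℕ} {S : Finset (Pt d)} {a : Fin d → ℝ} {D : ℝ}
    (hD : 0 < D) (hS : (S : Set (Pt d)) ⊆ openCube a D) {i : Fin d} (hi : DominatedBy S i)
    (hk : 2 ≤ S.card) {M : ℕ} (hM : S.card / 2 ≤ M) :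
    S.card ^ 3 ≤ 6 * ∑ m ∈ Finset.Ioo 0 (M + 1), m * (closePairs S (D / m)).card := by
  have h1 : ∀ m ∈ Finset.Ioo 0 (S.card / 2 + 1),
      S.card ^ 2 ≤ 2 * (m * (closePairs S (D / m)).card) := by
    intro m hm
    rw [Finset.mem_Ioo] at hm
    have h := card_sq_le_mul_card_close hD hS hi hm.1
    have h' : ((S ×ˢ S).filter fun x => ∀ j, |x.1 j - x.2 j| ≤ D / m).card
        ≤ S.card + (closePairs S (D / m)).card := by
      rw [← Finset.diag_card S]
      refine (Finset.card_le_card fun x hx => ?_).trans (Finset.card_union_le _ _)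
      simp only [Finset.mem_filter, Finset.mem_product, Finset.mem_union, Finset.mem_diag,
        closePairs, Finset.mem_offDiag] at hx ⊢
      by_cases e : x.1 = x.2
      · exact Or.inl ⟨hx.1.1, e⟩
      · exact Or.inr ⟨⟨hx.1.1, hx.1.2, e⟩, hx.2⟩
    have h2 : 2 * m ≤ S.card := by omega
    nlinarith [Nat.mul_le_mul_left m h', Nat.mul_le_mul_right S.card h2]
  have h2 := Finset.card_nsmul_le_sum _ _ _ h1
  rw [Nat.card_Ioo, ← Finset.mul_sum, smul_eq_mul] at h2
  have h3 : ∑ m ∈ Finset.Ioo 0 (S.card / 2 + 1), m * (closePairs S (D / m)).card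
      ≤ ∑ m ∈ Finset.Ioo 0 (M + 1), m * (closePairs S (D / m)).card :=
    Finset.sum_le_sum_of_subset (Finset.Ioo_subset_Ioo_right (by omega))
  have h4 : S.card ≤ 3 * (S.card / 2 + 1 - 0 - 1) := by omega
  have h5 := Nat.mul_le_mul_right (S.card ^ 2) h4
  calc S.card ^ 3 = S.card * S.card ^ 2 := by ring
    _ ≤ _ := h5
    _ ≤ _ := by linarith

/-- The line spanned by a pair of points. -/
def lineOf {d : ℕ} (x : Pt d × Pt d) : AffineSubspace ℝ (Pt d) :=
  affineSpan ℝ ({x.1, x.2} : Set (Pt d))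

lemma lineOf_eq_of_mem {d : ℕ} {x y p q : Pt d} (hx : x ∈ lineOf (p, q))
    (hy : y ∈ lineOf (p, q)) (h : x ≠ y) : lineOf (x, y) = lineOf (p, q) :=
  affineSpan_pair_eq_of_mem_of_mem_of_ne hx hy h

/-- The ordered collinear triples of points of `P` with apex distinct from the other two. -/
def collinearTriples {d : ℕ} (P : Finset (Pt d)) : Finset (Pt d × Pt d × Pt d) :=
  (P ×ˢ P ×ˢ P).filter fun t =>
    t.2.1 ≠ t.1 ∧ t.2.2 ≠ t.1 ∧ lineOf (t.1, t.2.1) = lineOf (t.1, t.2.2)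

lemma card_collinearTriples_le_sum {d : ℕ} [NeZero d] {b : ℝ} {P : Finset (Pt d)}
    (hP : WellSeparated b P) (hb : 0 ≤ b) {a : Fin d → ℝ} {D : ℝ} (hD : 1 ≤ D)
    (hPa : (P : Set (Pt d)) ⊆ openCube a D) :
    (collinearTriples P).card ≤
      6 * ∑ m ∈ Finset.Ioo 0 (⌊b * 3 ^ d * D⌋₊ + 1), m * (closePairs P (D / m)).card := by
  set M := ⌊b * 3 ^ d * D⌋₊
  set Ls := P.offDiag.image lineOf
  have h1 : (collinearTriples P).card ≤ ∑ L ∈ Ls, (P.filter fun x => x ∈ L).card ^ 3 := by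
    rw [Finset.card_eq_sum_card_fiberwise (f := fun t => lineOf (t.1, t.2.1)) (t := Ls)]
    · refine Finset.sum_le_sum fun L _ => ?_
      rw [show (P.filter fun x => x ∈ L).card ^ 3 = ((P.filter fun x => x ∈ L) ×ˢ
        (P.filter fun x => x ∈ L) ×ˢ (P.filter fun x => x ∈ L)).card by
          rw [Finset.card_product, Finset.card_product]; ring]
      refine Finset.card_le_card fun t ht => ?_
      simp only [collinearTriples, Finset.mem_filter, Finset.mem_product] at ht ⊢
      obtain ⟨⟨⟨h1, h2, h3⟩, -, -, e⟩, rfl⟩ := ht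
      refine ⟨⟨h1, left_mem_affineSpan_pair ℝ _ _⟩, ⟨h2, right_mem_affineSpan_pair ℝ _ _⟩,
        h3, ?_⟩
      rw [e]
      exact right_mem_affineSpan_pair ℝ _ _
    · intro t ht
      simp only [collinearTriples, Finset.coe_filter, Set.mem_ofPred_eq,
        Finset.mem_product] at ht
      exact Finset.mem_coe.2 (Finset.mem_image_of_mem lineOf
        (Finset.mem_offDiag.2 ⟨ht.1.1, ht.1.2.1, ht.2.1.symm⟩))
  have h2 : ∀ L ∈ Ls, (P.filter fun x => x ∈ L).card ^ 3 ≤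
      6 * ∑ m ∈ Finset.Ioo 0 (M + 1),
        m * ((closePairs P (D / m)).filter fun x => lineOf x = L).card := by
    intro L hL
    obtain ⟨⟨p, q⟩, hpq, rfl⟩ := Finset.mem_image.1 hL
    rw [Finset.mem_offDiag] at hpq
    set S := P.filter fun x => x ∈ lineOf (p, q) with hSdef
    have hSP : S ⊆ P := Finset.filter_subset _ _
    have hSa : (S : Set (Pt d)) ⊆ openCube a D := fun x hx => hPa (hSP hx)
    obtain ⟨i, hi⟩ := exists_dominatedBy_of_subset_line S p q
      fun x hx => (Finset.mem_filter.1 hx).2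
    have hk : 2 ≤ S.card := by
      refine Finset.one_lt_card.2 ⟨p, ?_, q, ?_, hpq.2.2⟩
      · exact Finset.mem_filter.2 ⟨hpq.1, left_mem_affineSpan_pair ℝ _ _⟩
      · exact Finset.mem_filter.2 ⟨hpq.2.1, right_mem_affineSpan_pair ℝ _ _⟩
    have hM : S.card / 2 ≤ M := by
      refine Nat.le_floor ?_
      have := card_le_of_dominatedBy hP hb hSP hD hSa hi
      have h' : ((S.card / 2 : ℕ) : ℝ) ≤ (S.card : ℝ) / 2 := Nat.cast_div_le
      linarith
    refine (card_cube_le_sum_closePairs (by linarith) hSa hi hk hM).trans ?_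
    gcongr with m hm
    intro x hx
    simp only [closePairs, Finset.mem_filter, Finset.mem_offDiag, hSdef] at hx ⊢
    obtain ⟨⟨⟨h1, h1'⟩, ⟨h2, h2'⟩, h3⟩, h4⟩ := hx
    exact ⟨⟨⟨h1, h2, h3⟩, h4⟩, lineOf_eq_of_mem h1' h2' h3⟩
  refine h1.trans ((Finset.sum_le_sum h2).trans_eq ?_)
  rw [← Finset.mul_sum, Finset.sum_comm]
  congr 1
  refine Finset.sum_congr rfl fun m _ => ?_
  rw [← Finset.mul_sum]
  refine congrArg (m * ·) (Finset.card_eq_sum_card_fiberwise fun x hx => ?_).symm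
  exact Finset.mem_coe.2 (Finset.mem_image_of_mem lineOf
    (Finset.mem_filter.1 (Finset.mem_coe.1 hx)).1)

lemma card_closePairs_le {b : ℝ} {P : Finset (Pt 3)} (hP : WellSeparated b P) (hb : 0 ≤ b)
    {D : ℝ} (hD : 0 ≤ D) (hPD : D ^ 3 = P.card) {m : ℕ} (hm : 0 < m) {β : ℝ}
    (hmD : (m : ℝ) ≤ β * D) :
    m * ((closePairs P (D / m)).card : ℝ) ≤
      b * (2 + β) ^ 3 * (P.card : ℝ) ^ 2 * ((m : ℝ) ^ 2)⁻¹ := by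
  have hm' : (0 : ℝ) < m := by exact_mod_cast hm
  have h1 : (closePairs P (D / m)).card ≤
      ∑ p ∈ P, (P.filter fun q => ∀ j, |p j - q j| ≤ D / m).card := by
    rw [← card_filter_product_eq_sum P P fun p q => ∀ j, |p j - q j| ≤ D / m]
    exact Finset.card_le_card (Finset.filter_subset_filter _ fun x hx => by
      rw [Finset.mem_offDiag] at hx
      exact Finset.mem_product.2 ⟨hx.1, hx.2.1⟩)
  have h2 : ((∑ p ∈ P, (P.filter fun q => ∀ j, |p j - q j| ≤ D / m).card : ℕ) : ℝ)
      ≤ P.card * (b * ((2 + β) * (D / m)) ^ 3) := by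
    push_cast
    rw [← nsmul_eq_mul]
    refine Finset.sum_le_card_nsmul _ _ _ fun p _ => ?_
    refine (card_close_le hP hb p (by positivity)).trans ?_
    have : 1 ≤ β * (D / m) := by
      rw [← mul_div_assoc, le_div_iff₀ hm', one_mul]
      exact hmD
    gcongr
    linarith
  calc m * ((closePairs P (D / m)).card : ℝ)
      ≤ m * (P.card * (b * ((2 + β) * (D / m)) ^ 3)) := by
        gcongr
        exact (Nat.cast_le.2 h1).trans h2
    _ = b * (2 + β) ^ 3 * P.card * D ^ 3 * ((m : ℝ) ^ 2)⁻¹ := by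
        field_simp
    _ = _ := by rw [hPD]; ring

lemma card_collinearTriples_le {b : ℝ} (hb : 0 ≤ b) {P : Finset (Pt 3)}
    (hP : IsHomogeneous b P) (hn : 0 < P.card) :
    ((collinearTriples P).card : ℝ) ≤ 12 * (b * (2 + 27 * b) ^ 3) * (P.card : ℝ) ^ 2 := by
  obtain ⟨⟨a, ha⟩, hW⟩ := hP
  have hn' : (1 : ℝ) ≤ P.card := by exact_mod_cast hn
  set D : ℝ := (P.card : ℝ) ^ (1 / ((3 : ℕ) : ℝ)) with hDdef
  have hD : 1 ≤ D := Real.one_le_rpow hn' (by positivity)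
  have hD3 : D ^ 3 = P.card := by
    rw [hDdef, one_div]
    exact Real.rpow_inv_natCast_pow (by positivity) (by norm_num)
  have h1 : ((collinearTriples P).card : ℝ) ≤
      6 * ∑ m ∈ Finset.Ioo 0 (⌊b * 3 ^ 3 * D⌋₊ + 1),
        (m : ℝ) * ((closePairs P (D / m)).card : ℝ) := by
    exact_mod_cast card_collinearTriples_le_sum hW hb hD ha
  have h2 : ∑ m ∈ Finset.Ioo 0 (⌊b * 3 ^ 3 * D⌋₊ + 1),
      (m : ℝ) * ((closePairs P (D / m)).card : ℝ) ≤
      ∑ m ∈ Finset.Ioo 0 (⌊b * 3 ^ 3 * D⌋₊ + 1),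
        b * (2 + 27 * b) ^ 3 * (P.card : ℝ) ^ 2 * ((m : ℝ) ^ 2)⁻¹ := by
    refine Finset.sum_le_sum fun m hm => ?_
    rw [Finset.mem_Ioo] at hm
    refine card_closePairs_le hW hb (by linarith) hD3 hm.1 ?_
    have h := (Nat.le_floor_iff (by positivity)).1 (Nat.lt_add_one_iff.1 hm.2)
    linarith
  have h3 := sum_Ioo_inv_sq_le (α := ℝ) 0 (⌊b * 3 ^ 3 * D⌋₊ + 1)
  rw [← Finset.mul_sum] at h2
  norm_num at h3
  have h4 : (0 : ℝ) ≤ b * (2 + 27 * b) ^ 3 * (P.card : ℝ) ^ 2 := by positivity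
  norm_num at h1 h2
  nlinarith [mul_le_mul_of_nonneg_left h3 h4]

lemma card_collinearTriples_eq_sum {d : ℕ} (P : Finset (Pt d)) :
    (collinearTriples P).card = ∑ p ∈ P, ((P.erase p ×ˢ P.erase p).filter
      fun x => lineOf (p, x.1) = lineOf (p, x.2)).card := by
  refine (card_filter_product_eq_sum P (P ×ˢ P) fun p x =>
    x.1 ≠ p ∧ x.2 ≠ p ∧ lineOf (p, x.1) = lineOf (p, x.2)).trans
    (Finset.sum_congr rfl fun p _ => congrArg Finset.card ?_)
  ext x
  simp only [Finset.mem_filter, Finset.mem_product, Finset.mem_erase]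
  tauto

/-- In every large enough `b`-homogeneous set `P` of `n` points in `ℝ³`,
there is a subset `P₀` of at least `c·n` points each of which lies on at least `c·n`
distinct lines spanned together with other points of `P`. -/
theorem many_points_on_many_lines (b : ℝ) (hb : 0 < b) :
    ∃ c : ℝ, 0 < c ∧ ∃ n₀ : ℕ,
      ∀ P : Finset (Pt 3), IsHomogeneous b P → n₀ ≤ P.card →
        ∃ P₀ : Finset (Pt 3), P₀ ⊆ P ∧ c * (P.card : ℝ) ≤ (P₀.card : ℝ) ∧
          ∀ p ∈ P₀,
            c * (P.card : ℝ) ≤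
              ({L : AffineSubspace ℝ (Pt 3) |
                  ∃ q ∈ P, q ≠ p ∧ L = affineSpan ℝ ({p, q} : Set (Pt 3))}.ncard : ℝ) := by
  have hB : 0 < b * (2 + 27 * b) ^ 3 := by positivity
  set B := b * (2 + 27 * b) ^ 3
  refine ⟨min (1 / 2) (1 / (96 * B)), by positivity, 2, fun P hP hn => ?_⟩
  have hn' : (2 : ℝ) ≤ P.card := by exact_mod_cast hn
  set T : Pt 3 → ℕ := fun p => ((P.erase p ×ˢ P.erase p).filter
    fun x => lineOf (p, x.1) = lineOf (p, x.2)).card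
  have hsum : ∑ p ∈ P, (T p : ℝ) ≤ 12 * B * (P.card : ℝ) ^ 2 := by
    have h := card_collinearTriples_le hb.le hP (by omega)
    rw [card_collinearTriples_eq_sum] at h
    exact_mod_cast h
  have hpos : 0 < 24 * B * (P.card : ℝ) := by positivity
  refine ⟨P.filter fun p => (T p : ℝ) ≤ 24 * B * P.card, Finset.filter_subset _ _, ?_, ?_⟩
  · have hbad : ((P.filter fun p => ¬ (T p : ℝ) ≤ 24 * B * P.card).card : ℝ) ≤ P.card / 2 := by
      have h1 : ((P.filter fun p => ¬ (T p : ℝ) ≤ 24 * B * P.card).card : ℝ)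
          * (24 * B * P.card) ≤ ∑ p ∈ P, (T p : ℝ) := by
        rw [← nsmul_eq_mul]
        refine (Finset.card_nsmul_le_sum _ (fun p => (T p : ℝ)) _ fun p hp => ?_).trans
          (Finset.sum_le_sum_of_subset_of_nonneg (Finset.filter_subset _ P)
            fun _ _ _ => Nat.cast_nonneg _)
        exact (not_le.1 (Finset.mem_filter.1 hp).2).le
      refine le_of_mul_le_mul_right ((h1.trans hsum).trans_eq ?_) hpos
      ring
    have htot : ((P.filter fun p => (T p : ℝ) ≤ 24 * B * P.card).card : ℝ)
        + ((P.filter fun p => ¬ (T p : ℝ) ≤ 24 * B * P.card).card : ℝ) = P.card := by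
      exact_mod_cast Finset.card_filter_add_card_filter_not (s := P)
        (fun p => (T p : ℝ) ≤ 24 * B * P.card)
    have hc : min (1 / 2) (1 / (96 * B)) * (P.card : ℝ) ≤ 1 / 2 * P.card := by
      gcongr
      exact min_le_left _ _
    linarith
  · intro p hp
    obtain ⟨hpP, hTp⟩ := Finset.mem_filter.1 hp
    have hset : {L : AffineSubspace ℝ (Pt 3) |
        ∃ q ∈ P, q ≠ p ∧ L = affineSpan ℝ ({p, q} : Set (Pt 3))} =
        (((P.erase p).image fun q => lineOf (p, q) : Finset _) :
          Set (AffineSubspace ℝ (Pt 3))) := by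
      ext L
      simp only [Set.mem_ofPred_eq, Finset.coe_image, Set.mem_image, Finset.mem_coe,
        Finset.mem_erase, lineOf]
      constructor
      · rintro ⟨q, h1, h2, rfl⟩
        exact ⟨q, ⟨h2, h1⟩, rfl⟩
      · rintro ⟨q, ⟨h2, h1⟩, rfl⟩
        exact ⟨q, h1, h2, rfl⟩
    rw [hset, Set.ncard_coe_finset]
    set ℓ := ((P.erase p).image fun q => lineOf (p, q)).card
    have h1 : ((P.card : ℝ) - 1) ^ 2 ≤ ℓ * T p := by
      have h := card_sq_le_card_image_mul_card_filter (P.erase p) fun q => lineOf (p, q)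
      have he := Finset.card_erase_add_one hpP
      have he' : (P.card : ℝ) - 1 = ((P.erase p).card : ℝ) := by
        rw [← he]; push_cast; ring
      rw [he']
      exact_mod_cast h
    have h2 : (P.card : ℝ) / (96 * B) ≤ ℓ := by
      rw [div_le_iff₀ (by positivity)]
      have h3 : ((P.card : ℝ) - 1) ^ 2 ≤ ℓ * (24 * B * P.card) :=
        h1.trans (by gcongr)
      refine le_of_mul_le_mul_right ?_ (by linarith : (0 : ℝ) < P.card)
      nlinarith
    calc min (1 / 2) (1 / (96 * B)) * (P.card : ℝ) ≤ 1 / (96 * B) * P.card := by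
          gcongr
          exact min_le_right _ _
      _ = (P.card : ℝ) / (96 * B) := by ring
      _ ≤ ℓ := h2
end
end
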